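/- Let 0 \le \beta < 1/2. Let \rho be a smooth, even, compactly supported function on \mathbb{R}^4 with \int_{\mathbb{R}^4}\rho = 1, set \eta(x) = \rho(x) - 2^{-|s|}\rho(2^{-1}\cdot x), and assume there exists \xi_0\in\mathbb{R}^4 such that |\hat{\eta}(\xi_0)| - \sum_{n\in\mathbb{Z}\setminus\{0\}} 2^{-n\beta}|\hat{\eta}(2^{-n}\cdot\xi_0)| > 0. Let (\alpha_n)_{n\ge 0} be a bounded real sequence with \limsup_{n\to\infty} 2^{n\beta}|\alpha_n| \in (0,\infty). Set R_0 = \alpha_0\rho, R_n = \alpha_n\,\eta^{2^{-n}} for n \ge 1 (where \eta^{\lambda}(y) = \lambda^{-|s|}\eta(\lambda^{-1}\cdot y)), and \hat{R} = \sum_{n\ge 0}\hat{R}_n. Then there exists C \ge 1 such that \limsup_{n\to\infty} 2^{3n\beta} \sup_{(\xi,\xi')\in B_n^C} |\hat{R}(\xi)\hat{R}(\xi')\hat{R}(\xi+\xi')| > 0, i.e., Assumption Rough holds. -/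

import Mathlib

open MeasureTheory Filter Topology

noncomputable section

/-- Parabolic scaling exponents s = (2,1,1,1). -/
def sExp : Fin 4 → ℕ := ![2, 1, 1, 1]

/-- Parabolically scaled norm |z|_s = max_i |z_i|^(1/s_i). -/
def snorm4 (z : Fin 4 → ℝ) : ℝ := ⨆ i, |z i| ^ ((sExp i : ℝ)⁻¹)

/-- Scaling action l · z = (l^(s_i) z_i)_i. -/
def scl (l : ℝ) (z : Fin 4 → ℝ) : Fin 4 → ℝ := fun i => l ^ (sExp i) * z i

/-- Scaled size |k|_s = ∑ s_i k_i of a multi-index. -/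
def ksize (k : Fin 4 → ℕ) : ℝ := ∑ i, (sExp i : ℝ) * (k i : ℝ)

/-- Partial derivative in direction i. -/
def pderiv1 (i : Fin 4) (f : (Fin 4 → ℝ) → ℝ) : (Fin 4 → ℝ) → ℝ :=
  fun z => fderiv ℝ f z (Pi.single i 1)

/-- Iterated partial derivative ∂^k. -/
def pderivM (k : Fin 4 → ℕ) (f : (Fin 4 → ℝ) → ℝ) : (Fin 4 → ℝ) → ℝ :=
  ((pderiv1 0)^[k 0] ∘ (pderiv1 1)^[k 1] ∘ (pderiv1 2)^[k 2] ∘ (pderiv1 3)^[k 3]) f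

/-- Assumption R from the paper: the R_n are even smooth functions, R_n is supported in a
parabolic ball of radius C₀ 2^(-n), the derivative ∂^k R_n is bounded by
C_k 2^(n(|s| + |k|_s - β)) (with |s| = 5), and if β = 0 then R_n integrates to zero
for n ≥ 1. -/
structure AssumptionR (R : ℕ → (Fin 4 → ℝ) → ℝ) (β : ℝ) : Prop where
  beta_nonneg : 0 ≤ β
  even : ∀ n z, R n (-z) = R n z
  smooth : ∀ n, ContDiff ℝ (⊤ : ℕ∞) (R n)
  support : ∃ C0 > 0, ∀ n z, R n z ≠ 0 → snorm4 z ≤ C0 * (2 : ℝ) ^ (-(n : ℝ))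
  deriv_bound : ∀ k : Fin 4 → ℕ, ∃ Ck > 0, ∀ n z,
    |pderivM k (R n) z| ≤ Ck * (2 : ℝ) ^ ((n : ℝ) * (5 + ksize k - β))
  mean_zero : β = 0 → ∀ n, 1 ≤ n → (∫ z, R n z) = 0

/-- Fourier transform on ℝ⁴ with convention e^(-i⟨ξ,z⟩). -/
def ft (f : (Fin 4 → ℝ) → ℝ) (ξ : Fin 4 → ℝ) : ℂ :=
  ∫ z : Fin 4 → ℝ, Complex.exp (-Complex.I * ((∑ i, ξ i * z i : ℝ) : ℂ)) * (f z : ℂ)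

/-- The parabolic annulus A_n^C. -/
def AnC (C : ℝ) (n : ℕ) : Set (Fin 4 → ℝ) :=
  {ξ | C⁻¹ * 2 ^ n ≤ snorm4 ξ ∧ snorm4 ξ ≤ C * 2 ^ n}

/-- The set B_n^C. -/
def BnC (C : ℝ) (n : ℕ) : Set ((Fin 4 → ℝ) × (Fin 4 → ℝ)) :=
  {p | p.1 ∈ AnC C n ∧ p.2 ∈ AnC C n ∧ p.1 + p.2 ∈ AnC C n}

/-- Integration of a nonnegative function against the measure m̂, given by
(1/2π) ∫ dξ₀ ∑_(k ∈ ℤ³) f(ξ₀, 2πk₁, 2πk₂, 2πk₃). -/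
def mIntegral (f : (Fin 4 → ℝ) → ENNReal) : ENNReal :=
  ENNReal.ofReal (1 / (2 * Real.pi)) *
    ∫⁻ t : ℝ, ∑' k : Fin 3 → ℤ, f (Fin.cons t (fun j => 2 * Real.pi * (k j : ℝ)))

/-- The family R₀ = α₀ ρ, Rₙ = αₙ η^(2^(-n)) for n ≥ 1, where
η^λ(y) = λ^(-|s|) η(λ⁻¹ · y), i.e. η^(2^(-n))(y) = 2^(5n) η(2ⁿ · y). -/
def famPL (α : ℕ → ℝ) (ρ η : (Fin 4 → ℝ) → ℝ) : ℕ → (Fin 4 → ℝ) → ℝ :=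
  fun n => if n = 0 then (fun z => α 0 * ρ z)
    else (fun z => α n * ((2 : ℝ) ^ (5 * n) * η (scl ((2 : ℝ) ^ n) z)))

theorem exists_sum_mul_eq_one_of_no_common_zero {𝔸 : Type*} [NormedRing 𝔸] [NormedAlgebra ℂ 𝔸]
    [CompleteSpace 𝔸] {ι : Type*} (B : 𝔸) (a : ι → ℕ → ℂ)
    (ha : ∀ i, Summable fun j => ‖a i j • B ^ j‖)
    (hz : ∀ l : ℂ, ‖l‖ ≤ ‖B‖ * ‖(1 : 𝔸)‖ → ∃ i, ∑' j, a i j * l ^ j ≠ 0) :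
    ∃ (s : Finset ι) (u : ι → 𝔸), ∑ i ∈ s, u i * ∑' j, a i j • B ^ j = 1 := by
  let S := Algebra.elemental ℂ B
  let _ : NormedCommRing S := { (inferInstance : NormedRing S) with
    mul_comm := mul_comm }
  let _ : NormedAlgebra ℂ S := inferInstance
  have hcl : IsClosed (S : Set 𝔸) := Algebra.elemental.isClosed ℂ B
  have : CompleteSpace S := hcl.completeSpace_coe
  let b : S := ⟨B, Algebra.elemental.self_mem ℂ B⟩
  have hs : ∀ i, Summable fun j => a i j • b ^ j := fun i =>
    Summable.of_norm (ha i)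
  let y : ι → S := fun i => ∑' j, a i j • b ^ j
  have hy : ∀ i, ((y i : S) : 𝔸) = ∑' j, a i j • B ^ j := fun i => by
    exact (hs i).map_tsum S.val.toLinearMap.toAddMonoidHom continuous_subtype_val
  have htop : Ideal.span (Set.range y) = ⊤ := by
    by_contra hne
    obtain ⟨M, hM, hle⟩ := Ideal.exists_le_maximal _ hne
    let χ := M.toCharacterSpace
    have hχ : ∀ i, χ (y i) = 0 := fun i =>
      M.toCharacterSpace_apply_eq_zero_of_mem (hle (Ideal.subset_span ⟨i, rfl⟩))
    have hb : ‖χ b‖ ≤ ‖B‖ * ‖(1 : 𝔸)‖ :=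
      spectrum.norm_le_norm_mul_of_mem (A := S) (a := b) (AlgHom.apply_mem_spectrum χ b)
    obtain ⟨i, hi⟩ := hz _ hb
    apply hi
    rw [← hχ i]
    have := (hs i).map_tsum χ (map_continuous χ)
    rw [this]
    simp
  have h1 : (1 : S) ∈ Ideal.span (Set.range y) := htop ▸ Submodule.mem_top
  obtain ⟨c, hc⟩ := (Finsupp.mem_ideal_span_range_iff_exists_finsupp).1 h1
  refine ⟨c.support, fun i => c i, ?_⟩
  have := congrArg (Subtype.val) hc
  simp only [Finsupp.sum] at this
  simp_rw [← hy]
  simpa using this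

/-- The weighted left shift `(v_j) ↦ (θ v_{j+1})` on bounded sequences. -/
def weightedShift (θ : ℝ) : (lp (fun _ : ℕ => ℂ) ⊤) →L[ℂ] (lp (fun _ : ℕ => ℂ) ⊤) :=
  LinearMap.mkContinuous
    { toFun := fun v => ⟨fun j => (θ : ℂ) * v (j + 1), by
        refine memℓp_infty ⟨|θ| * ‖v‖, ?_⟩
        rintro _ ⟨j, rfl⟩
        simp only [norm_mul, Complex.norm_real, Real.norm_eq_abs]
        gcongr
        exact lp.norm_apply_le_norm (by simp) v (j + 1)⟩
      map_add' := fun v w => by ext j; exact mul_add _ _ _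
      map_smul' := fun c v => by ext j; simp [mul_left_comm] } |θ| (fun v => by
        refine lp.norm_le_of_forall_le (by positivity) fun j => ?_
        simp only [LinearMap.coe_mk, AddHom.coe_mk, norm_mul, Complex.norm_real, Real.norm_eq_abs]
        gcongr
        exact lp.norm_apply_le_norm (by simp) v (j + 1))

theorem weightedShift_apply (θ : ℝ) (v : lp (fun _ : ℕ => ℂ) ⊤) (j : ℕ) :
    weightedShift θ v j = (θ : ℂ) * v (j + 1) := rfl

theorem weightedShift_pow_apply (θ : ℝ) (n : ℕ) (v : lp (fun _ : ℕ => ℂ) ⊤) (j : ℕ) :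
    (weightedShift θ ^ n) v j = (θ : ℂ) ^ n * v (j + n) := by
  induction n generalizing j with
  | zero => simp
  | succ n ih =>
    rw [pow_succ']
    change weightedShift θ ((weightedShift θ ^ n) v) j = _
    rw [weightedShift_apply, ih]
    rw [show j + 1 + n = j + (n + 1) by ring]; ring

theorem norm_weightedShift_le {θ : ℝ} (hθ : 0 ≤ θ) : ‖weightedShift θ‖ ≤ θ :=
  (LinearMap.mkContinuous_norm_le _ (abs_nonneg θ) _).trans (abs_of_nonneg hθ).le

/-- If the symbols `∑ aᵢⱼ zʲ` have no common zero in the disc of radius `θ`, then finitely many of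
the corresponding Hankel-type convolutions control a bounded sequence. -/
theorem exists_bound_of_no_common_zero {ι : Type*} {θ : ℝ} (hθ : 0 ≤ θ) (a : ι → ℕ → ℂ)
    (ha : ∀ i, Summable fun j => ‖a i j‖ * θ ^ j)
    (hz : ∀ l : ℂ, ‖l‖ ≤ θ → ∃ i, ∑' j, a i j * l ^ j ≠ 0) :
    ∃ (s : Finset ι) (C : ℝ), 0 ≤ C ∧ ∀ (v : ℕ → ℂ) (D : ℝ), 0 ≤ D →
      (∃ K, ∀ j, ‖v j‖ ≤ K) →
      (∀ i ∈ s, ∀ q, ‖∑' j, a i j * ((θ : ℂ) ^ j * v (q + j))‖ ≤ D) → ∀ q, ‖v q‖ ≤ C * D := by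
  have hpow : ∀ n, ‖weightedShift θ ^ n‖ ≤ θ ^ n := fun n => by
    refine ContinuousLinearMap.opNorm_le_bound _ (by positivity) fun v => ?_
    refine lp.norm_le_of_forall_le (by positivity) fun j => ?_
    rw [weightedShift_pow_apply, norm_mul, norm_pow, Complex.norm_real, Real.norm_of_nonneg hθ]
    gcongr
    exact lp.norm_apply_le_norm (by simp) v _
  have hsum : ∀ i, Summable fun j => ‖a i j • weightedShift θ ^ j‖ := fun i => by
    refine (ha i).of_nonneg_of_le (fun j => norm_nonneg _) fun j => ?_
    rw [norm_smul]
    gcongr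
    exact hpow j
  obtain ⟨s, u, hu⟩ := exists_sum_mul_eq_one_of_no_common_zero (weightedShift θ) a hsum
    (fun l hl => hz l (hl.trans (by
      refine (mul_le_mul (norm_weightedShift_le hθ) ContinuousLinearMap.norm_id_le
        (norm_nonneg _) hθ).trans (mul_one θ).le)))
  refine ⟨s, ∑ i ∈ s, ‖u i‖, by positivity, fun v D hD ⟨K, hK⟩ hv q => ?_⟩
  let V : lp (fun _ : ℕ => ℂ) ⊤ := ⟨v, memℓp_infty ⟨K, by rintro _ ⟨j, rfl⟩; exact hK j⟩⟩
  have hY : ∀ i ∈ s, ‖(∑' j, a i j • weightedShift θ ^ j) V‖ ≤ D := fun i hi => by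
    refine lp.norm_le_of_forall_le hD fun q => ?_
    have hs : Summable fun j => a i j • weightedShift θ ^ j := (hsum i).of_norm
    let ev : ((lp (fun _ : ℕ => ℂ) ⊤) →L[ℂ] (lp (fun _ : ℕ => ℂ) ⊤)) →L[ℂ] ℂ :=
      (lp.evalCLM ℂ (fun _ : ℕ => ℂ) ⊤ q).comp (ContinuousLinearMap.apply ℂ _ V)
    have h2 := hs.map_tsum ev ev.continuous
    have h3 : ev (∑' j, a i j • weightedShift θ ^ j) =
      (∑' j, a i j • weightedShift θ ^ j) V q := rfl
    rw [← h3, h2]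
    have h4 : ∀ j, ev (a i j • weightedShift θ ^ j) = a i j * ((θ : ℂ) ^ j * v (q + j)) :=
      fun j => by
        rw [map_smul, smul_eq_mul]
        congr 1
        exact weightedShift_pow_apply θ j V q
    simp_rw [h4]
    exact hv i hi q
  have h1 : V = ∑ i ∈ s, u i ((∑' j, a i j • weightedShift θ ^ j) V) := by
    have := congrArg (fun T => T V) hu
    simpa [sum_apply] using this.symm
  calc ‖v q‖ = ‖V q‖ := rfl
    _ ≤ ‖V‖ := lp.norm_apply_le_norm (by simp) V q
    _ = ‖∑ i ∈ s, u i ((∑' j, a i j • weightedShift θ ^ j) V)‖ := by rw [← h1]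
    _ ≤ ∑ i ∈ s, ‖u i‖ * D := (norm_sum_le _ _).trans (Finset.sum_le_sum fun i hi =>
        ((u i).le_opNorm _).trans (by gcongr; exact hY i hi))
    _ = _ := by rw [Finset.sum_mul]

/-- Fourier transform on `ℝ` with the convention `e^(-iτt)`. -/
def ftLine (f : ℝ → ℂ) (τ : ℝ) : ℂ := ∫ t : ℝ, Complex.exp (-Complex.I * (τ * t : ℝ)) * f t

/-- The heat profile `e^(-y² / (4 * a))`. -/
def heat (a y : ℝ) : ℝ := Real.exp (-y ^ 2 / (4 * a))

theorem summable_pow_natAbs {q : ℝ} (h0 : 0 ≤ q) (h1 : q < 1) :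
    Summable fun k : ℤ => q ^ k.natAbs := by
  refine Summable.of_nat_of_neg ?_ ?_ <;> simpa using summable_geometric_of_lt_one h0 h1

/-- A dyadic series with coefficients growing slower than `2^|k|`, against a function which is
`O(min(s, s⁻¹))`. -/
theorem norm_mul_le_pow_natAbs_half {θ A C x y : ℝ} (hθ1 : 1 ≤ θ) {k : ℤ}
    (hA : 0 ≤ A) (hx' : x ≤ A * θ ^ (-k)) (hy : 0 ≤ y) {w : ℝ}
    (h1 : 0 ≤ k → y ≤ C * (2 : ℝ) ^ (-k) * w) (h2 : k ≤ 0 → y ≤ C * (2 : ℝ) ^ k * w) :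
    x * y ≤ A * C * w * (θ / 2) ^ k.natAbs := by
  have hθ : 0 < θ := by linarith
  have hpow : (θ / 2) ^ k.natAbs = θ ^ k.natAbs * ((2 : ℝ) ^ k.natAbs)⁻¹ := by
    rw [div_pow, div_eq_mul_inv]
  rw [hpow]
  rcases Int.natAbs_eq k with hk | hk
  · have e1 : (2 : ℝ) ^ (-k) = ((2 : ℝ) ^ k.natAbs)⁻¹ := by
      conv_lhs => rw [hk]
      simp only [zpow_neg, zpow_natCast]
    have e2 : θ ^ (-k) ≤ θ ^ k.natAbs := by
      rw [← zpow_natCast]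
      exact zpow_le_zpow_right₀ hθ1 (by omega)
    calc x * y ≤ (A * θ ^ k.natAbs) * (C * ((2 : ℝ) ^ k.natAbs)⁻¹ * w) := by
          have h1 := h1 (by omega)
          rw [e1] at h1
          gcongr
          exact hx'.trans (by gcongr)
      _ = _ := by ring
  · have e1 : (2 : ℝ) ^ k = ((2 : ℝ) ^ k.natAbs)⁻¹ := by
      conv_lhs => rw [hk]
      simp only [zpow_neg, zpow_natCast]
    have e2 : θ ^ (-k) = θ ^ k.natAbs := by
      conv_lhs => rw [hk]
      simp only [neg_neg, zpow_natCast]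
    calc x * y ≤ (A * θ ^ k.natAbs) * (C * ((2 : ℝ) ^ k.natAbs)⁻¹ * w) := by
          have h2 := h2 (by omega)
          rw [e1] at h2; rw [e2] at hx'
          gcongr
      _ = _ := by ring

theorem integrable_abs_rpow_mul_exp_neg_sq {s : ℝ} (hs : -1 < s) :
    Integrable fun x : ℝ => |x| ^ s * Real.exp (-x ^ 2) := by
  have h := integrableOn_rpow_mul_exp_neg_mul_sq one_pos hs
  have h' : IntegrableOn (fun x : ℝ => |x| ^ s * Real.exp (-x ^ 2)) (Set.Ioi 0) := by
    refine h.congr_fun (fun x hx => ?_) measurableSet_Ioi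
    simp [abs_of_pos (Set.mem_Ioi.1 hx)]
  rw [← integrableOn_univ, ← @Set.Iio_union_Ici _ _ (0 : ℝ), integrableOn_union,
    integrableOn_Ici_iff_integrableOn_Ioi]
  refine ⟨?_, h'⟩
  rw [← (Measure.measurePreserving_neg (volume : Measure ℝ)).integrableOn_comp_preimage
      (Homeomorph.neg ℝ).measurableEmbedding]
  simpa [Function.comp_def] using h'

theorem heat_nonneg (a y : ℝ) : 0 ≤ heat a y := (Real.exp_pos _).le

theorem continuous_heat (a : ℝ) : Continuous (heat a) := by unfold heat; fun_prop

theorem heat_eq (a y : ℝ) : heat a y = Real.exp (-(1 / (4 * a)) * y ^ 2) := by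
  unfold heat; congr 1; ring

theorem integrable_heat {a : ℝ} (ha : 0 < a) : Integrable (heat a) := by
  simp_rw [funext (heat_eq a)]
  exact integrable_exp_neg_mul_sq (by positivity)

theorem integral_heat {a : ℝ} (ha : 0 < a) : ∫ y, heat a y = √(4 * Real.pi * a) := by
  simp_rw [funext (heat_eq a)]
  rw [integral_gaussian]
  congr 1; field_simp

theorem integral_exp_mul_gaussian {a : ℝ} (ha : 0 < a) (y : ℝ) :
    ∫ τ : ℝ, Complex.exp (Complex.I * (τ * y : ℝ)) * (Real.exp (-a * τ ^ 2) : ℂ) =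
      √(Real.pi / a) * heat a y := by
  have h := fourierIntegral_gaussian (b := (a : ℂ)) (by simpa using ha) (y : ℂ)
  have e1 : ((Real.pi : ℂ) / a) ^ (1 / 2 : ℂ) = ((√(Real.pi / a) : ℝ) : ℂ) := by
    rw [Real.sqrt_eq_rpow, Complex.ofReal_cpow (by positivity)]
    simp
  have e2 : Complex.exp (-(y : ℂ) ^ 2 / (4 * a)) = ((heat a y : ℝ) : ℂ) := by
    simp [heat]
  rw [← e1, ← e2, ← h]
  congr 1; ext τ
  push_cast
  congr 2; ring

theorem exists_norm_le_of_compact_support {μ : ℝ → ℂ} (hμ : Continuous μ) {e : ℝ}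
    (he : ∀ t, e < |t| → μ t = 0) : ∃ M, 0 ≤ M ∧ ∀ t, ‖μ t‖ ≤ M := by
  have hc : HasCompactSupport μ := HasCompactSupport.intro (isCompact_Icc (a := -e) (b := e))
    fun t ht => he t (by
      by_contra h
      exact ht (abs_le.1 (not_lt.1 h)))
  obtain ⟨M, hM⟩ := hc.exists_bound_of_continuous hμ
  exact ⟨M, (norm_nonneg _).trans (hM 0), hM⟩

theorem integrable_of_compact_support {μ : ℝ → ℂ} (hμ : Continuous μ) {e : ℝ}
    (he : ∀ t, e < |t| → μ t = 0) : Integrable μ :=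
  hμ.integrable_of_hasCompactSupport (HasCompactSupport.intro (isCompact_Icc (a := -e) (b := e))
    fun t ht => he t (by
      by_contra h
      exact ht (abs_le.1 (not_lt.1 h))))

theorem integral_gaussian_mul_ftLine {μ : ℝ → ℂ} (hμ : Continuous μ) (hi : Integrable μ)
    {a : ℝ} (ha : 0 < a) (x l : ℝ) :
    ∫ τ : ℝ, Complex.exp (Complex.I * (τ * x : ℝ)) * (Real.exp (-a * τ ^ 2) : ℂ) *
      ftLine μ (l * τ) = √(Real.pi / a) * ∫ u, μ u * heat a (x - l * u) := by
  have h1 : ∀ τ : ℝ, Complex.exp (Complex.I * (τ * x : ℝ)) * (Real.exp (-a * τ ^ 2) : ℂ) *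
      ftLine μ (l * τ) = ∫ u, μ u * (Complex.exp (Complex.I * (τ * (x - l * u) : ℝ)) *
        (Real.exp (-a * τ ^ 2) : ℂ)) := fun τ => by
    unfold ftLine
    rw [← integral_const_mul]
    congr 1; ext u
    rw [show Complex.I * (τ * (x - l * u) : ℝ) = Complex.I * (τ * x : ℝ) +
      -Complex.I * (l * τ * u : ℝ) by push_cast; ring, Complex.exp_add]
    ring
  simp_rw [h1]
  rw [integral_integral_swap]
  · simp_rw [integral_const_mul, integral_exp_mul_gaussian ha]
    rw [← integral_const_mul]
    congr 1; ext u; ring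
  · have hg : Integrable fun τ : ℝ => (Real.exp (-a * τ ^ 2) : ℂ) :=
      (integrable_exp_neg_mul_sq ha).ofReal
    refine (hg.mul_prod hi).mono ?_ (ae_of_all _ fun p => ?_)
    · refine Continuous.aestronglyMeasurable ?_
      unfold Function.uncurry
      fun_prop
    · simp only [Function.uncurry, norm_mul]
      rw [mul_comm Complex.I, Complex.norm_exp_ofReal_mul_I]
      exact le_of_eq (by ring)

theorem continuous_ftLine {μ : ℝ → ℂ} (hi : Integrable μ) : Continuous (ftLine μ) := by
  unfold ftLine
  refine continuous_of_dominated (bound := fun t => ‖μ t‖) (fun τ => ?_) (fun τ => ?_) hi.norm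
    (ae_of_all _ fun t => by fun_prop)
  · exact (Continuous.aestronglyMeasurable (by fun_prop)).mul hi.aestronglyMeasurable
  · refine ae_of_all _ fun t => ?_
    rw [norm_mul, show -Complex.I * (τ * t : ℝ) = ((-(τ * t) : ℝ) : ℂ) * Complex.I by
      push_cast; ring, Complex.norm_exp_ofReal_mul_I, one_mul]

theorem norm_mul_ftLine_le {μ : ℝ → ℂ} {c : ℤ → ℂ} {A θ C : ℝ} (hA : 0 ≤ A) (hθ : 1 ≤ θ)
    (hc : ∀ k, ‖c k‖ ≤ A * θ ^ (-k)) (h1 : ∀ s, ‖ftLine μ s‖ ≤ C * |s|)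
    (h2 : ∀ s, ‖ftLine μ s‖ * |s| ≤ C) (k : ℤ) (τ : ℝ) :
    ‖c k * ftLine μ ((4 : ℝ) ^ (-k) * τ)‖ ≤
      A * C * (|τ| + |τ| ^ (-(1 / 2) : ℝ)) * (θ / 2) ^ k.natAbs := by
  have hC : 0 ≤ C := by simpa using (norm_nonneg _).trans (h1 1)
  have hr : 0 ≤ |τ| ^ (-(1 / 2) : ℝ) := by positivity
  rw [norm_mul]
  refine norm_mul_le_pow_natAbs_half hθ hA (hc k) (norm_nonneg _) (fun hk => ?_) fun hk => ?_
  · refine (h1 _).trans ?_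
    rw [abs_mul, abs_of_pos (by positivity), mul_assoc]
    have h42 : (4 : ℝ) ^ (-k) ≤ 2 ^ (-k) := by
      obtain ⟨n, rfl⟩ := Int.eq_ofNat_of_zero_le hk
      rw [zpow_neg, zpow_neg, zpow_natCast, zpow_natCast]
      gcongr
      norm_num
    gcongr
    linarith
  · set s := (4 : ℝ) ^ (-k) * τ with hs
    have key : ‖ftLine μ s‖ ≤ C * |s| ^ (-(1 / 2) : ℝ) := by
      rcases le_or_gt 1 |s| with h | h
      · have h3 : ‖ftLine μ s‖ ≤ C * |s| ^ (-1 : ℝ) := by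
          rw [Real.rpow_neg_one, ← div_eq_mul_inv, le_div_iff₀ (by linarith)]
          exact h2 s
        refine h3.trans ?_
        gcongr 2
        norm_num
      · rcases (abs_nonneg s).eq_or_lt with h0 | h0
        · have := h1 s
          rw [← h0] at this ⊢
          simpa using this
        · refine (h1 s).trans ?_
          gcongr
          exact h.le.trans (Real.one_le_rpow_of_pos_of_le_one_of_nonpos h0 h.le (by norm_num))
    refine key.trans ?_
    rw [hs, abs_mul, abs_of_pos (by positivity), Real.mul_rpow (by positivity) (by positivity)]
    have e : ((4 : ℝ) ^ (-k)) ^ (-(1 / 2) : ℝ) = 2 ^ k := by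
      rw [← Real.rpow_intCast, ← Real.rpow_mul (by norm_num), show (4 : ℝ) = 2 ^ (2 : ℝ) by norm_num,
        ← Real.rpow_mul (by norm_num), ← Real.rpow_intCast]
      congr 1; push_cast; ring
    rw [e, mul_assoc]
    gcongr
    linarith [abs_nonneg τ]

/-- If a lacunary Fourier series vanishes near `0`, the heat regularisation of its inverse
transform is exponentially small. -/
theorem exists_hasSum_heat_le {μ : ℝ → ℂ} (hμ : Continuous μ) (hi : Integrable μ) {c : ℤ → ℂ}
    {A θ C : ℝ} (hA : 0 ≤ A) (hθ : 1 ≤ θ) (hθ2 : θ < 2) (hc : ∀ k, ‖c k‖ ≤ A * θ ^ (-k))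
    (h1 : ∀ s, ‖ftLine μ s‖ ≤ C * |s|) (h2 : ∀ s, ‖ftLine μ s‖ * |s| ≤ C) {r : ℝ} (hr : 0 < r)
    (hF : ∀ τ, |τ| < r → ∑' k : ℤ, c k * ftLine μ ((4 : ℝ) ^ (-k) * τ) = 0) :
    ∃ B, 0 ≤ B ∧ ∀ a, 1 ≤ a → ∀ x, ∃ S : ℂ, ‖S‖ ≤ B * √a * Real.exp (-(a - 1) * r ^ 2) ∧
      HasSum (fun k : ℤ => c k * ∫ u, μ u * heat a (x - (4 : ℝ) ^ (-k) * u)) S := by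
  have hC : 0 ≤ C := by simpa using (norm_nonneg _).trans (h1 1)
  set q := θ / 2 with hq
  have hq0 : 0 ≤ q := by rw [hq]; linarith
  have hqs : Summable fun k : ℤ => q ^ k.natAbs := summable_pow_natAbs hq0 (by rw [hq]; linarith)
  set Q := ∑' k : ℤ, q ^ k.natAbs
  have hQ : 0 ≤ Q := tsum_nonneg fun k => by positivity
  let W : ℝ → ℝ := fun τ => (|τ| + |τ| ^ (-(1 / 2) : ℝ)) * Real.exp (-τ ^ 2)
  have hW : Integrable W := by
    have := (integrable_abs_rpow_mul_exp_neg_sq (s := 1) (by norm_num)).add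
      (integrable_abs_rpow_mul_exp_neg_sq (s := -(1 / 2)) (by norm_num))
    refine this.congr (ae_of_all _ fun τ => ?_)
    simp [W]; ring
  have hW0 : ∀ τ, 0 ≤ W τ := fun τ => by positivity
  refine ⟨A * C * Q * ∫ τ, W τ, mul_nonneg (by positivity) (integral_nonneg hW0),
    fun a ha x => ?_⟩
  have ha0 : 0 < a := by linarith
  let F : ℤ → ℝ → ℂ := fun k τ => Complex.exp (Complex.I * (τ * x : ℝ)) *
    (Real.exp (-a * τ ^ 2) : ℂ) * (c k * ftLine μ ((4 : ℝ) ^ (-k) * τ))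
  have hexp : ∀ τ, ‖Complex.exp (Complex.I * (τ * x : ℝ)) * (Real.exp (-a * τ ^ 2) : ℂ)‖ =
      Real.exp (-a * τ ^ 2) := fun τ => by
    rw [norm_mul, mul_comm Complex.I, Complex.norm_exp_ofReal_mul_I, one_mul, Complex.norm_real,
      Real.norm_of_nonneg (Real.exp_pos _).le]
  have hexp1 : ∀ τ, Real.exp (-a * τ ^ 2) ≤ Real.exp (-τ ^ 2) := fun τ =>
    Real.exp_le_exp.2 (by nlinarith [sq_nonneg τ])
  have hFb : ∀ k τ, ‖F k τ‖ ≤ A * C * q ^ k.natAbs * W τ := fun k τ => by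
    simp only [F]
    rw [norm_mul, hexp]
    calc _ ≤ Real.exp (-τ ^ 2) * (A * C * (|τ| + |τ| ^ (-(1 / 2) : ℝ)) * (θ / 2) ^ k.natAbs) := by
          gcongr
          · exact Real.exp_le_exp.1 (hexp1 τ)
          · exact norm_mul_ftLine_le hA hθ hc h1 h2 k τ
      _ = _ := by simp only [W]; ring
  have hFc : ∀ k, Continuous (F k) := fun k => by
    have := (continuous_ftLine hi).comp (continuous_const_mul ((4 : ℝ) ^ (-k)))
    simp only [Function.comp_def] at this
    simp only [F]
    fun_prop
  have hFi : ∀ k, Integrable (F k) := fun k =>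
    (hW.const_mul _).mono' (hFc k).aestronglyMeasurable (ae_of_all _ (hFb k))
  have hFs : Summable fun k => ∫ τ, ‖F k τ‖ := by
    refine Summable.of_nonneg_of_le (fun k => integral_nonneg fun τ => norm_nonneg _) (fun k => ?_)
      ((hqs.mul_left (A * C)).mul_right (∫ τ, W τ))
    rw [← integral_const_mul]
    exact integral_mono (hFi k).norm (hW.const_mul _) (hFb k)
  have hsum := hasSum_integral_of_summable_integral_norm hFi hFs
  have hI : ‖∫ τ, ∑' k, F k τ‖ ≤ A * C * Q * (∫ τ, W τ) * Real.exp (-(a - 1) * r ^ 2) := by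
    have : A * C * Q * (∫ τ, W τ) * Real.exp (-(a - 1) * r ^ 2) =
        ∫ τ, A * C * Q * Real.exp (-(a - 1) * r ^ 2) * W τ := by
      rw [integral_const_mul]; ring
    rw [this]
    refine norm_integral_le_of_norm_le (hW.const_mul _) (ae_of_all _ fun τ => ?_)
    simp only [F]
    rw [tsum_mul_left]
    rcases lt_or_ge |τ| r with h | h
    · rw [hF τ h, mul_zero, norm_zero]
      have := hW0 τ
      positivity
    · rw [norm_mul, hexp]
      have hb : ‖∑' k : ℤ, c k * ftLine μ ((4 : ℝ) ^ (-k) * τ)‖ ≤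
          A * C * (|τ| + |τ| ^ (-(1 / 2) : ℝ)) * Q :=
        tsum_of_norm_bounded (hqs.hasSum.mul_left _) (norm_mul_ftLine_le hA hθ hc h1 h2 · τ)
      have he : Real.exp (-a * τ ^ 2) ≤ Real.exp (-(a - 1) * r ^ 2) * Real.exp (-τ ^ 2) := by
        rw [← Real.exp_add]
        refine Real.exp_le_exp.2 ?_
        have : r ^ 2 ≤ τ ^ 2 := by rw [← sq_abs τ]; gcongr
        nlinarith
      calc _ ≤ (Real.exp (-(a - 1) * r ^ 2) * Real.exp (-τ ^ 2)) *
            (A * C * (|τ| + |τ| ^ (-(1 / 2) : ℝ)) * Q) := by gcongr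
        _ = _ := by simp only [W]; ring
  have hpa : 0 < √(Real.pi / a) := Real.sqrt_pos.2 (by positivity)
  have hterm : ∀ k, ∫ τ, F k τ =
      √(Real.pi / a) * (c k * ∫ u, μ u * heat a (x - (4 : ℝ) ^ (-k) * u)) := fun k => by
    have := integral_gaussian_mul_ftLine hμ hi ha0 x ((4 : ℝ) ^ (-k))
    rw [mul_left_comm, ← this, ← integral_const_mul]
    congr 1; ext τ; simp only [F]; ring
  simp_rw [hterm] at hsum
  refine ⟨(√(Real.pi / a) : ℂ)⁻¹ * ∫ τ, ∑' k, F k τ, ?_, ?_⟩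
  · rw [norm_mul, norm_inv, Complex.norm_real, Real.norm_of_nonneg hpa.le]
    have : (√(Real.pi / a))⁻¹ ≤ √a := by
      rw [← Real.sqrt_inv]
      refine Real.sqrt_le_sqrt ?_
      rw [inv_div, div_le_iff₀ Real.pi_pos]
      nlinarith [Real.pi_gt_three]
    calc _ ≤ √a * (A * C * Q * (∫ τ, W τ) * Real.exp (-(a - 1) * r ^ 2)) := by gcongr
      _ = _ := by ring
  · have := hsum.mul_left (√(Real.pi / a) : ℂ)⁻¹
    refine this.congr_fun fun k => ?_
    rw [← mul_assoc, inv_mul_cancel₀ (by exact_mod_cast hpa.ne'), one_mul]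

theorem abs_exp_neg_sub_exp_neg_le {p q m : ℝ} (hp : m ≤ p) (hq : m ≤ q) :
    |Real.exp (-p) - Real.exp (-q)| ≤ |p - q| * Real.exp (-m) := by
  wlog h : p ≤ q generalizing p q
  · rw [abs_sub_comm, abs_sub_comm p q]
    exact this hq hp (le_of_not_ge h)
  have h1 : Real.exp (-q) ≤ Real.exp (-p) := Real.exp_le_exp.2 (by linarith)
  rw [abs_of_nonneg (by linarith), abs_of_nonpos (by linarith)]
  have h2 : Real.exp (-q) = Real.exp (-p) * Real.exp (p - q) := by
    rw [← Real.exp_add]; congr 1; ring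
  have h3 := Real.add_one_le_exp (p - q)
  have h4 : Real.exp (-p) ≤ Real.exp (-m) := Real.exp_le_exp.2 (by linarith)
  have h5 := Real.exp_pos (-p)
  rw [h2]
  calc _ = Real.exp (-p) * (1 - Real.exp (p - q)) := by ring
    _ ≤ Real.exp (-p) * (-(p - q)) := by gcongr; linarith
    _ ≤ Real.exp (-m) * (-(p - q)) := by gcongr; linarith
    _ = _ := by ring

/-- The part of the inverse transform of a lacunary series carried by large scales. -/
def kerLarge (c : ℤ → ℂ) (μ : ℝ → ℂ) (x : ℝ) : ℂ :=
  ∑' j : ℕ, c (-(j + 1)) * ((4 : ℝ) ^ (-(j + 1 : ℤ)) : ℝ) * μ ((4 : ℝ) ^ (-(j + 1 : ℤ)) * x)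

theorem norm_coeff_mul_le {c : ℤ → ℂ} {A θ M : ℝ} (hθ : 0 < θ) (hA : 0 ≤ A)
    (hc : ∀ k, ‖c k‖ ≤ A * θ ^ (-k)) (j : ℕ) {z : ℂ} (hz : ‖z‖ ≤ M) :
    ‖c (-(j + 1)) * ((4 : ℝ) ^ (-(j + 1 : ℤ)) : ℝ) * z‖ ≤ A * M * (θ / 4) * (θ / 4) ^ j := by
  have h := hc (-(j + 1))
  rw [norm_mul, norm_mul, Complex.norm_real, Real.norm_of_nonneg (by positivity)]
  have e1 : θ ^ (-(-(j + 1 : ℤ))) = θ ^ (j + 1) := by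
    rw [neg_neg, ← zpow_natCast]; congr 1
  have e2 : (4 : ℝ) ^ (-(j + 1 : ℤ)) = ((4 : ℝ) ^ (j + 1))⁻¹ := by
    rw [zpow_neg, ← zpow_natCast]; congr 2
  rw [e1] at h
  rw [e2]
  calc _ ≤ A * θ ^ (j + 1) * ((4 : ℝ) ^ (j + 1))⁻¹ * M := by gcongr
    _ = A * M * ((θ / 4) ^ (j + 1)) := by rw [div_pow]; ring
    _ = _ := by ring

theorem summable_geometric_quarter {θ : ℝ} (hθ : 0 < θ) (hθ4 : θ < 4) (B : ℝ) :
    Summable fun j : ℕ => B * (θ / 4) ^ j :=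
  (summable_geometric_of_lt_one (by positivity) (by linarith)).mul_left B

theorem exists_norm_kerLarge_le {c : ℤ → ℂ} {μ : ℝ → ℂ} {A θ M : ℝ} (hθ : 0 < θ) (hθ4 : θ < 4)
    (hA : 0 ≤ A) (hc : ∀ k, ‖c k‖ ≤ A * θ ^ (-k)) (hM : ∀ t, ‖μ t‖ ≤ M) :
    ∃ B, 0 ≤ B ∧ ∀ x, ‖kerLarge c μ x‖ ≤ B := by
  have h0 : 0 ≤ M := (norm_nonneg _).trans (hM 0)
  refine ⟨∑' j : ℕ, A * M * (θ / 4) * (θ / 4) ^ j, tsum_nonneg fun j => by positivity,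
    fun x => ?_⟩
  exact tsum_of_norm_bounded (summable_geometric_quarter hθ hθ4 _).hasSum
    fun j => norm_coeff_mul_le hθ hA hc j (hM _)

theorem continuous_kerLarge {c : ℤ → ℂ} {μ : ℝ → ℂ} {A θ M : ℝ} (hθ : 0 < θ) (hθ4 : θ < 4)
    (hA : 0 ≤ A) (hc : ∀ k, ‖c k‖ ≤ A * θ ^ (-k)) (hμ : Continuous μ) (hM : ∀ t, ‖μ t‖ ≤ M) :
    Continuous (kerLarge c μ) :=
  continuous_tsum (fun j => by fun_prop) (summable_geometric_quarter hθ hθ4 (A * M * (θ / 4)))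
    fun j x => norm_coeff_mul_le hθ hA hc j (hM _)

theorem hasSum_integral_kerLarge_mul_heat {c : ℤ → ℂ} {μ : ℝ → ℂ} {A θ M : ℝ} (hθ : 0 < θ)
    (hθ4 : θ < 4) (hA : 0 ≤ A) (hc : ∀ k, ‖c k‖ ≤ A * θ ^ (-k)) (hμ : Continuous μ)
    (hM : ∀ t, ‖μ t‖ ≤ M) {a : ℝ} (ha : 0 < a) (x : ℝ) :
    HasSum (fun j : ℕ => c (-(j + 1)) * ∫ u, μ u * heat a (x - (4 : ℝ) ^ (-(-(j + 1 : ℤ))) * u))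
      (∫ y, kerLarge c μ y * heat a (x - y)) := by
  have h0 : 0 ≤ M := (norm_nonneg _).trans (hM 0)
  have hh : Integrable fun y => heat a (x - y) := (integrable_heat ha).comp_sub_left x
  let F : ℕ → ℝ → ℂ := fun j y => c (-(j + 1)) * ((4 : ℝ) ^ (-(j + 1 : ℤ)) : ℝ) *
    μ ((4 : ℝ) ^ (-(j + 1 : ℤ)) * y) * heat a (x - y)
  have hFb : ∀ j y, ‖F j y‖ ≤ A * M * (θ / 4) * (θ / 4) ^ j * heat a (x - y) := fun j y => by
    simp only [F]
    rw [norm_mul, Complex.norm_real, Real.norm_of_nonneg (heat_nonneg _ _)]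
    gcongr
    · exact heat_nonneg _ _
    · exact norm_coeff_mul_le hθ hA hc j (hM _)
  have hFi : ∀ j, Integrable (F j) := fun j => by
    refine (hh.const_mul _).mono' (Continuous.aestronglyMeasurable ?_) (ae_of_all _ (hFb j))
    have := continuous_heat a
    simp only [F]
    fun_prop
  have hFs : Summable fun j => ∫ y, ‖F j y‖ := by
    refine Summable.of_nonneg_of_le (fun k => integral_nonneg fun τ => norm_nonneg _) (fun k => ?_)
      ((summable_geometric_quarter hθ hθ4 (A * M * (θ / 4))).mul_right (∫ y, heat a (x - y)))
    rw [← integral_const_mul]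
    exact integral_mono (hFi k).norm (hh.const_mul _) (hFb k)
  have hsum := hasSum_integral_of_summable_integral_norm hFi hFs
  have e : ∀ y, ∑' j, F j y = kerLarge c μ y * heat a (x - y) := fun y => tsum_mul_right
  simp_rw [e] at hsum
  refine hsum.congr_fun fun j => ?_
  have h4 : (0 : ℝ) < (4 : ℝ) ^ (-(j + 1 : ℤ)) := by positivity
  have := Measure.integral_comp_mul_left
    (fun u => μ u * heat a (x - (4 : ℝ) ^ (-(-(j + 1 : ℤ))) * u)) ((4 : ℝ) ^ (-(j + 1 : ℤ)))
  rw [abs_inv, abs_of_pos h4, eq_inv_smul_iff₀ h4.ne'] at this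
  rw [← this, Complex.real_smul, ← mul_assoc, ← integral_const_mul]
  congr 1; ext y
  rw [← mul_assoc, ← mul_assoc ((4 : ℝ) ^ (-(-(j + 1 : ℤ)))), ← zpow_add₀ (by norm_num)]
  simp [F]

/-- Small scales of a mean zero profile contribute exponentially little. -/
theorem norm_integral_mul_heat_le {μ : ℝ → ℂ} (hμ : Continuous μ) {e : ℝ} (he0 : 0 ≤ e)
    (he : ∀ t, e < |t| → μ t = 0) (hint : ∫ t, μ t = 0) {x a l : ℝ} (hx : 0 < x)
    (ha : 2 * e ≤ a * x) (ha0 : 0 < a) (hl0 : 0 ≤ l) (hl1 : l ≤ 1) :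
    ‖∫ u, μ u * heat a (a * x - l * u)‖ ≤
      l * (e * x * (∫ u, ‖μ u‖)) * Real.exp (-(x ^ 2 / 16) * a) := by
  have hi := integrable_of_compact_support hμ he
  have hax : 0 < a * x := by positivity
  have hcs : HasCompactSupport μ := HasCompactSupport.intro (isCompact_Icc (a := -e) (b := e))
    fun t ht => he t (by
      by_contra h
      exact ht (abs_le.1 (not_lt.1 h)))
  have hi2 : Integrable fun u => μ u * heat a (a * x - l * u) := by
    refine Continuous.integrable_of_hasCompactSupport ?_ hcs.mul_right
    have := continuous_heat a
    fun_prop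
  have e1 : ∫ u, μ u * heat a (a * x - l * u) =
      ∫ u, μ u * ((heat a (a * x - l * u) - heat a (a * x) : ℝ) : ℂ) := by
    have : ∫ u, μ u * (heat a (a * x) : ℂ) = 0 := by rw [integral_mul_const, hint, zero_mul]
    rw [← sub_zero (∫ u, μ u * heat a (a * x - l * u)), ← this, ← integral_sub hi2
      (hi.mul_const _)]
    congr 1; ext u; push_cast; ring
  have e2 : l * (e * x * (∫ u, ‖μ u‖)) * Real.exp (-(x ^ 2 / 16) * a) =
      ∫ u, l * (e * x) * Real.exp (-(x ^ 2 / 16) * a) * ‖μ u‖ := by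
    rw [integral_const_mul]; ring
  rw [e1, e2]
  refine norm_integral_le_of_norm_le (hi.norm.const_mul _) (ae_of_all _ fun u => ?_)
  rcases lt_or_ge e |u| with h | h
  · simp [he u h]
  have hlu : |l * u| ≤ l * e := by rw [abs_mul, abs_of_nonneg hl0]; gcongr
  have hlu' : |l * u| ≤ a * x / 2 := hlu.trans (by nlinarith)
  have hlu2 := abs_le.1 hlu'
  rw [norm_mul, Complex.norm_real, Real.norm_eq_abs, mul_comm]
  gcongr
  have := abs_exp_neg_sub_exp_neg_le (p := (a * x - l * u) ^ 2 / (4 * a))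
    (q := (a * x) ^ 2 / (4 * a)) (m := x ^ 2 / 16 * a) ?_ ?_
  · unfold heat
    rw [neg_div, neg_div, neg_mul]
    refine this.trans ?_
    gcongr
    rw [← sub_div, abs_div, abs_of_pos (by positivity : 0 < 4 * a), div_le_iff₀ (by positivity)]
    rw [show (a * x - l * u) ^ 2 - (a * x) ^ 2 = (l * u) * (l * u - 2 * (a * x)) by ring, abs_mul]
    calc |l * u| * |l * u - 2 * (a * x)| ≤ (l * e) * (4 * (a * x)) := by
          gcongr
          rw [abs_le]; constructor <;> linarith
      _ = _ := by ring
  · rw [le_div_iff₀ (by positivity)]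
    nlinarith
  · rw [le_div_iff₀ (by positivity)]
    nlinarith

theorem norm_integral_kerLarge_mul_heat_le {μ : ℝ → ℂ} (hμ : Continuous μ) {e : ℝ} (he0 : 0 ≤ e)
    (he : ∀ t, e < |t| → μ t = 0) (hint : ∫ t, μ t = 0) {c : ℤ → ℂ}
    {A θ C : ℝ} (hA : 0 ≤ A) (hθ : 1 ≤ θ) (hθ2 : θ < 2) (hc : ∀ k, ‖c k‖ ≤ A * θ ^ (-k))
    (h1 : ∀ s, ‖ftLine μ s‖ ≤ C * |s|) (h2 : ∀ s, ‖ftLine μ s‖ * |s| ≤ C) {r : ℝ} (hr : 0 < r)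
    (hF : ∀ τ, |τ| < r → ∑' k : ℤ, c k * ftLine μ ((4 : ℝ) ^ (-k) * τ) = 0)
    {x : ℝ} (hx : 0 < x) :
    ∃ B δ, 0 ≤ B ∧ 0 < δ ∧ ∀ᶠ a in atTop,
      ‖∫ y, kerLarge c μ y * heat a (a * x - y)‖ ≤ B * √a * Real.exp (-δ * a) := by
  have hi := integrable_of_compact_support hμ he
  obtain ⟨M, hM0, hM⟩ := exists_norm_le_of_compact_support hμ he
  obtain ⟨B₁, hB₁, hS⟩ := exists_hasSum_heat_le hμ hi hA hθ hθ2 hc h1 h2 hr hF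
  have hθ0 : 0 < θ := by linarith
  set I := ∫ u, ‖μ u‖
  have hI : 0 ≤ I := integral_nonneg fun _ => norm_nonneg _
  set G := ∑' n : ℕ, A * (e * x * I) * (1 / 4 : ℝ) ^ n
  have hG : 0 ≤ G := tsum_nonneg fun n => by positivity
  set δ := min (r ^ 2 / 2) (x ^ 2 / 16)
  have hδ : 0 < δ := by positivity
  refine ⟨B₁ + G, δ, by positivity, hδ, ?_⟩
  filter_upwards [eventually_ge_atTop 2, eventually_ge_atTop (2 * e / x)] with a ha2 hax
  have ha0 : 0 < a := by linarith
  have hax' : 2 * e ≤ a * x := by rwa [div_le_iff₀ hx] at hax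
  obtain ⟨S, hSb, hS⟩ := hS a (by linarith) (a * x)
  have hneg := hasSum_integral_kerLarge_mul_heat hθ0 (by linarith) hA hc hμ hM ha0 (a * x)
  have hterm : ∀ n : ℕ, ‖c n * ∫ u, μ u * heat a (a * x - (4 : ℝ) ^ (-(n : ℤ)) * u)‖ ≤
      A * (e * x * I) * (1 / 4 : ℝ) ^ n * Real.exp (-δ * a) := fun n => by
    have h4 : (4 : ℝ) ^ (-(n : ℤ)) = (1 / 4 : ℝ) ^ n := by
      rw [zpow_neg, zpow_natCast, one_div, inv_pow]
    have hcn : ‖c n‖ ≤ A := (hc n).trans (by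
      rw [zpow_neg, zpow_natCast]
      exact mul_le_of_le_one_right hA (inv_le_one_of_one_le₀ (one_le_pow₀ hθ)))
    rw [norm_mul, h4]
    calc _ ≤ A * ((1 / 4 : ℝ) ^ n * (e * x * I) * Real.exp (-(x ^ 2 / 16) * a)) := by
          gcongr
          exact norm_integral_mul_heat_le hμ he0 he hint hx hax' ha0 (by positivity)
            (pow_le_one₀ (by norm_num) (by norm_num))
      _ ≤ A * ((1 / 4 : ℝ) ^ n * (e * x * I) * Real.exp (-δ * a)) := by
          gcongr
          exact min_le_right _ _
      _ = _ := by ring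
  have hgs : Summable fun n : ℕ => A * (e * x * I) * (1 / 4 : ℝ) ^ n * Real.exp (-δ * a) :=
    ((summable_geometric_of_lt_one (by norm_num) (by norm_num)).mul_left _).mul_right _
  have hpos : Summable fun n : ℕ => c n * ∫ u, μ u * heat a (a * x - (4 : ℝ) ^ (-(n : ℤ)) * u) :=
    Summable.of_norm_bounded hgs hterm
  have htot := (HasSum.of_nat_of_neg_add_one (f := fun k : ℤ =>
    c k * ∫ u, μ u * heat a (a * x - (4 : ℝ) ^ (-k) * u)) hpos.hasSum hneg).unique hS
  have hpb : ‖∑' n : ℕ, c n * ∫ u, μ u * heat a (a * x - (4 : ℝ) ^ (-(n : ℤ)) * u)‖ ≤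
      G * Real.exp (-δ * a) := by
    refine (tsum_of_norm_bounded hgs.hasSum hterm).trans (le_of_eq tsum_mul_right)
  rw [← eq_sub_iff_add_eq'] at htot
  rw [htot]
  have h1a : 1 ≤ √a := Real.one_le_sqrt.2 (by linarith)
  have hexp : Real.exp (-(a - 1) * r ^ 2) ≤ Real.exp (-δ * a) := by
    refine Real.exp_le_exp.2 ?_
    have : δ ≤ r ^ 2 / 2 := min_le_left _ _
    nlinarith [sq_nonneg r]
  calc _ ≤ B₁ * √a * Real.exp (-(a - 1) * r ^ 2) + G * Real.exp (-δ * a) :=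
        (norm_sub_le _ _).trans (add_le_add hSb hpb)
    _ ≤ B₁ * √a * Real.exp (-δ * a) + G * √a * Real.exp (-δ * a) := by
        gcongr
        exact le_mul_of_one_le_right hG h1a
    _ = _ := by ring

/-- Recovering a bounded function, Lipschitz near a point, from its heat regularisation. -/
theorem norm_le_of_heat {f : ℝ → ℂ} (hf : Continuous f) {M : ℝ} (hM : ∀ y, ‖f y‖ ≤ M)
    {x L κ a : ℝ} (ha : 0 < a) (hκ : 0 ≤ κ) (hL : 0 ≤ L)
    (h : ∀ y, |y - x| ≤ κ → ‖f y - f x‖ ≤ L * |y - x|) :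
    ‖f x‖ * √a ≤ ‖∫ y, f y * heat a (x - y)‖ + 18 * a * L +
      12 * M * √a * Real.exp (-κ ^ 2 / (8 * a)) := by
  have hM0 : 0 ≤ M := (norm_nonneg _).trans (hM 0)
  have hh : Integrable fun y => heat a (x - y) := (integrable_heat ha).comp_sub_left x
  have hh2 : Integrable fun y => heat (2 * a) (x - y) :=
    (integrable_heat (by positivity)).comp_sub_left x
  have hch := continuous_heat a
  have hfi : Integrable fun y => f y * heat a (x - y) := by
    refine (hh.const_mul M).mono' (Continuous.aestronglyMeasurable (by fun_prop))
      (ae_of_all _ fun y => ?_)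
    rw [norm_mul, Complex.norm_real, Real.norm_of_nonneg (heat_nonneg _ _)]
    exact mul_le_mul_of_nonneg_right (hM y) (heat_nonneg _ _)
  have hci : Integrable fun y => f x * (heat a (x - y) : ℂ) := hh.ofReal.const_mul _
  have e1 : ∫ y, f x * (heat a (x - y) : ℂ) = f x * √(4 * Real.pi * a) := by
    rw [integral_const_mul, integral_complex_ofReal, integral_sub_left_eq_self (heat a),
      integral_heat ha]
  have e2 : ∫ y, heat (2 * a) (x - y) = √(4 * Real.pi * (2 * a)) := by
    rw [integral_sub_left_eq_self (heat (2 * a)), integral_heat (by positivity)]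
  have hsplit : ∀ y, heat a (x - y) = heat (2 * a) (x - y) * heat (2 * a) (x - y) := fun y => by
    unfold heat
    rw [← Real.exp_add]; congr 1; field_simp; ring
  set E := Real.exp (-κ ^ 2 / (8 * a))
  have hpt : ∀ y, ‖f y * heat a (x - y) - f x * (heat a (x - y) : ℂ)‖ ≤
      (L * √(8 * a) + 2 * M * E) * heat (2 * a) (x - y) := fun y => by
    rw [← sub_mul, norm_mul, Complex.norm_real, Real.norm_of_nonneg (heat_nonneg _ _), hsplit,
      ← mul_assoc]
    refine mul_le_mul_of_nonneg_right ?_ (heat_nonneg _ _)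
    rcases le_or_gt |y - x| κ with hy | hy
    · have h3 : |y - x| * heat (2 * a) (x - y) ≤ √(8 * a) := by
        have hs : 0 < √(8 * a) := Real.sqrt_pos.2 (by positivity)
        have hs2 : √(8 * a) ^ 2 = 8 * a := Real.sq_sqrt (by positivity)
        set t := |y - x| / √(8 * a) with ht
        have ht' : |y - x| = t * √(8 * a) := by rw [ht]; field_simp
        have h5 : heat (2 * a) (x - y) = Real.exp (-t ^ 2) := by
          unfold heat
          congr 1
          rw [ht, div_pow, hs2, sq_abs]; field_simp; ring
        have h6 : t * Real.exp (-t ^ 2) ≤ 1 := by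
          have h7 := Real.add_one_le_exp (t ^ 2)
          rw [Real.exp_neg, ← div_eq_mul_inv, div_le_one (Real.exp_pos _)]
          nlinarith [sq_nonneg (t - 1)]
        rw [h5, ht']
        calc _ = (t * Real.exp (-t ^ 2)) * √(8 * a) := by ring
          _ ≤ 1 * √(8 * a) := by gcongr
          _ = _ := one_mul _
      calc _ ≤ L * |y - x| * heat (2 * a) (x - y) :=
            mul_le_mul_of_nonneg_right (h y hy) (heat_nonneg _ _)
        _ = L * (|y - x| * heat (2 * a) (x - y)) := by ring
        _ ≤ L * √(8 * a) := by gcongr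
        _ ≤ _ := by simp only [le_add_iff_nonneg_right]; positivity
    · have h3 : heat (2 * a) (x - y) ≤ E := by
        refine Real.exp_le_exp.2 ?_
        rw [show 4 * (2 * a) = 8 * a by ring]
        have : κ ^ 2 ≤ (x - y) ^ 2 := by
          rw [← sq_abs (x - y), abs_sub_comm]
          gcongr
        gcongr
      calc _ ≤ (M + M) * E := by
            refine mul_le_mul ((norm_sub_le _ _).trans (add_le_add (hM _) (hM _))) h3
              (heat_nonneg _ _) (by positivity)
        _ ≤ _ := by rw [← two_mul]; simp only [le_add_iff_nonneg_left]; positivity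
  have hd : ‖∫ y, (f y * heat a (x - y) - f x * (heat a (x - y) : ℂ))‖ ≤
      (L * √(8 * a) + 2 * M * E) * √(4 * Real.pi * (2 * a)) := by
    rw [← e2, ← integral_const_mul]
    exact norm_integral_le_of_norm_le (hh2.const_mul _) (ae_of_all _ hpt)
  rw [integral_sub hfi hci, e1] at hd
  have hn : ‖f x * (√(4 * Real.pi * a) : ℂ)‖ = ‖f x‖ * √(4 * Real.pi * a) := by
    rw [norm_mul, Complex.norm_real, Real.norm_of_nonneg (Real.sqrt_nonneg _)]
  have hmain : ‖f x‖ * √(4 * Real.pi * a) ≤ ‖∫ y, f y * heat a (x - y)‖ +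
      (L * √(8 * a) + 2 * M * E) * √(4 * Real.pi * (2 * a)) := by
    rw [← hn]
    linarith [norm_sub_norm_le (f x * (√(4 * Real.pi * a) : ℂ)) (∫ y, f y * heat a (x - y)),
      norm_sub_rev (f x * (√(4 * Real.pi * a) : ℂ)) (∫ y, f y * heat a (x - y))]
  have hpi := Real.pi_gt_three
  have hpi4 := Real.pi_lt_four
  have hs1 : √a ≤ √(4 * Real.pi * a) := Real.sqrt_le_sqrt (by nlinarith)
  have hs2 : √(4 * Real.pi * (2 * a)) ≤ 6 * √a := by
    rw [← Real.sqrt_sq (by norm_num : (0 : ℝ) ≤ 6), ← Real.sqrt_mul (by norm_num)]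
    refine Real.sqrt_le_sqrt ?_
    nlinarith
  have hs3 : √(8 * a) ≤ 3 * √a := by
    rw [← Real.sqrt_sq (by norm_num : (0 : ℝ) ≤ 3), ← Real.sqrt_mul (by norm_num)]
    refine Real.sqrt_le_sqrt ?_
    nlinarith
  have hE : 0 ≤ E := (Real.exp_pos _).le
  calc ‖f x‖ * √a ≤ ‖f x‖ * √(4 * Real.pi * a) := by gcongr
    _ ≤ _ := hmain
    _ ≤ ‖∫ y, f y * heat a (x - y)‖ + (L * (3 * √a) + 2 * M * E) * (6 * √a) := by gcongr
    _ = ‖∫ y, f y * heat a (x - y)‖ + 18 * (√a * √a) * L + 12 * M * √a * E := by ring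
    _ = _ := by rw [Real.mul_self_sqrt ha.le]

/-- A lacunary series vanishing near `0` has inverse transform controlled at scale `a` by its local
Lipschitz constant at that scale, up to an exponentially small error. -/
theorem exists_norm_kerLarge_le_of_lipschitz {μ : ℝ → ℂ} (hμ : Continuous μ) {e : ℝ} (he0 : 0 ≤ e)
    (he : ∀ t, e < |t| → μ t = 0) (hint : ∫ t, μ t = 0) {c : ℤ → ℂ}
    {A θ C : ℝ} (hA : 0 ≤ A) (hθ : 1 ≤ θ) (hθ2 : θ < 2) (hc : ∀ k, ‖c k‖ ≤ A * θ ^ (-k))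
    (h1 : ∀ s, ‖ftLine μ s‖ ≤ C * |s|) (h2 : ∀ s, ‖ftLine μ s‖ * |s| ≤ C) {r : ℝ} (hr : 0 < r)
    (hF : ∀ τ, |τ| < r → ∑' k : ℤ, c k * ftLine μ ((4 : ℝ) ^ (-k) * τ) = 0)
    {x κ : ℝ} (hx : 0 < x) (hκ : 0 < κ) :
    ∃ B δ, 0 ≤ B ∧ 0 < δ ∧ ∀ᶠ a in atTop, ∀ L, 0 ≤ L →
      (∀ y, |y - a * x| ≤ κ * a → ‖kerLarge c μ y - kerLarge c μ (a * x)‖ ≤ L * |y - a * x|) →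
      ‖kerLarge c μ (a * x)‖ ≤ B * Real.exp (-δ * a) + 18 * √a * L := by
  obtain ⟨M, hM0, hM⟩ := exists_norm_le_of_compact_support hμ he
  have hθ0 : 0 < θ := by linarith
  obtain ⟨M', hM'0, hM'⟩ := exists_norm_kerLarge_le hθ0 (by linarith) hA hc hM
  obtain ⟨B, δ, hB, hδ, hev⟩ := norm_integral_kerLarge_mul_heat_le hμ he0 he hint hA hθ hθ2 hc h1 h2
    hr hF hx
  refine ⟨B + 12 * M', min δ (κ ^ 2 / 8), by positivity, by positivity, ?_⟩
  filter_upwards [hev, eventually_gt_atTop 0] with a hb ha L hL hlip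
  have hkey := norm_le_of_heat (continuous_kerLarge hθ0 (by linarith) hA hc hμ hM) hM' ha
    (by positivity : 0 ≤ κ * a) hL hlip
  have hsa : 0 < √a := Real.sqrt_pos.2 ha
  refine le_of_mul_le_mul_right (hkey.trans ?_) hsa
  have e1 : Real.exp (-δ * a) ≤ Real.exp (-min δ (κ ^ 2 / 8) * a) := by
    gcongr
    exact min_le_left _ _
  have e2 : Real.exp (-(κ * a) ^ 2 / (8 * a)) ≤ Real.exp (-min δ (κ ^ 2 / 8) * a) := by
    rw [show -(κ * a) ^ 2 / (8 * a) = -(κ ^ 2 / 8) * a by field_simp]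
    gcongr
    exact min_le_right _ _
  calc _ ≤ B * √a * Real.exp (-min δ (κ ^ 2 / 8) * a) + 18 * a * L +
        12 * M' * √a * Real.exp (-min δ (κ ^ 2 / 8) * a) := by
        gcongr
        exact hb.trans (by gcongr)
    _ = (B + 12 * M') * Real.exp (-min δ (κ ^ 2 / 8) * a) * √a + 18 * (√a * √a) * L := by
        rw [Real.mul_self_sqrt ha.le]; ring
    _ = _ := by ring

/-- The inverse transform, away from `0`, of the lacunary series with coefficients `c` and profile
`μ`. -/
def kerFull (c : ℤ → ℂ) (μ : ℝ → ℂ) (x : ℝ) : ℂ :=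
  ∑' k : ℤ, c k * ((4 : ℝ) ^ k : ℝ) * μ ((4 : ℝ) ^ k * x)

theorem mul_kerFull_eq {c : ℤ → ℂ} {μ : ℝ → ℂ} {e : ℝ} (he : ∀ t, e < |t| → μ t = 0) {x : ℝ}
    (he0 : 0 < e) (hx : e / 4 < x) (m : ℕ) :
    ((4 ^ m : ℝ) : ℂ) * kerFull c μ (4 ^ m * x) =
      ∑' j : ℕ, c (-(m + j)) * ((1 / 4 : ℝ) ^ j : ℝ) * μ ((1 / 4 : ℝ) ^ j * x) := by
  unfold kerFull
  have hx0 : 0 < x := by linarith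
  rw [← tsum_mul_left]
  have hinj : Function.Injective fun j : ℕ => (-(m + j) : ℤ) := fun i j h => by
    simp only at h; omega
  rw [← hinj.tsum_eq]
  · congr 1; ext j
    have e1 : (4 : ℝ) ^ (-(m + j : ℤ)) * 4 ^ m = (1 / 4 : ℝ) ^ j := by
      rw [← zpow_natCast, ← zpow_add₀ (by norm_num), one_div, inv_pow, ← zpow_natCast, ← zpow_neg]
      congr 1; ring
    rw [← mul_assoc ((4 : ℝ) ^ _), e1, ← e1]
    push_cast
    ring
  · intro k hk
    rw [Function.mem_support] at hk
    by_contra hr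
    apply hk
    have hkm : 0 < k + m := by
      by_contra hle
      refine hr ⟨(-(k + m)).toNat, ?_⟩
      simp only
      omega
    rw [he, mul_zero, mul_zero]
    rw [← mul_assoc, ← zpow_natCast, ← zpow_add₀ (by norm_num), abs_of_pos (by positivity)]
    have : (4 : ℝ) ^ (1 : ℤ) ≤ 4 ^ (k + m) := zpow_le_zpow_right₀ (by norm_num) (by omega)
    rw [zpow_one] at this
    nlinarith

/-- Weighted supremum of the coefficients at scales `≥ p`. -/
def tailSup (c : ℤ → ℂ) (θ : ℝ) (p : ℕ) : ℝ := ⨆ j : ℕ, ‖c (-(p + j))‖ * (θ ^ j)⁻¹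

theorem tailSup_nonneg (c : ℤ → ℂ) {θ : ℝ} (hθ : 0 < θ) (p : ℕ) : 0 ≤ tailSup c θ p :=
  Real.iSup_nonneg fun j => by positivity

theorem norm_coeff_mul_inv_le {c : ℤ → ℂ} {A θ : ℝ} (hθ : 0 < θ)
    (hc : ∀ k, ‖c k‖ ≤ A * θ ^ (-k)) (p j : ℕ) : ‖c (-(p + j))‖ * (θ ^ j)⁻¹ ≤ A * θ ^ p := by
  rw [← div_eq_mul_inv, div_le_iff₀ (by positivity), mul_assoc, ← pow_add, ← zpow_natCast]
  have := hc (-(p + j))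
  rwa [neg_neg] at this

theorem norm_coeff_le_tailSup {c : ℤ → ℂ} {A θ : ℝ} (hθ : 0 < θ)
    (hc : ∀ k, ‖c k‖ ≤ A * θ ^ (-k)) (p j : ℕ) : ‖c (-(p + j))‖ ≤ tailSup c θ p * θ ^ j := by
  rw [← div_le_iff₀ (by positivity), div_eq_mul_inv]
  exact le_ciSup (f := fun j : ℕ => ‖c (-(p + j))‖ * (θ ^ j)⁻¹)
    ⟨A * θ ^ p, by rintro _ ⟨i, rfl⟩; exact norm_coeff_mul_inv_le hθ hc p i⟩ j

theorem tailSup_add_le {c : ℤ → ℂ} {A θ : ℝ} (hθ : 0 < θ)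
    (hc : ∀ k, ‖c k‖ ≤ A * θ ^ (-k)) (p q : ℕ) : tailSup c θ (p + q) ≤ θ ^ q * tailSup c θ p := by
  refine ciSup_le fun j => ?_
  have := norm_coeff_le_tailSup hθ hc p (q + j)
  rw [← div_eq_mul_inv, div_le_iff₀ (by positivity)]
  calc ‖c (-(((p + q : ℕ) : ℤ) + j))‖ = ‖c (-(p + ((q + j : ℕ) : ℤ)))‖ := by
        rw [Nat.cast_add, Nat.cast_add, add_assoc]
    _ ≤ tailSup c θ p * θ ^ (q + j) := this
    _ = _ := by rw [pow_add]; ring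

theorem exists_pow_mul_norm_le {c : ℤ → ℂ} {μ : ℝ → ℂ} {e e₀ L₀ A θ : ℝ}
    (he : ∀ t, e < |t| → μ t = 0) (he0 : 0 < e) (hL₀ : 0 ≤ L₀)
    (hlip : ∀ s t, ‖μ s - μ t‖ ≤ L₀ * |s - t|) (hθ0 : 0 < θ) (hθ : θ < 2)
    (hc : ∀ k, ‖c k‖ ≤ A * θ ^ (-k)) {K : ℝ → ℂ} (hrep : ∀ y, e₀ < y → K y = kerFull c μ y)
    (hK : ∀ x κ, 0 < x → 0 < κ → ∃ B δ, 0 ≤ B ∧ 0 < δ ∧ ∀ᶠ a in atTop, ∀ L, 0 ≤ L →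
      (∀ y, |y - a * x| ≤ κ * a → ‖K y - K (a * x)‖ ≤ L * |y - a * x|) →
      ‖K (a * x)‖ ≤ B * Real.exp (-δ * a) + 18 * √a * L)
    {x : ℝ} (hx : e / 4 < x) :
    ∃ N : ℕ, 0 < N ∧ ∀ m ≥ N, (4 : ℝ) ^ m * ‖K (4 ^ m * x)‖ ≤
      N * ((1 / 2) ^ m * tailSup c θ m + Real.exp (-4 ^ m / N)) ∧ K (4 ^ m * x) =
        kerFull c μ (4 ^ m * x) := by
  have hx0 : 0 < x := by linarith
  set κ := (x - e / 4) / 2 with hκ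
  have hκ0 : 0 < κ := by rw [hκ]; linarith
  obtain ⟨B, δ, hB, hδ, hev⟩ := hK x κ hx0 hκ0
  set C₁ := L₀ * ∑' j : ℕ, (θ / 16) ^ j with hC₁
  have hC₁0 : 0 ≤ C₁ := mul_nonneg hL₀ (tsum_nonneg fun j => by positivity)
  have hgs : Summable fun j : ℕ => (θ / 16) ^ j :=
    summable_geometric_of_lt_one (by positivity) (by linarith)
  have htend : Tendsto (fun m : ℕ => (4 : ℝ) ^ m) atTop atTop :=
    tendsto_pow_atTop_atTop_of_one_lt (by norm_num)
  have h4e : ∀ᶠ m : ℕ in atTop, e₀ < 4 ^ m * (e / 4) :=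
    (htend.atTop_mul_const (by positivity)).eventually_gt_atTop e₀
  obtain ⟨N₁, hN₁⟩ := eventually_atTop.1 ((htend.eventually hev).and h4e)
  obtain ⟨N₂, hN₂⟩ := exists_nat_ge (max (B * (2 / δ)) (max (18 * C₁) (2 / δ)))
  refine ⟨max (max N₁ N₂) 1, by positivity, fun m hm => ?_⟩
  set N := max (max N₁ N₂) 1
  obtain ⟨hb, he₀⟩ := hN₁ m ((le_max_left _ _).trans ((le_max_left _ _).trans hm))
  have h4m : (0 : ℝ) < 4 ^ m := by positivity
  set S := tailSup c θ m
  have hS : 0 ≤ S := tailSup_nonneg c hθ0 m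
  have hrep' : ∀ z, e / 4 < z → K (4 ^ m * z) = kerFull c μ (4 ^ m * z) := fun z hz =>
    hrep _ (he₀.trans (by gcongr))
  refine ⟨?_, hrep' x hx⟩
  have hterm : ∀ (z : ℝ) (j : ℕ), ‖c (-(m + j)) * ((1 / 4 : ℝ) ^ j : ℝ) * μ ((1 / 4 : ℝ) ^ j * z) -
      c (-(m + j)) * ((1 / 4 : ℝ) ^ j : ℝ) * μ ((1 / 4 : ℝ) ^ j * x)‖ ≤
        S * L₀ * |z - x| * (θ / 16) ^ j := fun z j => by
    rw [← mul_sub, norm_mul, norm_mul, Complex.norm_real, Real.norm_of_nonneg (by positivity)]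
    calc _ ≤ (S * θ ^ j) * (1 / 4 : ℝ) ^ j * (L₀ * |(1 / 4 : ℝ) ^ j * z - (1 / 4 : ℝ) ^ j * x|) := by
          gcongr
          · exact norm_coeff_le_tailSup hθ0 hc m j
          · exact hlip _ _
      _ = _ := by
          rw [← mul_sub, abs_mul, abs_of_pos (by positivity),
            show θ / 16 = θ * (1 / 4) * (1 / 4) by ring, mul_pow, mul_pow]
          ring
  obtain ⟨M, hM0, hM⟩ : ∃ M, 0 ≤ M ∧ ∀ t, ‖μ t‖ ≤ M :=
    exists_norm_le_of_compact_support (e := e) (by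
      refine (LipschitzWith.of_dist_le_mul (K := ⟨L₀, hL₀⟩) fun s t => ?_).continuous
      rw [dist_eq_norm, Real.dist_eq]; exact hlip s t) he
  have hsm : ∀ z : ℝ, Summable fun j : ℕ =>
      c (-(m + j)) * ((1 / 4 : ℝ) ^ j : ℝ) * μ ((1 / 4 : ℝ) ^ j * z) := fun z => by
    refine Summable.of_norm_bounded (g := fun j : ℕ => S * M * (θ / 4) ^ j)
      (summable_geometric_quarter hθ0 (by linarith) _) fun j => ?_
    rw [norm_mul, norm_mul, Complex.norm_real, Real.norm_of_nonneg (by positivity)]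
    calc _ ≤ (S * θ ^ j) * (1 / 4 : ℝ) ^ j * M := by
          gcongr
          · exact norm_coeff_le_tailSup hθ0 hc m j
          · exact hM _
      _ = _ := by rw [show θ / 4 = θ * (1 / 4) by ring, mul_pow]; ring
  have hlipK := hb (C₁ * S / (4 ^ m * 4 ^ m)) (by positivity) fun y hy => by
    obtain ⟨z, rfl⟩ : ∃ z, y = 4 ^ m * z := ⟨y / 4 ^ m, by field_simp⟩
    rw [← mul_sub, abs_mul, abs_of_pos h4m, mul_comm κ] at hy
    have hzx := le_of_mul_le_mul_left hy h4m
    have hz : e / 4 < z := by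
      have := (abs_le.1 hzx).1
      rw [hκ] at this; linarith
    have h1 : ‖((4 ^ m : ℝ) : ℂ) * (K (4 ^ m * z) - K (4 ^ m * x))‖ ≤ C₁ * S * |z - x| := by
      rw [mul_sub, hrep' z hz, hrep' x hx, mul_kerFull_eq he he0 hz, mul_kerFull_eq he he0 hx,
        ← (hsm z).tsum_sub (hsm x)]
      refine (tsum_of_norm_bounded (hgs.hasSum.mul_left _) (hterm z)).trans (le_of_eq ?_)
      rw [hC₁]; ring
    rw [norm_mul, Complex.norm_real, Real.norm_of_nonneg h4m.le] at h1
    rw [← mul_sub, abs_mul, abs_of_pos h4m]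
    rw [← mul_le_mul_iff_right₀ h4m]
    refine h1.trans (le_of_eq ?_)
    field_simp
  have hN1 : (1 : ℝ) ≤ N := by exact_mod_cast le_max_right _ _
  have hNN : max (B * (2 / δ)) (max (18 * C₁) (2 / δ)) ≤ N := hN₂.trans (by
    exact_mod_cast (le_max_right N₁ N₂).trans (le_max_left _ _))
  have hNa : B * (2 / δ) ≤ N := (le_max_left _ _).trans hNN
  have hNb : 18 * C₁ ≤ N := (le_max_left _ _).trans ((le_max_right _ _).trans hNN)
  have hNc : 2 / δ ≤ N := (le_max_right _ _).trans ((le_max_right _ _).trans hNN)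
  have hsq : √((4 : ℝ) ^ m) = 2 ^ m := by
    rw [show (4 : ℝ) = 2 ^ 2 by norm_num, ← pow_mul, mul_comm 2 m, pow_mul,
      Real.sqrt_sq (by positivity)]
  rw [hsq] at hlipK
  have hexp : (4 : ℝ) ^ m * Real.exp (-δ * 4 ^ m) ≤ (2 / δ) * Real.exp (-4 ^ m / N) := by
    have e1 : Real.exp (-δ * 4 ^ m) = Real.exp (-(δ / 2 * 4 ^ m)) * Real.exp (-(δ / 2 * 4 ^ m)) := by
      rw [← Real.exp_add]; congr 1; ring
    have e2 : Real.exp (-(δ / 2 * 4 ^ m)) ≤ Real.exp (-4 ^ m / N) := by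
      refine Real.exp_le_exp.2 ?_
      rw [neg_div, neg_le_neg_iff, div_le_iff₀ (by linarith)]
      rw [div_le_iff₀ hδ] at hNc
      nlinarith
    have e3 : (4 : ℝ) ^ m * Real.exp (-(δ / 2 * 4 ^ m)) ≤ 2 / δ := by
      rw [Real.exp_neg, ← div_eq_mul_inv, div_le_div_iff₀ (Real.exp_pos _) hδ]
      linarith [Real.add_one_le_exp (δ / 2 * 4 ^ m)]
    rw [e1, ← mul_assoc]
    gcongr
  calc (4 : ℝ) ^ m * ‖K (4 ^ m * x)‖
      ≤ 4 ^ m * (B * Real.exp (-δ * 4 ^ m) + 18 * 2 ^ m * (C₁ * S / (4 ^ m * 4 ^ m))) := by gcongr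
    _ = B * (4 ^ m * Real.exp (-δ * 4 ^ m)) + 18 * C₁ * ((1 / 2) ^ m * S) := by
        have : (1 / 2 : ℝ) ^ m = 2 ^ m / 4 ^ m := by rw [← div_pow]; norm_num
        rw [this]; field_simp
    _ ≤ B * ((2 / δ) * Real.exp (-4 ^ m / N)) + 18 * C₁ * ((1 / 2) ^ m * S) := by gcongr
    _ ≤ N * Real.exp (-4 ^ m / N) + N * ((1 / 2) ^ m * S) := by
        rw [← mul_assoc]
        gcongr
    _ = _ := by ring

/-- Exponential decay of the coefficients at large scales, when the dilates of the profile have no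
common zero in their symbols. -/
theorem exists_norm_coeff_le_exp {c : ℤ → ℂ} {μ : ℝ → ℂ} {e e₀ L₀ A θ : ℝ}
    (he : ∀ t, e < |t| → μ t = 0) (he0 : 0 < e) (hL₀ : 0 ≤ L₀)
    (hlip : ∀ s t, ‖μ s - μ t‖ ≤ L₀ * |s - t|) (hθ1 : 1 ≤ θ) (hθ : θ < 2)
    (hc : ∀ k, ‖c k‖ ≤ A * θ ^ (-k)) {K : ℝ → ℂ} (hrep : ∀ y, e₀ < y → K y = kerFull c μ y)
    (hK : ∀ x κ, 0 < x → 0 < κ → ∃ B δ, 0 ≤ B ∧ 0 < δ ∧ ∀ᶠ a in atTop, ∀ L, 0 ≤ L →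
      (∀ y, |y - a * x| ≤ κ * a → ‖K y - K (a * x)‖ ≤ L * |y - a * x|) →
      ‖K (a * x)‖ ≤ B * Real.exp (-δ * a) + 18 * √a * L)
    (hz : ∀ l : ℂ, ‖l‖ ≤ θ → ∃ x, e / 4 < x ∧ x ≤ e ∧
      ∑' j : ℕ, ((1 / 4 : ℝ) ^ j : ℝ) * μ ((1 / 4 : ℝ) ^ j * x) * l ^ j ≠ 0) :
    ∃ B δ, 0 ≤ B ∧ 0 < δ ∧ ∀ᶠ p : ℕ in atTop, ‖c (-p)‖ ≤ B * Real.exp (-δ * 4 ^ p) := by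
  have hθ0 : 0 < θ := by linarith
  have hμc : Continuous μ := by
    refine (LipschitzWith.of_dist_le_mul (K := ⟨L₀, hL₀⟩) fun s t => ?_).continuous
    rw [dist_eq_norm, Real.dist_eq]; exact hlip s t
  obtain ⟨M, hM0, hM⟩ := exists_norm_le_of_compact_support hμc he
  let ι := {x : ℝ // e / 4 < x ∧ x ≤ e}
  let a : ι → ℕ → ℂ := fun x j => ((1 / 4 : ℝ) ^ j : ℝ) * μ ((1 / 4 : ℝ) ^ j * x)
  obtain ⟨s, C, hC, hbd⟩ := exists_bound_of_no_common_zero hθ0.le a (fun x => by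
      refine Summable.of_nonneg_of_le (fun j => by positivity) (fun j => ?_)
        (summable_geometric_quarter hθ0 (by linarith) M)
      simp only [a]
      rw [norm_mul, Complex.norm_real, Real.norm_of_nonneg (by positivity)]
      calc _ ≤ (1 / 4 : ℝ) ^ j * M * θ ^ j := by gcongr; exact hM _
        _ = _ := by rw [show θ / 4 = 1 / 4 * θ by ring, mul_pow]; ring)
    (fun l hl => by
      obtain ⟨x, hx1, hx2, hx⟩ := hz l hl
      exact ⟨⟨x, hx1, hx2⟩, hx⟩)
  choose N hNp hN using fun x : ι => exists_pow_mul_norm_le he he0 hL₀ hlip hθ0 hθ hc hrep hK x.2.1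
  set N₀ := max (s.sup N) 1
  have hN0 : (1 : ℝ) ≤ N₀ := by exact_mod_cast le_max_right _ _
  refine ⟨2 * (C * N₀), 1 / N₀, by positivity, by positivity, ?_⟩
  have hsmall : ∀ᶠ p : ℕ in atTop, C * N₀ * (1 / 2 : ℝ) ^ p < 1 / 2 := by
    have := (tendsto_pow_atTop_nhds_zero_of_lt_one (r := (1 / 2 : ℝ)) (by norm_num)
      (by norm_num)).const_mul (C * N₀)
    rw [mul_zero] at this
    exact this.eventually_lt_const (by norm_num)
  filter_upwards [hsmall, eventually_ge_atTop N₀] with p hp hpN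
  set S := tailSup c θ p with hS
  have hS0 : 0 ≤ S := tailSup_nonneg c hθ0 p
  set D := N₀ * ((1 / 2 : ℝ) ^ p * S + Real.exp (-4 ^ p / N₀)) with hD
  let v : ℕ → ℂ := fun j => c (-(p + j)) * ((θ : ℂ) ^ j)⁻¹
  have hvn : ∀ j, ‖v j‖ = ‖c (-(p + j))‖ * (θ ^ j)⁻¹ := fun j => by
    simp only [v]
    rw [norm_mul, norm_inv, norm_pow, Complex.norm_real, Real.norm_of_nonneg hθ0.le]
  have hθc : (θ : ℂ) ≠ 0 := by exact_mod_cast hθ0.ne'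
  have hv := hbd v D (by positivity)
    ⟨A * θ ^ p, fun j => (hvn j).trans_le (norm_coeff_mul_inv_le hθ0 hc p j)⟩ (fun x hx q => by
      have hNx : N x ≤ N₀ := (Finset.le_sup hx).trans (le_max_left _ _)
      obtain ⟨h1, h2⟩ := hN x (p + q) (by omega)
      have hNx1 : (N x : ℝ) ≤ N₀ := by exact_mod_cast hNx
      have heq : ∑' j, a x j * ((θ : ℂ) ^ j * v (q + j)) =
          ((θ : ℂ) ^ q)⁻¹ * (((4 ^ (p + q) : ℝ) : ℂ) * K (4 ^ (p + q) * x)) := by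
        rw [h2, mul_kerFull_eq he he0 x.2.1, ← tsum_mul_left]
        congr 1; ext j
        simp only [a, v]
        have : (-((p : ℤ) + ((q + j : ℕ) : ℤ))) = -(((p + q : ℕ) : ℤ) + j) := by push_cast; ring
        rw [this, pow_add]
        field_simp
      rw [heq, norm_mul, norm_inv, norm_pow, Complex.norm_real, Real.norm_of_nonneg hθ0.le, norm_mul,
        Complex.norm_real, Real.norm_of_nonneg (by positivity : (0 : ℝ) ≤ 4 ^ (p + q))]
      rw [inv_mul_le_iff₀ (by positivity)]
      have hθq : 1 ≤ θ ^ q := one_le_pow₀ hθ1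
      have hexp : Real.exp (-4 ^ (p + q) / N x) ≤ Real.exp (-4 ^ p / N₀) := by
        refine Real.exp_le_exp.2 ?_
        rw [neg_div, neg_div, neg_le_neg_iff]
        have : (0 : ℝ) < N x := by exact_mod_cast hNp x
        gcongr
        · norm_num
        · omega
      calc _ ≤ _ := h1
        _ ≤ N₀ * ((1 / 2) ^ p * (θ ^ q * S) + θ ^ q * Real.exp (-4 ^ p / N₀)) := by
            have e1 : (1 / 2 : ℝ) ^ (p + q) ≤ (1 / 2) ^ p :=
              pow_le_pow_of_le_one (by norm_num) (by norm_num) (by omega)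
            have e2 := tailSup_add_le hθ0 hc p q
            have e3 := tailSup_nonneg c hθ0 (p + q)
            gcongr
            exact hexp.trans (le_mul_of_one_le_left (Real.exp_pos _).le hθq)
        _ = _ := by rw [hD]; ring)
  have hSle : S ≤ C * D := ciSup_le fun j => (hvn j).symm.trans_le (hv j)
  have hcS : ‖c (-p)‖ ≤ S := by
    have := norm_coeff_le_tailSup hθ0 hc p 0
    simpa using this
  have h4 : -(1 / (N₀ : ℝ)) * 4 ^ p = -4 ^ p / N₀ := by ring
  rw [h4]
  rw [hD] at hSle
  nlinarith [Real.exp_pos (-4 ^ p / N₀)]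

/-- The profile `∑ λʲ 4⁻ʲ μ(4⁻ʲ t)`, solving `μ(t) = ν(t) - (λ/4) ν(t/4)`. -/
def divProf (l : ℂ) (μ : ℝ → ℂ) (t : ℝ) : ℂ :=
  ∑' j : ℕ, ((1 / 4 : ℝ) ^ j : ℝ) * μ ((1 / 4 : ℝ) ^ j * t) * l ^ j

theorem norm_divProf_term_le {l : ℂ} {θ : ℝ} (hl : ‖l‖ ≤ θ) {M : ℝ} {z : ℂ} (hz : ‖z‖ ≤ M) (j : ℕ) :
    ‖((1 / 4 : ℝ) ^ j : ℝ) * z * l ^ j‖ ≤ M * (θ / 4) ^ j := by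
  rw [norm_mul, norm_mul, Complex.norm_real, Real.norm_of_nonneg (by positivity), norm_pow]
  have hM : 0 ≤ M := (norm_nonneg _).trans hz
  calc _ ≤ (1 / 4 : ℝ) ^ j * M * θ ^ j := by gcongr
    _ = _ := by rw [show θ / 4 = 1 / 4 * θ by ring, mul_pow]; ring

section
variable {l : ℂ} {θ : ℝ} {M : ℝ} {μ : ℝ → ℂ}

theorem summable_divProf (hθ : 0 < θ) (hθ4 : θ < 4) (hl : ‖l‖ ≤ θ) (hM : ∀ t, ‖μ t‖ ≤ M) (t : ℝ) :
    Summable fun j : ℕ => ((1 / 4 : ℝ) ^ j : ℝ) * μ ((1 / 4 : ℝ) ^ j * t) * l ^ j :=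
  Summable.of_norm_bounded (summable_geometric_quarter hθ hθ4 M)
    fun j => norm_divProf_term_le hl (hM _) j

theorem norm_divProf_le (hθ : 0 < θ) (hθ4 : θ < 4) (hl : ‖l‖ ≤ θ) (hM : ∀ t, ‖μ t‖ ≤ M) (t : ℝ) :
    ‖divProf l μ t‖ ≤ M * (1 - θ / 4)⁻¹ :=
  tsum_of_norm_bounded ((hasSum_geometric_of_lt_one (by positivity) (by linarith)).mul_left M)
    fun j => norm_divProf_term_le hl (hM _) j

theorem divProf_eq (hθ : 0 < θ) (hθ4 : θ < 4) (hl : ‖l‖ ≤ θ) (hM : ∀ t, ‖μ t‖ ≤ M) (t : ℝ) :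
    divProf l μ t = μ t + l / 4 * divProf l μ (t / 4) := by
  conv_lhs => unfold divProf
  rw [(summable_divProf hθ hθ4 hl hM t).tsum_eq_zero_add]
  unfold divProf
  rw [← tsum_mul_left]
  congr 1
  · simp
  · congr 1; ext j
    rw [show (1 / 4 : ℝ) ^ (j + 1) * t = (1 / 4 : ℝ) ^ j * (t / 4) by ring]
    push_cast; ring

theorem norm_divProf_sub_le {L : ℝ} (hL : 0 ≤ L) (hθ : 0 < θ) (hθ4 : θ < 4) (hl : ‖l‖ ≤ θ)
    (hM : ∀ t, ‖μ t‖ ≤ M) (hlip : ∀ s t, ‖μ s - μ t‖ ≤ L * |s - t|) (s t : ℝ) :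
    ‖divProf l μ s - divProf l μ t‖ ≤ L * (1 - θ / 4)⁻¹ * |s - t| := by
  unfold divProf
  rw [← (summable_divProf hθ hθ4 hl hM s).tsum_sub (summable_divProf hθ hθ4 hl hM t)]
  have hg := (hasSum_geometric_of_lt_one (by positivity : 0 ≤ θ / 4) (by linarith)).mul_left
    (L * |s - t|)
  refine (tsum_of_norm_bounded hg fun j => ?_).trans (le_of_eq (by ring))
  rw [← sub_mul, ← mul_sub]
  refine norm_divProf_term_le hl ?_ j
  refine (hlip _ _).trans ?_
  rw [← mul_sub, abs_mul, abs_of_pos (by positivity)]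
  gcongr
  exact mul_le_of_le_one_left (abs_nonneg _) (pow_le_one₀ (by norm_num) (by norm_num))

theorem divProf_neg (heven : ∀ t, μ (-t) = μ t) (t : ℝ) : divProf l μ (-t) = divProf l μ t := by
  unfold divProf
  simp_rw [mul_neg, heven]

theorem divProf_eq_zero (hθ : 0 < θ) (hθ4 : θ < 4) (hl : ‖l‖ ≤ θ) (hM : ∀ t, ‖μ t‖ ≤ M)
    (heven : ∀ t, μ (-t) = μ t) {e : ℝ} (he0 : 0 < e) (he : ∀ t, e < |t| → μ t = 0)
    (hz : ∀ x, e / 4 < x → x ≤ e → divProf l μ x = 0) (t : ℝ) (ht : e / 4 < |t|) :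
    divProf l μ t = 0 := by
  wlog hpos : 0 ≤ t generalizing t
  · rw [← divProf_neg heven]
    exact this (-t) (by rwa [abs_neg]) (by linarith)
  rw [abs_of_nonneg hpos] at ht
  have key : ∀ n : ℕ, ∀ x, e / 4 < x → x ≤ 4 ^ n * e → divProf l μ x = 0 := by
    intro n
    induction n with
    | zero => intro x h1 h2; exact hz x h1 (by simpa using h2)
    | succ n ih =>
      intro x h1 h2
      rcases le_or_gt x e with h | h
      · exact hz x h1 h
      · rw [divProf_eq hθ hθ4 hl hM, he x (h.trans_le (le_abs_self x)),
          ih (x / 4) (by linarith) (by rw [pow_succ] at h2; linarith)]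
        simp
  obtain ⟨n, hn⟩ := pow_unbounded_of_one_lt (t / e) (by norm_num : (1 : ℝ) < 4)
  exact key n t ht ((div_lt_iff₀ he0).1 hn).le

end

theorem summable_kerFull {c : ℤ → ℂ} {μ : ℝ → ℂ} {A θ M e : ℝ} (hθ : 0 < θ) (hθ4 : θ < 4)
    (hA : 0 ≤ A) (hc : ∀ k, ‖c k‖ ≤ A * θ ^ (-k)) (hM : ∀ t, ‖μ t‖ ≤ M)
    (he : ∀ t, e < |t| → μ t = 0) {x : ℝ} (hx : 0 < x) :
    Summable fun k : ℤ => c k * ((4 : ℝ) ^ k : ℝ) * μ ((4 : ℝ) ^ k * x) := by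
  refine Summable.of_nat_of_neg_add_one ?_ ?_
  · obtain ⟨n, hn⟩ := pow_unbounded_of_one_lt (e / x) (by norm_num : (1 : ℝ) < 4)
    refine summable_of_ne_finset_zero (s := Finset.range n) fun k hk => ?_
    rw [Finset.mem_range, not_lt] at hk
    rw [he, mul_zero]
    rw [abs_of_pos (by positivity), zpow_natCast]
    have : (4 : ℝ) ^ n ≤ 4 ^ k := pow_le_pow_right₀ (by norm_num) hk
    rw [div_lt_iff₀ hx] at hn
    nlinarith
  · exact Summable.of_norm_bounded (summable_geometric_quarter hθ hθ4 (A * M * (θ / 4)))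
      fun j => norm_coeff_mul_le hθ hA hc j (hM _)

/-- Twisted difference of coefficients, dual to `divProf`. -/
def divCoeff (l : ℂ) (c : ℤ → ℂ) (k : ℤ) : ℂ := c k - l * c (k + 1)

theorem norm_divCoeff_le {l : ℂ} {c : ℤ → ℂ} {A θ : ℝ} (hθ : 0 < θ) (hl : ‖l‖ ≤ θ)
    (hc : ∀ k, ‖c k‖ ≤ A * θ ^ (-k)) (k : ℤ) : ‖divCoeff l c k‖ ≤ 2 * A * θ ^ (-k) := by
  have h1 : θ * θ ^ (-(k + 1)) = θ ^ (-k) := by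
    rw [← zpow_one_add₀ hθ.ne']; congr 1; ring
  calc _ ≤ ‖c k‖ + ‖l‖ * ‖c (k + 1)‖ := by
        rw [← norm_mul]; exact norm_sub_le _ _
    _ ≤ A * θ ^ (-k) + θ * (A * θ ^ (-(k + 1))) := by gcongr; exacts [hc k, hc (k + 1)]
    _ = A * θ ^ (-k) + A * (θ * θ ^ (-(k + 1))) := by ring
    _ = _ := by rw [h1]; ring

theorem kerFull_divProf {l : ℂ} {c : ℤ → ℂ} {μ : ℝ → ℂ} {A θ M e : ℝ} (hθ : 0 < θ) (hθ4 : θ < 4)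
    (hA : 0 ≤ A) (hl : ‖l‖ ≤ θ) (hc : ∀ k, ‖c k‖ ≤ A * θ ^ (-k)) (hM : ∀ t, ‖μ t‖ ≤ M)
    (he : ∀ t, e < |t| → divProf l μ t = 0) {x : ℝ} (hx : 0 < x) :
    kerFull (divCoeff l c) (divProf l μ) x = kerFull c μ x := by
  have hν := norm_divProf_le hθ hθ4 hl hM
  have hs := summable_kerFull hθ hθ4 hA hc hν he hx
  have hs' : Summable fun k : ℤ =>
      l * c (k + 1) * ((4 : ℝ) ^ k : ℝ) * divProf l μ ((4 : ℝ) ^ k * x) := by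
    refine (((Equiv.addRight (1 : ℤ)).summable_iff.2
      (summable_kerFull hθ hθ4 hA hc hν he (by linarith : 0 < x / 4))).mul_left (l / 4)).congr
      fun k => ?_
    simp only [Function.comp, Equiv.coe_addRight]
    rw [zpow_add_one₀ (by norm_num), show (4 : ℝ) ^ k * 4 * (x / 4) = 4 ^ k * x by ring]
    push_cast; ring
  have e1 : kerFull (divCoeff l c) (divProf l μ) x =
      (∑' k : ℤ, c k * ((4 : ℝ) ^ k : ℝ) * divProf l μ ((4 : ℝ) ^ k * x)) -
      ∑' k : ℤ, l * c (k + 1) * ((4 : ℝ) ^ k : ℝ) * divProf l μ ((4 : ℝ) ^ k * x) := by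
    rw [← hs.tsum_sub hs']
    unfold kerFull divCoeff
    congr 1; ext k; ring
  have e2 : ∑' k : ℤ, l * c (k + 1) * ((4 : ℝ) ^ k : ℝ) * divProf l μ ((4 : ℝ) ^ k * x) =
      ∑' k : ℤ, c k * ((4 : ℝ) ^ k : ℝ) * (l / 4 * divProf l μ ((4 : ℝ) ^ k * x / 4)) := by
    rw [← (Equiv.addRight (1 : ℤ)).tsum_eq (fun k : ℤ =>
      c k * ((4 : ℝ) ^ k : ℝ) * (l / 4 * divProf l μ ((4 : ℝ) ^ k * x / 4)))]
    congr 1; ext k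
    simp only [Equiv.coe_addRight]
    rw [zpow_add_one₀ (by norm_num), show (4 : ℝ) ^ k * 4 * x / 4 = 4 ^ k * x by ring]
    push_cast; ring
  have hs2 : Summable fun k : ℤ =>
      c k * ((4 : ℝ) ^ k : ℝ) * (l / 4 * divProf l μ ((4 : ℝ) ^ k * x / 4)) := by
    refine ((summable_kerFull hθ hθ4 hA hc hν he (by linarith : 0 < x / 4)).mul_left
      (l / 4)).congr fun k => ?_
    rw [mul_div_assoc]; ring
  rw [e1, e2, ← hs.tsum_sub hs2]
  unfold kerFull
  congr 1; ext k
  rw [← mul_sub]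
  congr 1
  rw [divProf_eq hθ hθ4 hl hM ((4 : ℝ) ^ k * x)]
  ring

/-- Data obtained from the pair `(c₀, μ₀)` after `n` divisions. -/
structure DividedPair (c₀ : ℤ → ℂ) (μ₀ : ℝ → ℂ) (θ e₀ M : ℝ) (Z : (ℤ → ℂ) → Prop) (n : ℕ)
    (c : ℤ → ℂ) (μ : ℝ → ℂ) : Prop where
  lipschitz : ∃ L, 0 ≤ L ∧ ∀ s t, ‖μ s - μ t‖ ≤ L * |s - t|
  growth : ∃ A, 0 ≤ A ∧ ∀ k, ‖c k‖ ≤ A * θ ^ (-k)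
  even : ∀ t, μ (-t) = μ t
  support : ∀ t, e₀ / 4 ^ n < |t| → μ t = 0
  bound : ∀ t, ‖μ t‖ ≤ M * (1 - θ / 4)⁻¹ ^ n
  kerFull_eq : ∀ x, 0 < x → kerFull c μ x = kerFull c₀ μ₀ x
  prop : Z c
  le : ∀ x, e₀ / 4 < x → x ≤ e₀ → ‖μ₀ x‖ ≤ (θ / 4) ^ n * ‖μ (x / 4 ^ n)‖

theorem DividedPair.succ {c₀ : ℤ → ℂ} {μ₀ : ℝ → ℂ} {θ e₀ M : ℝ} {Z : (ℤ → ℂ) → Prop} {n : ℕ}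
    {c : ℤ → ℂ} {μ : ℝ → ℂ} (h : DividedPair c₀ μ₀ θ e₀ M Z n c μ) (hθ : 0 < θ) (hθ4 : θ < 4)
    (he0 : 0 < e₀)
    (hZ : ∀ c l, (∃ A, 0 ≤ A ∧ ∀ k, ‖c k‖ ≤ A * θ ^ (-k)) → ‖l‖ ≤ θ → Z c → Z (divCoeff l c))
    {l : ℂ} (hl : ‖l‖ ≤ θ)
    (hz : ∀ x, e₀ / 4 ^ n / 4 < x → x ≤ e₀ / 4 ^ n → divProf l μ x = 0) :
    DividedPair c₀ μ₀ θ e₀ M Z (n + 1) (divCoeff l c) (divProf l μ) := by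
  obtain ⟨L, hL, hlip⟩ := h.lipschitz
  obtain ⟨A, hA, hc⟩ := h.growth
  have hpos : (0 : ℝ) < 1 - θ / 4 := by linarith
  have hsupp : ∀ t, e₀ / 4 ^ (n + 1) < |t| → divProf l μ t = 0 := fun t ht =>
    divProf_eq_zero hθ hθ4 hl h.bound h.even (by positivity) h.support hz t (by
      rwa [div_div, ← pow_succ])
  refine ⟨⟨_, by positivity, norm_divProf_sub_le hL hθ hθ4 hl h.bound hlip⟩,
    ⟨2 * A, by positivity, norm_divCoeff_le hθ hl hc⟩, divProf_neg h.even, hsupp, fun t => ?_,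
    fun x hx => ?_, hZ c l h.growth hl h.prop, fun x hx1 hx2 => ?_⟩
  · rw [pow_succ, ← mul_assoc]
    exact norm_divProf_le hθ hθ4 hl h.bound t
  · rw [kerFull_divProf hθ hθ4 hA hl hc h.bound hsupp hx, h.kerFull_eq x hx]
  · refine (h.le x hx1 hx2).trans ?_
    rw [pow_succ (θ / 4), mul_assoc]
    gcongr
    have h1 := divProf_eq hθ hθ4 hl h.bound (x / 4 ^ n)
    rw [hz (x / 4 ^ n) (by rw [div_right_comm]; gcongr) (by gcongr)] at h1
    rw [pow_succ, ← div_div, eq_neg_of_add_eq_zero_left h1.symm, norm_neg, norm_mul, norm_div]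
    simp only [RCLike.norm_ofNat]
    gcongr

theorem exists_dividedPair_no_common_zero {c₀ : ℤ → ℂ} {μ₀ : ℝ → ℂ} {θ e₀ M L A x : ℝ}
    {Z : (ℤ → ℂ) → Prop} (hθ : 0 < θ) (hθ2 : θ < 2) (he0 : 0 < e₀)
    (hZ : ∀ c l, (∃ A, 0 ≤ A ∧ ∀ k, ‖c k‖ ≤ A * θ ^ (-k)) → ‖l‖ ≤ θ → Z c → Z (divCoeff l c))
    (hL : 0 ≤ L) (hlip : ∀ s t, ‖μ₀ s - μ₀ t‖ ≤ L * |s - t|)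
    (hA : 0 ≤ A) (hc : ∀ k, ‖c₀ k‖ ≤ A * θ ^ (-k)) (heven : ∀ t, μ₀ (-t) = μ₀ t)
    (hsupp : ∀ t, e₀ < |t| → μ₀ t = 0) (hM : ∀ t, ‖μ₀ t‖ ≤ M) (hZ0 : Z c₀)
    (hx1 : e₀ / 4 < x) (hx2 : x ≤ e₀) (hx : μ₀ x ≠ 0) :
    ∃ n c μ, DividedPair c₀ μ₀ θ e₀ M Z n c μ ∧ ∀ l : ℂ, ‖l‖ ≤ θ →
      ∃ y, e₀ / 4 ^ n / 4 < y ∧ y ≤ e₀ / 4 ^ n ∧ divProf l μ y ≠ 0 := by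
  by_contra! hcon
  have hall : ∀ n, ∃ c μ, DividedPair c₀ μ₀ θ e₀ M Z n c μ := by
    intro n
    induction n with
    | zero =>
      exact ⟨c₀, μ₀, ⟨L, hL, hlip⟩, ⟨A, hA, hc⟩, heven, by simpa using hsupp, by simpa using hM,
        fun _ _ => rfl, hZ0, fun y _ _ => by simp⟩
    | succ n ih =>
      obtain ⟨c, μ, h⟩ := ih
      obtain ⟨l, hl, hz⟩ := hcon n c μ h
      exact ⟨_, _, h.succ hθ (by linarith) he0 hZ hl hz⟩
  have hq : θ / 4 * (1 - θ / 4)⁻¹ < 1 := by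
    rw [mul_inv_lt_iff₀ (by linarith)]; linarith
  have hq0 : 0 ≤ θ / 4 * (1 - θ / 4)⁻¹ :=
    mul_nonneg (by positivity) (inv_nonneg.2 (by linarith))
  have hle : ∀ n : ℕ, ‖μ₀ x‖ ≤ (θ / 4 * (1 - θ / 4)⁻¹) ^ n * M := fun n => by
    obtain ⟨c, μ, h⟩ := hall n
    refine (h.le x hx1 hx2).trans ?_
    rw [mul_pow, mul_assoc]
    gcongr
    rw [mul_comm]
    exact h.bound _
  have hlim := (tendsto_pow_atTop_nhds_zero_of_lt_one hq0 hq).mul_const M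
  rw [zero_mul] at hlim
  exact hx (norm_le_zero_iff.1 (ge_of_tendsto' hlim hle))

/-- If the large-scale kernel is the one of a compactly supported even profile and its dyadic
Fourier series vanishes near the origin, then the coefficients at large scales of some divided
sequence decay superexponentially. -/
theorem exists_divided_coeff_le_exp {c₀ : ℤ → ℂ} {μ₀ : ℝ → ℂ} {θ e₀ L A C r x : ℝ}
    {Z : (ℤ → ℂ) → Prop} (hθ1 : 1 ≤ θ) (hθ2 : θ < 2) (he0 : 0 < e₀)
    (hZ : ∀ c l, (∃ A, 0 ≤ A ∧ ∀ k, ‖c k‖ ≤ A * θ ^ (-k)) → ‖l‖ ≤ θ → Z c → Z (divCoeff l c))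
    (hL : 0 ≤ L) (hlip : ∀ s t, ‖μ₀ s - μ₀ t‖ ≤ L * |s - t|)
    (hA : 0 ≤ A) (hc : ∀ k, ‖c₀ k‖ ≤ A * θ ^ (-k)) (heven : ∀ t, μ₀ (-t) = μ₀ t)
    (hsupp : ∀ t, e₀ < |t| → μ₀ t = 0) (hint : ∫ t, μ₀ t = 0)
    (h1 : ∀ s, ‖ftLine μ₀ s‖ ≤ C * |s|) (h2 : ∀ s, ‖ftLine μ₀ s‖ * |s| ≤ C) (hr : 0 < r)
    (hF : ∀ τ, |τ| < r → ∑' k : ℤ, c₀ k * ftLine μ₀ ((4 : ℝ) ^ (-k) * τ) = 0) (hZ0 : Z c₀)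
    (hx1 : e₀ / 4 < x) (hx2 : x ≤ e₀) (hx : μ₀ x ≠ 0) :
    ∃ c, Z c ∧ (∃ A, 0 ≤ A ∧ ∀ k, ‖c k‖ ≤ A * θ ^ (-k)) ∧
      ∃ B δ, 0 ≤ B ∧ 0 < δ ∧ ∀ᶠ p : ℕ in atTop, ‖c (-p)‖ ≤ B * Real.exp (-δ * 4 ^ p) := by
  have hθ : 0 < θ := by linarith
  have hμc : Continuous μ₀ := by
    refine (LipschitzWith.of_dist_le_mul (K := ⟨L, hL⟩) fun s t => ?_).continuous
    rw [dist_eq_norm, Real.dist_eq]; exact hlip s t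
  obtain ⟨M, hM0, hM⟩ := exists_norm_le_of_compact_support hμc hsupp
  obtain ⟨n, c, μ, h, hz⟩ := exists_dividedPair_no_common_zero hθ hθ2 he0 hZ hL hlip hA hc heven
    hsupp hM hZ0 hx1 hx2 hx
  obtain ⟨L', hL', hlip'⟩ := h.lipschitz
  obtain ⟨A', hA', hc'⟩ := h.growth
  refine ⟨c, h.prop, h.growth, exists_norm_coeff_le_exp (K := kerLarge c₀ μ₀) (e₀ := e₀)
    h.support (by positivity) hL' hlip' hθ1 hθ2 hc' (fun y hy => ?_)
    (fun x κ hx hκ => exists_norm_kerLarge_le_of_lipschitz hμc he0.le hsupp hint hA hθ1 hθ2 hc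
      h1 h2 hr hF hx hκ) hz⟩
  have hy0 : 0 < y := he0.trans hy
  rw [h.kerFull_eq y hy0]
  have hs := summable_kerFull hθ (by linarith) hA hc hM hsupp hy0
  unfold kerFull kerLarge
  rw [← (hs.hasSum.nat_add_neg_add_one).tsum_eq]
  congr 1; ext j
  have : μ₀ ((4 : ℝ) ^ (j : ℤ) * y) = 0 := by
    refine hsupp _ ?_
    rw [abs_of_pos (by positivity), zpow_natCast]
    have : (1 : ℝ) ≤ 4 ^ j := one_le_pow₀ (by norm_num)
    nlinarith
  rw [this]
  simp

theorem scl_scl (a b : ℝ) (z : Fin 4 → ℝ) : scl a (scl b z) = scl (a * b) z := by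
  ext i; simp only [scl, mul_pow]; ring

theorem scl_one (z : Fin 4 → ℝ) : scl 1 z = z := by ext i; simp [scl]

theorem scl_smul (a b : ℝ) (z : Fin 4 → ℝ) : scl a (b • z) = b • scl a z := by
  ext i; simp only [scl, Pi.smul_apply, smul_eq_mul]; ring

theorem scl_add (a : ℝ) (z w : Fin 4 → ℝ) : scl a (z + w) = scl a z + scl a w := by
  ext i; simp only [scl, Pi.add_apply]; ring

theorem scl_zero_right (a : ℝ) : scl a 0 = 0 := by ext i; simp [scl]

theorem one_le_sExp (i : Fin 4) : 1 ≤ sExp i := by fin_cases i <;> simp [sExp]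

theorem sExp_le_two (i : Fin 4) : sExp i ≤ 2 := by fin_cases i <;> simp [sExp]

theorem continuous_scl (l : ℝ) : Continuous (scl l) := by unfold scl; fun_prop

theorem norm_scl_le {l : ℝ} (h0 : 0 ≤ l) (h1 : l ≤ 1) (z : Fin 4 → ℝ) : ‖scl l z‖ ≤ l * ‖z‖ := by
  refine (pi_norm_le_iff_of_nonneg (by positivity)).2 fun i => ?_
  rw [scl, norm_mul, Real.norm_of_nonneg (by positivity)]
  have := pow_le_pow_of_le_one h0 h1 (one_le_sExp i)
  rw [pow_one] at this
  exact mul_le_mul this (norm_le_pi_norm z i) (norm_nonneg _) h0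

theorem norm_scl_le_sq {l : ℝ} (h1 : 1 ≤ l) (z : Fin 4 → ℝ) : ‖scl l z‖ ≤ l ^ 2 * ‖z‖ := by
  refine (pi_norm_le_iff_of_nonneg (by positivity)).2 fun i => ?_
  rw [scl, norm_mul, Real.norm_of_nonneg (by positivity)]
  exact mul_le_mul (pow_le_pow_right₀ h1 (sExp_le_two i)) (norm_le_pi_norm z i) (norm_nonneg _)
    (by positivity)

theorem le_norm_scl {l : ℝ} (h1 : 1 ≤ l) (z : Fin 4 → ℝ) : l * ‖z‖ ≤ ‖scl l z‖ := by
  have hl : 0 < l := by linarith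
  have h := norm_scl_le (inv_nonneg.2 hl.le) (inv_le_one_of_one_le₀ h1) (scl l z)
  rw [scl_scl, inv_mul_cancel₀ hl.ne', scl_one] at h
  rwa [inv_mul_eq_div, le_div_iff₀ hl, mul_comm] at h

theorem integral_scl {l : ℝ} (hl : 0 < l) (G : (Fin 4 → ℝ) → ℂ) :
    ∫ z, G (scl l z) = ((l ^ 5)⁻¹ : ℝ) * ∫ z, G z := by
  let D : Matrix (Fin 4) (Fin 4) ℝ := Matrix.diagonal fun i => l ^ sExp i
  have hdet : D.det = l ^ 5 := by
    simp only [D, Matrix.det_diagonal, Fin.prod_univ_four, sExp]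
    simp; ring
  have hD0 : D.det ≠ 0 := by rw [hdet]; positivity
  have hD : ∀ z, Matrix.toLin' D z = scl l z := fun z => by
    ext i; simp [D, Matrix.mulVec_diagonal, scl]
  have hme : MeasurableEmbedding (scl l) := by
    let h : (Fin 4 → ℝ) ≃ₜ (Fin 4 → ℝ) :=
      { toFun := scl l
        invFun := scl l⁻¹
        left_inv := fun z => by rw [scl_scl, inv_mul_cancel₀ hl.ne', scl_one]
        right_inv := fun z => by rw [scl_scl, mul_inv_cancel₀ hl.ne', scl_one]
        continuous_toFun := continuous_scl l
        continuous_invFun := continuous_scl l⁻¹ }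
    exact h.measurableEmbedding
  have hmap := Real.map_matrix_volume_pi_eq_smul_volume_pi hD0
  rw [show (⇑(Matrix.toLin' D)) = scl l from funext hD] at hmap
  rw [← hme.integral_map, hmap, integral_smul_measure, hdet, abs_of_pos (by positivity),
    ENNReal.toReal_ofReal (by positivity), Complex.real_smul]

/-- The Fourier transform along the complex line spanned by `ξ`. -/
def ftRay (f : (Fin 4 → ℝ) → ℝ) (ξ : Fin 4 → ℝ) (s : ℂ) : ℂ :=
  ∫ z, Complex.exp (-Complex.I * s * ((∑ i, ξ i * z i : ℝ) : ℂ)) * (f z : ℂ)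

theorem ftRay_ofReal (f : (Fin 4 → ℝ) → ℝ) (ξ : Fin 4 → ℝ) (s : ℝ) :
    ftRay f ξ s = ft f (s • ξ) := by
  unfold ftRay ft
  congr 1; ext z
  congr 2
  simp only [Pi.smul_apply, smul_eq_mul]
  push_cast
  rw [mul_assoc, Finset.mul_sum]
  congr 1
  exact Finset.sum_congr rfl fun i _ => by ring

theorem ft_scl {l : ℝ} (hl : 0 < l) (f : (Fin 4 → ℝ) → ℝ) (ξ : Fin 4 → ℝ) :
    ft (fun z => l ^ 5 * f (scl l z)) ξ = ft f (scl l⁻¹ ξ) := by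
  have h := integral_scl hl fun z =>
    Complex.exp (-Complex.I * ((∑ i, scl l⁻¹ ξ i * z i : ℝ) : ℂ)) * (f z : ℂ)
  have e : ((l : ℂ) ^ 5) * (((l ^ 5)⁻¹ : ℝ) : ℂ) = 1 := by
    rw [← Complex.ofReal_pow, ← Complex.ofReal_mul, mul_inv_cancel₀ (by positivity)]; rfl
  unfold ft
  rw [← one_mul (∫ z, _), ← one_mul (∫ z, Complex.exp (-Complex.I *
    ((∑ i, scl l⁻¹ ξ i * z i : ℝ) : ℂ)) * (f z : ℂ)), ← e, mul_assoc, mul_assoc, ← h,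
    ← mul_assoc, e, one_mul, ← integral_const_mul]
  congr 1; ext z
  have : ∑ i, scl l⁻¹ ξ i * scl l z i = ∑ i, ξ i * z i := by
    refine Finset.sum_congr rfl fun i _ => ?_
    have : l ^ sExp i ≠ 0 := by positivity
    simp only [scl, inv_pow]; field_simp
  rw [this]; push_cast; ring

theorem ft_const_mul (a : ℝ) (f : (Fin 4 → ℝ) → ℝ) (ξ : Fin 4 → ℝ) :
    ft (fun z => a * f z) ξ = a * ft f ξ := by
  unfold ft
  rw [← integral_const_mul]
  congr 1; ext z; push_cast; ring

theorem norm_exp_neg_I_mul (x : ℝ) : ‖Complex.exp (-Complex.I * (x : ℂ))‖ = 1 := by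
  rw [show -Complex.I * (x : ℂ) = ((-x : ℝ) : ℂ) * Complex.I by push_cast; ring]
  exact Complex.norm_exp_ofReal_mul_I _

theorem integrable_exp_mul {f : (Fin 4 → ℝ) → ℝ} (hf : Continuous f) (hfs : HasCompactSupport f)
    {g : (Fin 4 → ℝ) → ℂ} (hg : Continuous g) : Integrable fun z => g z * (f z : ℂ) := by
  refine (by fun_prop : Continuous fun z => g z * (f z : ℂ)).integrable_of_hasCompactSupport ?_
  exact HasCompactSupport.mul_left (hfs.comp_left (g := ((↑) : ℝ → ℂ)) Complex.ofReal_zero)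

theorem continuous_ft {f : (Fin 4 → ℝ) → ℝ} (hf : Continuous f) (hfs : HasCompactSupport f) :
    Continuous (ft f) := by
  unfold ft
  refine continuous_of_dominated (bound := fun z => ‖f z‖) (fun ξ => ?_) (fun ξ => ?_)
    (hf.integrable_of_hasCompactSupport hfs).norm ?_
  · exact (by fun_prop : Continuous _).aestronglyMeasurable
  · refine Eventually.of_forall fun z => ?_
    rw [norm_mul, norm_exp_neg_I_mul, one_mul, Complex.norm_real]
  · exact Eventually.of_forall fun z => by fun_prop

theorem norm_ft_le (f : (Fin 4 → ℝ) → ℝ) (ξ : Fin 4 → ℝ) : ‖ft f ξ‖ ≤ ∫ z, ‖f z‖ := by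
  refine (norm_integral_le_integral_norm _).trans (le_of_eq ?_)
  congr 1; ext z
  rw [norm_mul, norm_exp_neg_I_mul, one_mul, Complex.norm_real]

theorem abs_sum_mul_le (ξ z : Fin 4 → ℝ) : |∑ i, ξ i * z i| ≤ 4 * ‖ξ‖ * ‖z‖ := by
  refine (Finset.abs_sum_le_sum_abs _ _).trans ?_
  calc ∑ i, |ξ i * z i| ≤ ∑ _i : Fin 4, ‖ξ‖ * ‖z‖ := by
        refine Finset.sum_le_sum fun i _ => ?_
        rw [abs_mul]
        exact mul_le_mul (norm_le_pi_norm ξ i) (norm_le_pi_norm z i) (abs_nonneg _) (norm_nonneg _)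
    _ = _ := by simp; ring

theorem norm_mul_ft_le {f : (Fin 4 → ℝ) → ℝ} (hf : ContDiff ℝ 1 f) (hfs : HasCompactSupport f)
    (ξ : Fin 4 → ℝ) : ‖ft f ξ‖ * ‖ξ‖ ≤ ∫ z, ‖fderiv ℝ f z‖ := by
  have hc : Continuous (fderiv ℝ f) := hf.continuous_fderiv one_ne_zero
  have hcs : HasCompactSupport (fderiv ℝ f) := hfs.fderiv ℝ
  have hint := (hc.integrable_of_hasCompactSupport (μ := volume) hcs).norm
  obtain ⟨i, hi⟩ : ∃ i, ‖ξ i‖ = ‖ξ‖ := by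
    obtain ⟨i, -, hi⟩ := Finset.exists_mem_eq_sup' (Finset.univ_nonempty (α := Fin 4)) fun i => ‖ξ i‖₊
    refine ⟨i, ?_⟩
    rw [Pi.norm_def, ← Finset.sup'_eq_sup Finset.univ_nonempty, hi]; rfl
  let v : Fin 4 → ℝ := Pi.single i 1
  let F : (Fin 4 → ℝ) → ℂ := fun z => (f z : ℂ)
  let g : (Fin 4 → ℝ) → ℂ := fun z => Complex.exp (-Complex.I * ((∑ i, ξ i * z i : ℝ) : ℂ))
  have hv : ‖v‖ ≤ 1 := (pi_norm_le_iff_of_nonneg zero_le_one).2 fun j => by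
    rcases eq_or_ne j i with h | h <;> simp [v, h]
  have hF' : ∀ z, fderiv ℝ F z v = ((fderiv ℝ f z v : ℝ) : ℂ) := fun z => by
    have := (Complex.ofRealCLM.hasFDerivAt.comp z
      (hf.differentiable one_ne_zero z).hasFDerivAt).fderiv
    change fderiv ℝ (Complex.ofRealCLM ∘ f) z v = _
    rw [this]; rfl
  have hgd : ∀ z, HasFDerivAt g (g z • (-Complex.I) • (Complex.ofRealCLM.comp
      (∑ i, ξ i • ContinuousLinearMap.proj (R := ℝ) (φ := fun _ : Fin 4 => ℝ) i))) z := fun z => by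
    have h1 : HasFDerivAt (fun z : Fin 4 → ℝ => ∑ i, ξ i * z i)
        (∑ i, ξ i • ContinuousLinearMap.proj (R := ℝ) (φ := fun _ : Fin 4 => ℝ) i) z := by
      convert (∑ i, ξ i • ContinuousLinearMap.proj (R := ℝ)
        (φ := fun _ : Fin 4 => ℝ) i).hasFDerivAt (x := z) using 1
      ext z; simp
    exact ((Complex.ofRealCLM.hasFDerivAt.comp z h1).const_mul (-Complex.I)).cexp
  have hg' : ∀ z, fderiv ℝ g z v = -Complex.I * ξ i * g z := fun z => by
    rw [(hgd z).fderiv]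
    simp [v, Pi.single_apply]; ring
  have hgc : Continuous g := by fun_prop
  have hFd : Differentiable ℝ F := fun z => (Complex.ofRealCLM.hasFDerivAt.comp z
      (hf.differentiable one_ne_zero z).hasFDerivAt).differentiableAt
  have hfv : Continuous fun z => fderiv ℝ f z v := by fun_prop
  have hfvs : HasCompactSupport fun z => fderiv ℝ f z v :=
    hcs.comp_left (g := fun T : (Fin 4 → ℝ) →L[ℝ] ℝ => T v) rfl
  have hib := integral_mul_fderiv_eq_neg_fderiv_mul_of_integrable (𝕜 := ℂ) (μ := volume)
    (f := F) (g := g) (v := v)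
    (by simp_rw [hF', mul_comm _ (g _)]; exact integrable_exp_mul hfv hfvs hgc)
    (by
      simp_rw [hg', mul_comm (F _)]
      exact integrable_exp_mul hf.continuous hfs (by fun_prop))
    (by simp_rw [mul_comm (F _)]; exact integrable_exp_mul hf.continuous hfs hgc)
    (fun z _ => hFd z) (fun z _ => (hgd z).differentiableAt)
  have e1 : ∫ z, F z * fderiv ℝ g z v = -Complex.I * ξ i * ft f ξ := by
    unfold ft
    rw [← integral_const_mul]
    congr 1; ext z; rw [hg']; simp only [F, g]; ring
  rw [e1] at hib
  have := congrArg norm hib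
  rw [norm_neg, norm_mul, norm_mul, norm_neg, Complex.norm_I, one_mul, Complex.norm_real, hi,
    mul_comm] at this
  rw [this]
  refine (norm_integral_le_integral_norm _).trans (integral_mono_of_nonneg
    (Eventually.of_forall fun z => norm_nonneg _) hint (Eventually.of_forall fun z => ?_))
  change ‖fderiv ℝ F z v * g z‖ ≤ ‖fderiv ℝ f z‖
  rw [norm_mul, norm_exp_neg_I_mul, mul_one, hF', Complex.norm_real]
  exact ((fderiv ℝ f z).le_opNorm v).trans (mul_le_of_le_one_right (norm_nonneg _) hv)

theorem norm_ftRay_le {f : (Fin 4 → ℝ) → ℝ} (hf : Continuous f) (hfs : HasCompactSupport f) :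
    ∃ C M, 0 ≤ C ∧ 0 ≤ M ∧ ∀ ξ s, ‖ftRay f ξ s‖ ≤ C * Real.exp (M * ‖ξ‖ * |s.im|) := by
  obtain ⟨M, hM⟩ := hfs.isCompact.isBounded.exists_norm_le
  have hi := (hf.integrable_of_hasCompactSupport (μ := volume) hfs).norm
  refine ⟨∫ z, ‖f z‖, 4 * |M|, integral_nonneg fun _ => norm_nonneg _, by positivity, fun ξ s => ?_⟩
  unfold ftRay
  rw [← integral_mul_const]
  refine (norm_integral_le_integral_norm _).trans (integral_mono_of_nonneg
    (Eventually.of_forall fun z => norm_nonneg _) (hi.mul_const _)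
    (Eventually.of_forall fun z => ?_))
  simp only
  rw [norm_mul, Complex.norm_real, mul_comm]
  by_cases hz : f z = 0
  · simp [hz]
  gcongr
  rw [Complex.norm_exp]
  gcongr
  have hzM : ‖z‖ ≤ |M| := (hM z (subset_tsupport f hz)).trans (le_abs_self M)
  calc _ = s.im * ∑ i, ξ i * z i := by
        rw [Complex.re_mul_ofReal]; simp
    _ ≤ |s.im| * (4 * ‖ξ‖ * ‖z‖) := by
        refine (le_abs_self _).trans ?_
        rw [abs_mul]; gcongr; exact abs_sum_mul_le ξ z
    _ ≤ |s.im| * (4 * ‖ξ‖ * |M|) := by gcongr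
    _ = _ := by ring

theorem norm_exp_sub_one_le_mul_exp (w : ℂ) : ‖Complex.exp w - 1‖ ≤ ‖w‖ * Real.exp ‖w‖ := by
  have := Complex.norm_exp_sub_sum_le_norm_mul_exp w 1
  simpa using this

theorem norm_ftRay_le_of_integral_eq_zero {f : (Fin 4 → ℝ) → ℝ} (hf : Continuous f)
    (hfs : HasCompactSupport f) (h0 : ∫ z, f z = 0) :
    ∃ C M, 0 ≤ C ∧ 0 ≤ M ∧
      ∀ ξ s, ‖ftRay f ξ s‖ ≤ C * (‖ξ‖ * ‖s‖) * Real.exp (M * ‖ξ‖ * ‖s‖) := by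
  obtain ⟨M, hM⟩ := hfs.isCompact.isBounded.exists_norm_le
  have hi := (hf.integrable_of_hasCompactSupport (μ := volume) hfs).norm
  refine ⟨(∫ z, ‖f z‖) * (4 * |M|), 4 * |M|,
    mul_nonneg (integral_nonneg fun _ => norm_nonneg _) (by positivity), by positivity,
    fun ξ s => ?_⟩
  have e : ftRay f ξ s = ∫ z, (Complex.exp (-Complex.I * s * ((∑ i, ξ i * z i : ℝ) : ℂ)) - 1) *
      (f z : ℂ) := by
    have hz : ∫ z, (1 : ℂ) * (f z : ℂ) = 0 := by
      simp_rw [one_mul]; rw [integral_complex_ofReal, h0]; rfl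
    rw [ftRay, ← sub_zero (∫ z, _), ← hz, ← integral_sub
      (integrable_exp_mul hf hfs (by fun_prop)) (integrable_exp_mul hf hfs (by fun_prop))]
    congr 1; ext z; ring
  rw [e, mul_assoc, mul_assoc, ← integral_mul_const]
  refine (norm_integral_le_integral_norm _).trans (integral_mono_of_nonneg
    (Eventually.of_forall fun z => norm_nonneg _) (hi.mul_const _)
    (Eventually.of_forall fun z => ?_))
  simp only
  rw [norm_mul, Complex.norm_real, mul_comm]
  by_cases hz : f z = 0
  · simp [hz]
  gcongr
  have hzM : ‖z‖ ≤ |M| := (hM z (subset_tsupport f hz)).trans (le_abs_self M)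
  have hw : ‖-Complex.I * s * ((∑ i, ξ i * z i : ℝ) : ℂ)‖ ≤ 4 * |M| * (‖ξ‖ * ‖s‖) := by
    rw [norm_mul, norm_mul, norm_neg, Complex.norm_I, one_mul, Complex.norm_real]
    calc _ ≤ ‖s‖ * (4 * ‖ξ‖ * |M|) := by
          gcongr; exact (abs_sum_mul_le ξ z).trans (by gcongr)
      _ = _ := by ring
  refine (norm_exp_sub_one_le_mul_exp _).trans ?_
  calc _ ≤ 4 * |M| * (‖ξ‖ * ‖s‖) * Real.exp (4 * |M| * (‖ξ‖ * ‖s‖)) := by gcongr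
    _ = _ := by ring_nf

theorem norm_ft_le_mul_norm {f : (Fin 4 → ℝ) → ℝ} (hf : Continuous f)
    (hfs : HasCompactSupport f) (h0 : ∫ z, f z = 0) : ∃ C, 0 ≤ C ∧ ∀ ξ, ‖ft f ξ‖ ≤ C * ‖ξ‖ := by
  obtain ⟨M, hM⟩ := hfs.isCompact.isBounded.exists_norm_le
  have hi := (hf.integrable_of_hasCompactSupport (μ := volume) hfs).norm
  obtain ⟨C, M, hC, hM, h⟩ := norm_ftRay_le_of_integral_eq_zero hf hfs h0
  have hn := norm_ft_le f
  have hI : 0 ≤ ∫ z, ‖f z‖ := integral_nonneg fun _ => norm_nonneg _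
  refine ⟨C * Real.exp M + ∫ z, ‖f z‖, by positivity, fun ξ => ?_⟩
  rcases le_total ‖ξ‖ 1 with h1 | h1
  · have := h ξ (1 : ℝ)
    rw [ftRay_ofReal, one_smul] at this
    simp only [Complex.ofReal_one, norm_one, mul_one] at this
    refine this.trans ?_
    have : Real.exp (M * ‖ξ‖) ≤ Real.exp M := Real.exp_le_exp.2 (mul_le_of_le_one_right hM h1)
    calc _ ≤ C * ‖ξ‖ * Real.exp M := by gcongr
      _ ≤ C * ‖ξ‖ * Real.exp M + (∫ z, ‖f z‖) * ‖ξ‖ := le_add_of_nonneg_right (by positivity)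
      _ = _ := by ring
  · refine (hn ξ).trans ?_
    have : 0 ≤ C * Real.exp M := by positivity
    nlinarith

theorem differentiable_ftRay {f : (Fin 4 → ℝ) → ℝ} (hf : Continuous f)
    (hfs : HasCompactSupport f) (ξ : Fin 4 → ℝ) : Differentiable ℂ (ftRay f ξ) := by
  intro s₀
  let p : (Fin 4 → ℝ) → ℝ := fun z => ∑ i, ξ i * z i
  have hp : Continuous p := by fun_prop
  have hbi : Integrable fun z => |p z| * Real.exp ((‖s₀‖ + 1) * |p z|) * ‖f z‖ :=
    (by fun_prop : Continuous _).integrable_of_hasCompactSupport hfs.norm.mul_left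
  refine ((hasDerivAt_integral_of_dominated_loc_of_deriv_le (𝕜 := ℂ) (μ := volume)
    (F := fun (s : ℂ) z => Complex.exp (-Complex.I * s * ((p z : ℝ) : ℂ)) * (f z : ℂ))
    (F' := fun (s : ℂ) z => Complex.exp (-Complex.I * s * ((p z : ℝ) : ℂ)) *
      (-Complex.I * ((p z : ℝ) : ℂ)) * (f z : ℂ))
    (Metric.ball_mem_nhds s₀ one_pos) (Eventually.of_forall fun s =>
      (by fun_prop : Continuous _).aestronglyMeasurable)
    (integrable_exp_mul hf hfs (by fun_prop)) (by fun_prop : Continuous _).aestronglyMeasurable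
    (Eventually.of_forall fun z s hs => ?_) hbi
    (Eventually.of_forall fun z s _ => ?_)).2).differentiableAt
  · rw [norm_mul, norm_mul, Complex.norm_real, norm_mul, norm_neg, Complex.norm_I, one_mul,
      Complex.norm_real, Real.norm_eq_abs, mul_comm (‖_‖) |p z|]
    gcongr
    refine (Complex.norm_exp_le_exp_norm _).trans ?_
    gcongr
    rw [norm_mul, norm_mul, norm_neg, Complex.norm_I, one_mul, Complex.norm_real, Real.norm_eq_abs]
    gcongr
    have := norm_sub_norm_le s s₀
    rw [Metric.mem_ball, dist_eq_norm] at hs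
    linarith
  · refine HasDerivAt.mul_const ?_ _
    have : HasDerivAt (fun s : ℂ => -Complex.I * s * ((p z : ℝ) : ℂ))
      (-Complex.I * ((p z : ℝ) : ℂ)) s := by
      simpa using ((hasDerivAt_id s).const_mul (-Complex.I)).mul_const ((p z : ℝ) : ℂ)
    exact this.cexp

/-- The dyadic series `∑ cₖ g(2⁻ᵏ · ξ)` over all scales. -/
def dySum (c : ℤ → ℂ) (g : (Fin 4 → ℝ) → ℂ) (ξ : Fin 4 → ℝ) : ℂ :=
  ∑' k : ℤ, c k * g (scl ((2 : ℝ) ^ (-k)) ξ)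

theorem norm_dySum_term_le {c : ℤ → ℂ} {g : (Fin 4 → ℝ) → ℂ} {A C θ : ℝ} (hA : 0 ≤ A)
    (hθ1 : 1 ≤ θ) (hc : ∀ k, ‖c k‖ ≤ A * θ ^ (-k)) (hC : 0 ≤ C) (h1 : ∀ ξ, ‖g ξ‖ ≤ C * ‖ξ‖)
    (h2 : ∀ ξ, ‖g ξ‖ * ‖ξ‖ ≤ C) {ξ : Fin 4 → ℝ} (hξ : ξ ≠ 0) (k : ℤ) :
    ‖c k‖ * ‖g (scl ((2 : ℝ) ^ (-k)) ξ)‖ ≤ A * C * (‖ξ‖ + ‖ξ‖⁻¹) * (θ / 2) ^ k.natAbs := by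
  have hn : 0 < ‖ξ‖ := norm_pos_iff.2 hξ
  refine norm_mul_le_pow_natAbs_half hθ1 hA (hc k) (norm_nonneg _) (fun hk => ?_) (fun hk => ?_)
  · have hs := norm_scl_le (l := (2 : ℝ) ^ (-k)) (by positivity)
      (zpow_le_one_of_nonpos₀ (by norm_num) (by lia)) ξ
    calc _ ≤ C * ((2 : ℝ) ^ (-k) * ‖ξ‖) := (h1 _).trans (by gcongr)
      _ = C * (2 : ℝ) ^ (-k) * ‖ξ‖ := by ring
      _ ≤ _ := by gcongr; exact le_add_of_nonneg_right (by positivity)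
  · have hs := le_norm_scl (l := (2 : ℝ) ^ (-k)) (one_le_zpow₀ (by norm_num) (by lia)) ξ
    have hpos : 0 < (2 : ℝ) ^ (-k) * ‖ξ‖ := by positivity
    calc _ ≤ C / ((2 : ℝ) ^ (-k) * ‖ξ‖) := by
          rw [le_div_iff₀ hpos]
          exact (mul_le_mul_of_nonneg_left hs (norm_nonneg _)).trans (h2 _)
      _ = C * (2 : ℝ) ^ k * ‖ξ‖⁻¹ := by
          rw [zpow_neg]; field_simp
      _ ≤ _ := by gcongr; exact le_add_of_nonneg_left (by positivity)

section
variable {c : ℤ → ℂ} {g : (Fin 4 → ℝ) → ℂ} {A C θ : ℝ}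

theorem summable_dySum (hA : 0 ≤ A) (hθ1 : 1 ≤ θ) (hθ2 : θ < 2) (hc : ∀ k, ‖c k‖ ≤ A * θ ^ (-k))
    (hC : 0 ≤ C) (h1 : ∀ ξ, ‖g ξ‖ ≤ C * ‖ξ‖) (h2 : ∀ ξ, ‖g ξ‖ * ‖ξ‖ ≤ C) (ξ : Fin 4 → ℝ) :
    Summable fun k : ℤ => c k * g (scl ((2 : ℝ) ^ (-k)) ξ) := by
  rcases eq_or_ne ξ 0 with rfl | hξ
  · have h0 : g 0 = 0 := by simpa using h1 0
    simp [scl_zero_right, h0, summable_zero]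
  · refine Summable.of_norm_bounded ((summable_pow_natAbs (by positivity)
      (by linarith : θ / 2 < 1)).mul_left (A * C * (‖ξ‖ + ‖ξ‖⁻¹))) fun k => ?_
    rw [norm_mul]
    exact norm_dySum_term_le hA hθ1 hc hC h1 h2 hξ k

theorem continuousAt_dySum (hA : 0 ≤ A) (hθ1 : 1 ≤ θ) (hθ2 : θ < 2)
    (hc : ∀ k, ‖c k‖ ≤ A * θ ^ (-k)) (hC : 0 ≤ C) (hg : Continuous g)
    (h1 : ∀ ξ, ‖g ξ‖ ≤ C * ‖ξ‖) (h2 : ∀ ξ, ‖g ξ‖ * ‖ξ‖ ≤ C) {ξ : Fin 4 → ℝ} (hξ : ξ ≠ 0) :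
    ContinuousAt (dySum c g) ξ := by
  have hn : 0 < ‖ξ‖ := norm_pos_iff.2 hξ
  let U : Set (Fin 4 → ℝ) := {ζ | ‖ξ‖ / 2 < ‖ζ‖ ∧ ‖ζ‖ < 2 * ‖ξ‖}
  have hU : IsOpen U := (isOpen_lt continuous_const continuous_norm).inter
    (isOpen_lt continuous_norm continuous_const)
  have hcont : ContinuousOn (dySum c g) U := by
    refine continuousOn_tsum (u := fun k : ℤ =>
      A * C * (2 * ‖ξ‖ + (‖ξ‖ / 2)⁻¹) * (θ / 2) ^ k.natAbs) (fun k => ?_)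
      ((summable_pow_natAbs (by positivity) (by linarith : θ / 2 < 1)).mul_left _) fun k ζ hζ => ?_
    · exact ((hg.comp (continuous_scl _)).const_mul _).continuousOn
    · have hζ0 : 0 < ‖ζ‖ := (by positivity : 0 < ‖ξ‖ / 2).trans hζ.1
      rw [norm_mul]
      refine (norm_dySum_term_le hA hθ1 hc hC h1 h2 (norm_pos_iff.1 hζ0) k).trans ?_
      gcongr
      exacts [hζ.2.le, hζ.1.le]
  exact hcont.continuousAt (hU.mem_nhds ⟨by linarith, by linarith⟩)

theorem dySum_divCoeff (hA : 0 ≤ A) (hθ1 : 1 ≤ θ) (hθ2 : θ < 2) (hc : ∀ k, ‖c k‖ ≤ A * θ ^ (-k))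
    (hC : 0 ≤ C) (h1 : ∀ ξ, ‖g ξ‖ ≤ C * ‖ξ‖) (h2 : ∀ ξ, ‖g ξ‖ * ‖ξ‖ ≤ C) (l : ℂ)
    (ξ : Fin 4 → ℝ) :
    dySum (divCoeff l c) g ξ = dySum c g ξ - l * dySum c g (scl 2 ξ) := by
  have hs := summable_dySum hA hθ1 hθ2 hc hC h1 h2
  have e : ∀ k : ℤ, scl ((2 : ℝ) ^ (-(k + 1))) (scl 2 ξ) = scl ((2 : ℝ) ^ (-k)) ξ := fun k => by
    rw [scl_scl]; congr 1
    rw [← zpow_add_one₀ (by norm_num)]; congr 1; ring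
  have hs' : Summable fun k : ℤ => c (k + 1) * g (scl ((2 : ℝ) ^ (-k)) ξ) := by
    refine ((Equiv.addRight (1 : ℤ)).summable_iff.2 (hs (scl 2 ξ))).congr fun k => ?_
    simp only [Function.comp, Equiv.coe_addRight, e]
  have e2 : dySum c g (scl 2 ξ) = ∑' k : ℤ, c (k + 1) * g (scl ((2 : ℝ) ^ (-k)) ξ) := by
    unfold dySum
    rw [← (Equiv.addRight (1 : ℤ)).tsum_eq (fun k : ℤ => c k * g (scl ((2 : ℝ) ^ (-k)) (scl 2 ξ)))]
    congr 1; ext k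
    simp only [Equiv.coe_addRight, e]
  rw [e2, ← tsum_mul_left, dySum, dySum, ← (hs ξ).tsum_sub (hs'.mul_left l)]
  congr 1; ext k
  unfold divCoeff; ring

end

theorem eq_zero_of_eq_mul_scl_two {F : (Fin 4 → ℝ) → ℂ} {l : ℂ}
    (h : ∀ ξ, F ξ = l * F (scl 2 ξ)) {r : ℝ} (hr : 0 < r) (h0 : ∀ ξ, ‖ξ‖ < r → F ξ = 0)
    (ξ : Fin 4 → ℝ) : F ξ = 0 := by
  rcases eq_or_ne l 0 with rfl | hl
  · rw [h, zero_mul]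
  have key : ∀ m : ℕ, ∀ ξ, ‖ξ‖ < 2 ^ m * r → F ξ = 0 := by
    intro m
    induction m with
    | zero => intro ξ hξ; exact h0 ξ (by simpa using hξ)
    | succ m ih =>
      intro ξ hξ
      have h1 := ih (scl 2⁻¹ ξ) (by
        have := norm_scl_le (l := (2 : ℝ)⁻¹) (by norm_num) (by norm_num) ξ
        rw [pow_succ] at hξ
        linarith)
      rw [h, scl_scl, mul_inv_cancel₀ (by norm_num), scl_one] at h1
      exact (mul_eq_zero.1 h1).resolve_left hl
  obtain ⟨m, hm⟩ := pow_unbounded_of_one_lt (‖ξ‖ / r) (by norm_num : (1 : ℝ) < 2)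
  exact key m ξ ((div_lt_iff₀ hr).1 hm)

theorem dySum_eq_zero_of_coeff_le_exp {f : (Fin 4 → ℝ) → ℝ} (hf : Continuous f)
    (hfs : HasCompactSupport f) (hf0 : ∫ z, f z = 0) {c : ℤ → ℂ} {A B θ δ r : ℝ} (hA : 0 ≤ A)
    (hθ1 : 1 ≤ θ) (hc : ∀ k, ‖c k‖ ≤ A * θ ^ (-k)) (hδ : 0 < δ)
    (hexp : ∀ᶠ p : ℕ in atTop, ‖c (-p)‖ ≤ B * Real.exp (-δ * 4 ^ p)) (hr : 0 < r)
    (hz : ∀ ξ, ‖ξ‖ < r → dySum c (ft f) ξ = 0) (ξ : Fin 4 → ℝ) : dySum c (ft f) ξ = 0 := by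
  obtain ⟨B', hB', hbd⟩ := Asymptotics.bound_of_isBigO_nat_atTop (f := fun p : ℕ => c (-p))
    (g'' := fun p : ℕ => Real.exp (-δ * 4 ^ p))
    (Asymptotics.IsBigO.of_bound B (hexp.mono fun p hp => by
      rwa [Real.norm_of_nonneg (Real.exp_pos _).le]))
  have hbd' : ∀ p : ℕ, ‖c (-p)‖ ≤ B' * Real.exp (-δ * 4 ^ p) := fun p => by
    have := hbd (x := p) (Real.exp_pos _).ne'
    rwa [Real.norm_of_nonneg (Real.exp_pos _).le] at this
  obtain ⟨C, M, hC, hM, h1⟩ := norm_ftRay_le hf hfs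
  obtain ⟨C', M', hC', hM', h2⟩ := norm_ftRay_le_of_integral_eq_zero hf hfs hf0
  let a : ℝ := δ / (2 * (M * ‖ξ‖ + 1))
  have ha : 0 < a := by positivity
  have haδ : M * ‖ξ‖ * a ≤ δ / 2 := by
    simp only [a]
    rw [mul_div_assoc', div_le_div_iff₀ (by positivity) (by positivity)]
    nlinarith
  let U : Set ℂ := Set.Ioo (-2) 2 ×ℂ Set.Ioo (-a) a
  have hU : IsOpen U := isOpen_Ioo.reProdIm isOpen_Ioo
  have hUc : IsPreconnected U :=
    (((convex_Ioo (-2 : ℝ) 2).linear_preimage Complex.reLm).inter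
      ((convex_Ioo (-a) a).linear_preimage Complex.imLm)).isPreconnected
  let G : ℂ → ℂ := fun s => ∑' k : ℤ, c k * ftRay f (scl ((2 : ℝ) ^ (-k)) ξ) s
  have hGr : ∀ s : ℝ, G s = dySum c (ft f) (s • ξ) := fun s => by
    simp only [G, dySum, ftRay_ofReal, scl_smul]
  let K₁ : ℝ := A * (C' * (‖ξ‖ * (2 + a)) * Real.exp (M' * ‖ξ‖ * (2 + a)))
  have hG : DifferentiableOn ℂ G U := by
    refine Complex.differentiableOn_tsum_of_summable_norm (u := fun k : ℤ =>
      K₁ * (1 / 2 : ℝ) ^ k.natAbs + B' * C * Real.exp (-(δ / 2)) ^ k.natAbs) ?_ (fun k => ?_) hU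
      fun k s hs => ?_
    · exact ((summable_pow_natAbs (by norm_num) (by norm_num)).mul_left _).add
        ((summable_pow_natAbs (Real.exp_pos _).le (Real.exp_zero ▸ Real.exp_lt_exp.2 (by linarith))).mul_left _)
    · exact ((differentiable_ftRay hf hfs _).const_mul _).differentiableOn
    · rw [Complex.mem_reProdIm] at hs
      have him : |s.im| ≤ a := (abs_lt.2 hs.2).le
      have hre : |s.re| ≤ 2 := (abs_lt.2 hs.1).le
      have hsn : ‖s‖ ≤ 2 + a := (Complex.norm_le_abs_re_add_abs_im s).trans (add_le_add hre him)
      rw [norm_mul]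
      obtain ⟨p, rfl | rfl⟩ := Int.eq_nat_or_neg k
      · have hsc := norm_scl_le (l := (2 : ℝ) ^ (-(p : ℤ))) (by positivity)
          (zpow_le_one_of_nonpos₀ (by norm_num) (by lia)) ξ
        have hp1 : (2 : ℝ) ^ (-(p : ℤ)) = (1 / 2 : ℝ) ^ p := by
          rw [zpow_neg, zpow_natCast, one_div, inv_pow]
        rw [hp1] at hsc ⊢
        have hsc' : ‖scl ((1 / 2 : ℝ) ^ p) ξ‖ ≤ ‖ξ‖ :=
          hsc.trans (mul_le_of_le_one_left (norm_nonneg _) (pow_le_one₀ (by norm_num) (by norm_num)))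
        have hcA : ‖c p‖ ≤ A := (hc p).trans
          (mul_le_of_le_one_right hA (zpow_le_one_of_nonpos₀ hθ1 (by lia)))
        refine le_add_of_le_of_nonneg ?_ (by positivity)
        calc _ ≤ A * (C' * (((1 / 2 : ℝ) ^ p * ‖ξ‖) * (2 + a)) *
              Real.exp (M' * ‖ξ‖ * (2 + a))) := by
              gcongr
              refine (h2 _ s).trans ?_
              gcongr
          _ = _ := by simp only [K₁, Int.natAbs_natCast]; ring
      · have hsc := norm_scl_le_sq (l := (2 : ℝ) ^ (- -(p : ℤ))) (one_le_zpow₀ (by norm_num)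
          (by lia)) ξ
        rw [neg_neg, zpow_natCast, ← pow_mul, mul_comm p 2, pow_mul] at hsc
        norm_num at hsc
        refine le_add_of_nonneg_of_le (by positivity) ?_
        rw [Int.natAbs_neg, Int.natAbs_natCast, neg_neg, zpow_natCast]
        have hp4 : (p : ℝ) ≤ 4 ^ p := by
          exact_mod_cast (Nat.lt_pow_self (by norm_num : 1 < 4)).le
        calc _ ≤ (B' * Real.exp (-δ * 4 ^ p)) * (C * Real.exp (M * (4 ^ p * ‖ξ‖) * a)) := by
              gcongr
              · exact hbd' p
              · refine (h1 _ s).trans ?_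
                gcongr
          _ = B' * C * Real.exp (-δ * 4 ^ p + M * (4 ^ p * ‖ξ‖) * a) := by
              rw [Real.exp_add]; ring
          _ ≤ B' * C * Real.exp (p * -(δ / 2)) := by
              gcongr
              have : M * (4 ^ p * ‖ξ‖) * a ≤ 4 ^ p * (δ / 2) := by
                calc _ = 4 ^ p * (M * ‖ξ‖ * a) := by ring
                  _ ≤ _ := by gcongr
              nlinarith
          _ = _ := by rw [Real.exp_nat_mul]
  have h0U : (0 : ℂ) ∈ U := by simp [U, Complex.mem_reProdIm, ha]
  have h1U : (1 : ℂ) ∈ U := by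
    rw [Complex.mem_reProdIm]
    refine ⟨?_, ?_⟩ <;> norm_num [ha]
  have hfreq : ∃ᶠ s in 𝓝[≠] (0 : ℂ), G s = 0 := by
    have ht : Tendsto (fun s : ℝ => (s : ℂ)) (𝓝[≠] 0) (𝓝[≠] 0) := by
      refine tendsto_nhdsWithin_of_tendsto_nhds_of_eventually_within _ ?_ ?_
      · exact (Complex.continuous_ofReal.tendsto' 0 0 rfl).mono_left nhdsWithin_le_nhds
      · filter_upwards [self_mem_nhdsWithin] with s hs
        simpa using hs
    refine ht.frequently (Eventually.frequently ?_)
    have hc : Tendsto (fun s : ℝ => ‖s • ξ‖) (𝓝[≠] 0) (𝓝 0) :=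
      ((by fun_prop : Continuous fun s : ℝ => ‖s • ξ‖).tendsto' 0 0 (by simp)).mono_left
        nhdsWithin_le_nhds
    filter_upwards [hc.eventually_lt_const hr] with s hs
    rw [hGr, hz _ hs]
  have := (hG.analyticOnNhd hU).eqOn_zero_of_preconnected_of_frequently_eq_zero hUc h0U hfreq h1U
  have h3 := hGr 1
  rw [one_smul, Complex.ofReal_one] at h3
  rw [← h3, this]; rfl

theorem exists_support_edge {μ : ℝ → ℂ} (hμ : Continuous μ) (heven : ∀ t, μ (-t) = μ t) {e : ℝ}
    (he0 : 0 ≤ e) (he : ∀ t, e < |t| → μ t = 0) {t₀ : ℝ} (ht₀ : μ t₀ ≠ 0) :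
    ∃ e₀, 0 < e₀ ∧ (∀ t, e₀ < |t| → μ t = 0) ∧ ∃ x, e₀ / 4 < x ∧ x ≤ e₀ ∧ μ x ≠ 0 := by
  let S : Set ℝ := {e | 0 ≤ e ∧ ∀ t, e < |t| → μ t = 0}
  have hS : S.Nonempty := ⟨e, he0, he⟩
  have hSb : BddBelow S := ⟨0, fun _ h => h.1⟩
  have hvan : ∀ t, sInf S < |t| → μ t = 0 := fun t ht => by
    obtain ⟨e', he', h⟩ := exists_lt_of_csInf_lt hS ht
    exact he'.2 t h
  have hpos : 0 < sInf S := by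
    refine lt_of_le_of_ne (Real.sInf_nonneg fun _ h => h.1) fun h => ht₀ ?_
    rw [← h] at hvan
    have : μ = fun _ => 0 := hμ.ext_on (dense_compl_singleton (0 : ℝ)) continuous_const
      fun t ht => hvan t (abs_pos.2 ht)
    rw [this]
  refine ⟨sInf S, hpos, hvan, ?_⟩
  by_contra! hcon
  have : sInf S / 4 ∈ S := by
    refine ⟨by positivity, fun t ht => ?_⟩
    rcases le_or_gt |t| (sInf S) with h | h
    · have h1 := hcon |t| ht h
      rcases abs_choice t with h2 | h2 <;> rw [h2] at h1
      · exact h1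
      · rwa [heven] at h1
    · exact hvan t h
  have := csInf_le hSb this
  linarith

/-- The marginal in the time variable. -/
def timeMarginal (f : (Fin 4 → ℝ) → ℝ) (t : ℝ) : ℂ :=
  ∫ x : Fin 3 → ℝ, ((f (Fin.cons t x : Fin 4 → ℝ) : ℝ) : ℂ)

theorem integral_cons {G : (Fin 4 → ℝ) → ℂ} (hG : Integrable G) :
    ∫ z, G z = ∫ t : ℝ, ∫ x : Fin 3 → ℝ, G (Fin.cons t x : Fin 4 → ℝ) := by
  have hmp := (volume_preserving_piFinSuccAbove (fun _ : Fin 4 => ℝ) 0).symm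
  have e : ∀ p : ℝ × (Fin 3 → ℝ), (MeasurableEquiv.piFinSuccAbove (fun _ : Fin 4 => ℝ) 0).symm p =
      (Fin.cons p.1 p.2 : Fin 4 → ℝ) := fun p => by
    simp [MeasurableEquiv.piFinSuccAbove, Fin.insertNthEquiv]
  rw [← hmp.integral_comp' (g := G), Measure.volume_eq_prod, integral_prod]
  · simp_rw [e]
  · rw [← Measure.volume_eq_prod]
    exact hmp.integrable_comp_of_integrable hG

theorem continuous_cons (t : ℝ) : Continuous fun x : Fin 3 → ℝ => (Fin.cons t x : Fin 4 → ℝ) := by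
  refine continuous_pi fun i => ?_
  refine Fin.cases ?_ (fun j => ?_) i
  · simpa using continuous_const
  · simpa using continuous_apply j

theorem ftLine_timeMarginal {f : (Fin 4 → ℝ) → ℝ} (hf : Continuous f) (hfs : HasCompactSupport f)
    (τ : ℝ) : ftLine (timeMarginal f) τ = ft f (Fin.cons τ 0) := by
  unfold ft
  rw [integral_cons (integrable_exp_mul hf hfs (by fun_prop))]
  unfold ftLine timeMarginal
  congr 1; ext t
  rw [← integral_const_mul]
  congr 1; ext x
  congr 3
  rw [Fin.sum_univ_succ]
  simp

theorem abs_le_norm_cons (t : ℝ) (x : Fin 3 → ℝ) : |t| ≤ ‖(Fin.cons t x : Fin 4 → ℝ)‖ := by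
  simpa using norm_le_pi_norm (Fin.cons t x : Fin 4 → ℝ) 0

theorem norm_le_norm_cons (t : ℝ) (x : Fin 3 → ℝ) : ‖x‖ ≤ ‖(Fin.cons t x : Fin 4 → ℝ)‖ := by
  refine (pi_norm_le_iff_of_nonneg (norm_nonneg _)).2 fun i => ?_
  simpa using norm_le_pi_norm (Fin.cons t x : Fin 4 → ℝ) i.succ

theorem timeMarginal_eq_zero {f : (Fin 4 → ℝ) → ℝ} {M : ℝ} (hM : ∀ z, M < ‖z‖ → f z = 0) (t : ℝ)
    (ht : M < |t|) : timeMarginal f t = 0 := by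
  unfold timeMarginal
  simp [fun x => hM _ (ht.trans_le (abs_le_norm_cons t x))]

theorem timeMarginal_neg {f : (Fin 4 → ℝ) → ℝ} (hf : ∀ z, f (-z) = f z) (t : ℝ) :
    timeMarginal f (-t) = timeMarginal f t := by
  unfold timeMarginal
  rw [← integral_neg_eq_self]
  congr 1; ext x
  rw [← hf]
  congr 2
  ext i
  refine Fin.cases ?_ (fun j => ?_) i <;> simp

theorem norm_cons_sub_cons (s t : ℝ) (x : Fin 3 → ℝ) :
    ‖(Fin.cons s x : Fin 4 → ℝ) - Fin.cons t x‖ ≤ |s - t| := by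
  refine (pi_norm_le_iff_of_nonneg (abs_nonneg _)).2 fun i => ?_
  refine Fin.cases ?_ (fun j => ?_) i <;> simp

theorem exists_norm_timeMarginal_sub_le {f : (Fin 4 → ℝ) → ℝ} (hf : ContDiff ℝ 1 f)
    (hfs : HasCompactSupport f) {M : ℝ} (hM : ∀ z, M < ‖z‖ → f z = 0) :
    ∃ L, 0 ≤ L ∧ ∀ s t, ‖timeMarginal f s - timeMarginal f t‖ ≤ L * |s - t| := by
  obtain ⟨K, hK⟩ := hf.lipschitzWith_of_hasCompactSupport hfs one_ne_zero
  have hi : ∀ t, Integrable fun x : Fin 3 → ℝ => ((f (Fin.cons t x : Fin 4 → ℝ) : ℝ) : ℂ) :=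
    fun t => by
      refine Continuous.integrable_of_hasCompactSupport
        (Complex.continuous_ofReal.comp (hf.continuous.comp (continuous_cons t)))
        (HasCompactSupport.intro (isCompact_closedBall 0 M) fun x hx => ?_)
      rw [mem_closedBall_zero_iff, not_le] at hx
      simp [hM _ (hx.trans_le (norm_le_norm_cons t x))]
  refine ⟨K * volume.real (Metric.closedBall (0 : Fin 3 → ℝ) M), by positivity, fun s t => ?_⟩
  unfold timeMarginal
  rw [← integral_sub (hi s) (hi t), ← setIntegral_eq_integral_of_forall_compl_eq_zero
    (s := Metric.closedBall (0 : Fin 3 → ℝ) M)]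
  · refine (norm_setIntegral_le_of_norm_le_const (C := K * |s - t|)
      measure_closedBall_lt_top fun x _ => ?_).trans (le_of_eq (by ring))
    rw [← Complex.ofReal_sub, Complex.norm_real, ← dist_eq_norm]
    refine (hK.dist_le_mul _ _).trans ?_
    rw [dist_eq_norm]
    gcongr
    exact norm_cons_sub_cons s t x
  · intro x hx
    rw [mem_closedBall_zero_iff, not_le] at hx
    simp [hM _ (hx.trans_le (norm_le_norm_cons s x)), hM _ (hx.trans_le (norm_le_norm_cons t x))]

theorem scl_cons_zero (l τ : ℝ) :
    scl l (Fin.cons τ 0 : Fin 4 → ℝ) = (Fin.cons (l ^ 2 * τ) 0 : Fin 4 → ℝ) := by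
  ext i
  refine Fin.cases ?_ (fun j => ?_) i <;> simp [scl, sExp]

theorem norm_cons_zero (τ : ℝ) : ‖(Fin.cons τ 0 : Fin 4 → ℝ)‖ = |τ| := by
  refine le_antisymm ((pi_norm_le_iff_of_nonneg (abs_nonneg _)).2 fun i => ?_)
    (abs_le_norm_cons τ 0)
  refine Fin.cases ?_ (fun j => ?_) i <;> simp

theorem ft_zero (f : (Fin 4 → ℝ) → ℝ) : ft f 0 = ((∫ z, f z : ℝ) : ℂ) := by
  unfold ft
  rw [← integral_complex_ofReal]
  simp

section
variable {ρ η : (Fin 4 → ℝ) → ℝ}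

theorem contDiff_scl {n : WithTop ℕ∞} (l : ℝ) : ContDiff ℝ n (scl l) := by
  unfold scl
  exact contDiff_pi.2 fun i => contDiff_const.mul (contDiff_apply ℝ ℝ i)

theorem hasCompactSupport_comp_scl (hρ : HasCompactSupport ρ) {l : ℝ} (hl : 0 < l) :
    HasCompactSupport fun z => ρ (scl l z) := by
  let h : (Fin 4 → ℝ) ≃ₜ (Fin 4 → ℝ) :=
    { toFun := scl l
      invFun := scl l⁻¹
      left_inv := fun z => by rw [scl_scl, inv_mul_cancel₀ hl.ne', scl_one]
      right_inv := fun z => by rw [scl_scl, mul_inv_cancel₀ hl.ne', scl_one]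
      continuous_toFun := continuous_scl l
      continuous_invFun := continuous_scl l⁻¹ }
  exact hρ.comp_homeomorph h

theorem ft_sub_scl (hρ : Continuous ρ) (hρs : HasCompactSupport ρ)
    (hη : η = fun x => ρ x - ((2 : ℝ) ^ (5 : ℕ))⁻¹ * ρ (scl (2⁻¹ : ℝ) x)) (ξ : Fin 4 → ℝ) :
    ft η ξ = ft ρ ξ - ft ρ (scl 2 ξ) := by
  have h := ft_scl (l := 2⁻¹) (by norm_num) ρ ξ
  rw [inv_inv] at h
  rw [← h, hη, ft, ft, ft, ← integral_sub (integrable_exp_mul hρ hρs (by fun_prop))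
    (integrable_exp_mul (f := fun z => 2⁻¹ ^ 5 * ρ (scl 2⁻¹ z))
      ((hρ.comp (continuous_scl _)).const_mul _)
      (hasCompactSupport_comp_scl hρs (by norm_num)).mul_left (by fun_prop))]
  congr 1; ext z
  push_cast; ring

theorem exists_timeMarginal_ne_zero (hρ : ContDiff ℝ 1 ρ) (hρs : HasCompactSupport ρ)
    (hρint : ∫ z, ρ z = 1) (hηc : Continuous η) (hηs : HasCompactSupport η)
    (hη : ∀ ξ, ft η ξ = ft ρ ξ - ft ρ (scl 2 ξ)) : ∃ t, timeMarginal η t ≠ 0 := by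
  by_contra! h0
  have h1 : ∀ τ, ft ρ (Fin.cons (4 * τ) 0) = ft ρ (Fin.cons τ 0) := fun τ => by
    have := ftLine_timeMarginal hηc hηs τ
    rw [hη, scl_cons_zero] at this
    simp only [ftLine, h0, mul_zero, integral_zero] at this
    rw [show (4 : ℝ) = 2 ^ 2 by norm_num]
    exact (sub_eq_zero.1 this.symm).symm
  have h2 : ∀ (m : ℕ) τ, ft ρ (Fin.cons (4 ^ m * τ) 0) = ft ρ (Fin.cons τ 0) := by
    intro m τ
    induction m with
    | zero => simp
    | succ m ih => rw [pow_succ', mul_assoc, h1, ih]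
  have h3 : ∀ τ, τ ≠ 0 → ft ρ (Fin.cons τ 0) = 0 := fun τ hτ => by
    have hb : ∀ m : ℕ, ‖ft ρ (Fin.cons τ 0)‖ ≤
        (∫ z, ‖fderiv ℝ ρ z‖) / |τ| * ((1 / 4 : ℝ) ^ m) := fun m => by
      have := norm_mul_ft_le hρ hρs (Fin.cons (4 ^ m * τ) 0)
      rw [h2, norm_cons_zero, abs_mul, abs_of_pos (by positivity : (0 : ℝ) < 4 ^ m)] at this
      have hτ' : 0 < |τ| := abs_pos.2 hτ
      rw [← le_div_iff₀ (by positivity)] at this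
      refine this.trans (le_of_eq ?_)
      rw [one_div, inv_pow]
      field_simp
    have hlim := (tendsto_pow_atTop_nhds_zero_of_lt_one (by norm_num : (0 : ℝ) ≤ 1 / 4)
      (by norm_num)).const_mul ((∫ z, ‖fderiv ℝ ρ z‖) / |τ|)
    rw [mul_zero] at hlim
    exact norm_le_zero_iff.1 (ge_of_tendsto' hlim hb)
  have hc : Continuous fun τ : ℝ => ft ρ (Fin.cons τ 0) := by
    refine (continuous_ft hρ.continuous hρs).comp (continuous_pi fun i => ?_)
    refine Fin.cases ?_ (fun j => ?_) i
    · simpa using continuous_id'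
    · simpa using continuous_const
  have h4 : (fun τ : ℝ => ft ρ (Fin.cons τ 0)) = fun _ => 0 :=
    hc.ext_on (dense_compl_singleton (0 : ℝ)) continuous_const fun τ hτ => h3 τ hτ
  have h5 := congrFun h4 0
  have h6 : (Fin.cons 0 0 : Fin 4 → ℝ) = 0 := by
    ext i
    refine Fin.cases ?_ (fun j => ?_) i <;> simp
  rw [h6, ft_zero, hρint] at h5
  simp at h5

/-- A dyadic Fourier series with subcritical growth which vanishes near the origin vanishes
identically. -/
theorem dySum_eq_zero_of_eq_zero_near (hρ : ContDiff ℝ 1 ρ) (hρs : HasCompactSupport ρ)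
    (hρint : ∫ z, ρ z = 1) (hηd : ContDiff ℝ 1 η) (hηs : HasCompactSupport η)
    (hηe : ∀ z, η (-z) = η z) (hη : ∀ ξ, ft η ξ = ft ρ ξ - ft ρ (scl 2 ξ)) {c₀ : ℤ → ℂ}
    {A θ r : ℝ} (hA : 0 ≤ A) (hθ1 : 1 ≤ θ) (hθ2 : θ < 2) (hc : ∀ k, ‖c₀ k‖ ≤ A * θ ^ (-k))
    (hr : 0 < r) (hz : ∀ ξ, ‖ξ‖ < r → dySum c₀ (ft η) ξ = 0) (ξ : Fin 4 → ℝ) :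
    dySum c₀ (ft η) ξ = 0 := by
  have hη0 : ∫ z, η z = 0 := by
    have := hη 0
    rw [scl_zero_right, sub_self, ft_zero] at this
    exact_mod_cast this
  have hηc := hηd.continuous
  obtain ⟨C₁, hC₁, h1⟩ := norm_ft_le_mul_norm hηc hηs hη0
  have h2 := norm_mul_ft_le hηd hηs
  set C₂ := ∫ z, ‖fderiv ℝ η z‖
  have hC₂ : 0 ≤ C₂ := integral_nonneg fun _ => norm_nonneg _
  have h1' : ∀ ξ, ‖ft η ξ‖ ≤ (C₁ + C₂) * ‖ξ‖ := fun ξ => (h1 ξ).trans (by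
    gcongr; exact le_add_of_nonneg_right hC₂)
  have h2' : ∀ ξ, ‖ft η ξ‖ * ‖ξ‖ ≤ C₁ + C₂ := fun ξ => (h2 ξ).trans
    (le_add_of_nonneg_left hC₁)
  obtain ⟨M, hMpos, hM⟩ := hηs.isCompact.isBounded.exists_pos_norm_le
  have hM' : ∀ z, M < ‖z‖ → η z = 0 := fun z hz' => by
    by_contra h
    exact hz'.not_ge (hM z (subset_tsupport η h))
  obtain ⟨L, hL, hlip⟩ := exists_norm_timeMarginal_sub_le hηd hηs hM'
  have heven := timeMarginal_neg hηe
  have hμc : Continuous (timeMarginal η) := by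
    refine (LipschitzWith.of_dist_le_mul (K := ⟨L, hL⟩) fun s t => ?_).continuous
    rw [dist_eq_norm, Real.dist_eq]; exact hlip s t
  obtain ⟨t₀, ht₀⟩ := exists_timeMarginal_ne_zero hρ hρs hρint hηc hηs hη
  obtain ⟨e₀, he0, hvan, x, hx1, hx2, hx⟩ := exists_support_edge hμc heven hMpos.le
    (timeMarginal_eq_zero hM') ht₀
  have hft := ftLine_timeMarginal hηc hηs
  let Z : (ℤ → ℂ) → Prop := fun c => (∃ r, 0 < r ∧ ∀ ξ, ‖ξ‖ < r → dySum c (ft η) ξ = 0) ∧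
    ((∀ ξ, dySum c (ft η) ξ = 0) → ∀ ξ, dySum c₀ (ft η) ξ = 0)
  have hZ : ∀ c l, (∃ A, 0 ≤ A ∧ ∀ k, ‖c k‖ ≤ A * θ ^ (-k)) → ‖l‖ ≤ θ → Z c →
      Z (divCoeff l c) := by
    rintro c l ⟨A', hA', hc'⟩ - ⟨⟨r', hr', hz'⟩, himp⟩
    have hdiv := dySum_divCoeff hA' hθ1 hθ2 hc' (add_nonneg hC₁ hC₂) h1' h2' l
    refine ⟨⟨r' / 4, by positivity, fun ξ hξ => ?_⟩, fun h => himp fun ξ => ?_⟩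
    · have h4 := norm_scl_le_sq (l := 2) (by norm_num) ξ
      rw [hdiv, hz' ξ (by linarith), hz' (scl 2 ξ) (by linarith), mul_zero, sub_zero]
    · exact eq_zero_of_eq_mul_scl_two (fun ζ => by
        have := h ζ
        rw [hdiv] at this
        exact sub_eq_zero.1 this) hr' hz' ξ
  obtain ⟨c, ⟨⟨r', hr', hz'⟩, himp⟩, ⟨A', hA', hc'⟩, B, δ, hB, hδ, hexp⟩ :=
    exists_divided_coeff_le_exp (Z := Z) (C := C₁ + C₂) hθ1 hθ2 he0 hZ hL hlip hA hc heven hvan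
      (by
        have h := hft 0
        have h6 : (Fin.cons 0 0 : Fin 4 → ℝ) = 0 := by
          ext i
          refine Fin.cases ?_ (fun j => ?_) i <;> simp
        rw [h6, ft_zero, hη0] at h
        simpa [ftLine] using h)
      (fun s => by rw [hft, ← norm_cons_zero]; exact h1' _)
      (fun s => by rw [hft, ← norm_cons_zero]; exact h2' _) hr
      (fun τ hτ => by
        rw [← hz (Fin.cons τ 0) (by rwa [norm_cons_zero])]
        unfold dySum
        congr 1; ext k
        rw [hft, scl_cons_zero, ← zpow_natCast, ← zpow_mul, mul_comm (-k), zpow_mul]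
        norm_num)
      ⟨⟨r, hr, hz⟩, id⟩ hx1 hx2 hx
  exact himp (dySum_eq_zero_of_coeff_le_exp hηc hηs hη0 hA' hθ1 hc' hδ hexp hr' hz') ξ

end

/-- Extension of a sequence on `ℕ` to `ℤ`, by zero at the nonpositive integers. -/
def extendPos (w : ℕ → ℝ) (m : ℤ) : ℝ := if 0 < m then w m.toNat else 0

theorem abs_extendPos_le {w : ℕ → ℝ} {A : ℝ} (hA : 0 ≤ A) (hw : ∀ n, |w n| ≤ A) (m : ℤ) :
    |extendPos w m| ≤ A := by
  unfold extendPos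
  split_ifs
  · exact hw _
  · simpa using hA

theorem exists_bound_of_limsup_lt_top {w : ℕ → ℝ}
    (hfin : atTop.limsup (fun n => ENNReal.ofReal |w n|) < ⊤) : ∃ A, 0 ≤ A ∧ ∀ n, |w n| ≤ A := by
  have h : ∀ᶠ n in atTop, |w n| ≤
      ((atTop.limsup (fun n => ENNReal.ofReal |w n|)) + 1).toReal := by
    have h1 : atTop.limsup (fun n => ENNReal.ofReal |w n|) <
        atTop.limsup (fun n => ENNReal.ofReal |w n|) + 1 := ENNReal.lt_add_right hfin.ne one_ne_zero
    filter_upwards [eventually_lt_of_limsup_lt h1] with n hn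
    exact (ENNReal.ofReal_le_iff_le_toReal (ENNReal.add_ne_top.2 ⟨hfin.ne, ENNReal.one_ne_top⟩)).1
      hn.le
  have hb : IsBoundedUnder (· ≤ ·) atTop fun n => |w n| := ⟨_, h⟩
  obtain ⟨A, hA⟩ := hb.bddAbove_range
  exact ⟨A, (abs_nonneg _).trans (hA ⟨0, rfl⟩), fun n => hA ⟨n, rfl⟩⟩

theorem exists_ultrafilter_tendsto_shift {w : ℕ → ℝ}
    (hpos : 0 < atTop.limsup (fun n => ENNReal.ofReal |w n|))
    (hfin : atTop.limsup (fun n => ENNReal.ofReal |w n|) < ⊤) :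
    ∃ (U : Ultrafilter ℕ) (b : ℤ → ℝ), (U : Filter ℕ) ≤ atTop ∧
      (∀ k : ℤ, Tendsto (fun N : ℕ => extendPos w (N + k)) U (𝓝 (b k))) ∧
      0 < |b 0| ∧ ∀ k, |b k| ≤ |b 0| := by
  obtain ⟨A, hA, hw⟩ := exists_bound_of_limsup_lt_top hfin
  set u : ℕ → ENNReal := fun n => ENNReal.ofReal |w n| with hu
  obtain ⟨U, hU, hUt⟩ := mapClusterPt_iff_ultrafilter.1 (MapClusterPt.limsup (f := atTop) (u := u))
  have hex : ∀ k : ℤ, ∃ b, Tendsto (fun N : ℕ => extendPos w (N + k)) U (𝓝 b) := fun k => by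
    obtain ⟨b, -, hb⟩ := (isCompact_Icc (a := -A) (b := A)).ultrafilter_le_nhds
      (U.map fun N : ℕ => extendPos w (N + k))
      (le_principal_iff.2 (Ultrafilter.mem_map.2 (Eventually.of_forall fun N : ℕ =>
        abs_le.1 (abs_extendPos_le hA hw ((N : ℤ) + k)))))
    exact ⟨b, hb⟩
  choose b hb using hex
  have hL : |b 0| = (atTop.limsup u).toReal := by
    have h1 : Tendsto (fun n => (u n).toReal) U (𝓝 (atTop.limsup u).toReal) :=
      (ENNReal.tendsto_toReal hfin.ne).comp hUt
    refine tendsto_nhds_unique (hb 0).abs (h1.congr' ?_)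
    filter_upwards [hU (eventually_gt_atTop 0)] with n hn
    simp [hu, extendPos, show 0 < n from hn]
  refine ⟨U, b, hU, hb, hL ▸ ENNReal.toReal_pos hpos.ne' hfin.ne, fun k => ?_⟩
  refine le_of_forall_pos_lt_add fun ε hε => ?_
  have h1 : atTop.limsup u < ENNReal.ofReal (|b 0| + ε / 2) := by
    rw [ENNReal.lt_ofReal_iff_toReal_lt hfin.ne, ← hL]; linarith
  obtain ⟨n₀, hn₀⟩ := eventually_atTop.1 (eventually_lt_of_limsup_lt h1)
  have h2 : |b k| ≤ |b 0| + ε / 2 := by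
    refine le_of_tendsto (hb k).abs ?_
    filter_upwards [hU (eventually_ge_atTop (n₀ + k.natAbs + 1))] with N hN
    have hpos : 0 < (N : ℤ) + k := by lia
    rw [extendPos, if_pos hpos]
    have := hn₀ ((N : ℤ) + k).toNat (by lia)
    exact ((ENNReal.ofReal_lt_ofReal_iff (by positivity)).1 this).le
  linarith

section
variable {ρ η : (Fin 4 → ℝ) → ℝ} {α : ℕ → ℝ} {θ A C : ℝ}

theorem norm_shiftCoeff_le {w : ℕ → ℝ} (hA : 0 ≤ A) (hθ : 0 < θ) (hw : ∀ n, |w n| ≤ A) (N : ℕ)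
    (k : ℤ) : ‖((extendPos w (N + k) * θ ^ (-k) : ℝ) : ℂ)‖ ≤ A * θ ^ (-k) := by
  rw [Complex.norm_real, norm_mul, Real.norm_eq_abs, Real.norm_of_nonneg (by positivity)]
  gcongr
  exact abs_extendPos_le hA hw _

theorem ft_famPL_succ (n N : ℕ) (hθ : 0 < θ) (ξ : Fin 4 → ℝ) :
    θ ^ N * ft (famPL α ρ η (n + 1)) (scl (2 ^ N) ξ) =
      ((extendPos (fun m => θ ^ m * α m) (N + (n + 1 - N : ℤ)) * θ ^ (-(n + 1 - N : ℤ)) : ℝ) : ℂ) *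
        ft η (scl ((2 : ℝ) ^ (-(n + 1 - N : ℤ))) ξ) := by
  have e : famPL α ρ η (n + 1) = fun z => α (n + 1) *
      (((2 : ℝ) ^ (n + 1)) ^ 5 * η (scl ((2 : ℝ) ^ (n + 1)) z)) := by
    unfold famPL
    rw [if_neg n.succ_ne_zero, mul_comm 5, pow_mul]
  have e2 : ((2 : ℝ) ^ (n + 1))⁻¹ * 2 ^ N = 2 ^ (-(n + 1 - N : ℤ)) := by
    rw [neg_sub, zpow_sub₀ two_ne_zero, zpow_natCast, div_eq_inv_mul]; norm_cast
  have e3 : θ ^ (-(n + 1 - N : ℤ)) = θ ^ N * (θ ^ (n + 1))⁻¹ := by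
    rw [neg_sub, zpow_sub₀ hθ.ne', zpow_natCast, div_eq_mul_inv]; norm_cast
  have e4 : extendPos (fun m => θ ^ m * α m) (N + (n + 1 - N : ℤ)) = θ ^ (n + 1) * α (n + 1) := by
    rw [add_sub_cancel, extendPos, if_pos (by positivity)]; rfl
  have h : (θ : ℂ) ≠ 0 := by exact_mod_cast hθ.ne'
  rw [e, ft_const_mul, ft_scl (by positivity), scl_scl, e2, e3, e4]
  push_cast
  field_simp

theorem scaled_tsum_ft_famPL (hA : 0 ≤ A) (hθ1 : 1 ≤ θ) (hθ2 : θ < 2)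
    (hw : ∀ n, |θ ^ n * α n| ≤ A) (hC : 0 ≤ C) (h1 : ∀ ξ, ‖ft η ξ‖ ≤ C * ‖ξ‖)
    (h2 : ∀ ξ, ‖ft η ξ‖ * ‖ξ‖ ≤ C) (N : ℕ) (ξ : Fin 4 → ℝ) :
    θ ^ N * ∑' n, ft (famPL α ρ η n) (scl (2 ^ N) ξ) =
      α 0 * (θ ^ N * ft ρ (scl (2 ^ N) ξ)) +
        dySum (fun k => ((extendPos (fun m => θ ^ m * α m) (N + k) * θ ^ (-k) : ℝ) : ℂ))
          (ft η) ξ := by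
  have hθ : 0 < θ := by linarith
  let c : ℤ → ℂ := fun k => ((extendPos (fun m => θ ^ m * α m) (N + k) * θ ^ (-k) : ℝ) : ℂ)
  let t : ℤ → ℂ := fun k => c k * ft η (scl ((2 : ℝ) ^ (-k)) ξ)
  have hs : Summable t :=
    summable_dySum hA hθ1 hθ2 (norm_shiftCoeff_le hA hθ hw N) hC h1 h2 ξ
  let i : ℕ → ℤ := fun n => (n : ℤ) + 1 - N
  have hi : Function.Injective i := fun m n h => by simp only [i] at h; lia
  have hterm : ∀ n : ℕ, θ ^ N * ft (famPL α ρ η (n + 1)) (scl (2 ^ N) ξ) = t (i n) := fun n =>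
    ft_famPL_succ n N hθ ξ
  have hθN : (θ : ℂ) ^ N ≠ 0 := pow_ne_zero _ (by exact_mod_cast hθ.ne')
  have hs1 : Summable fun n : ℕ => (θ : ℂ) ^ N * ft (famPL α ρ η (n + 1)) (scl (2 ^ N) ξ) :=
    (hs.comp_injective hi).congr fun n => (hterm n).symm
  have hs2 : Summable fun n : ℕ => (θ : ℂ) ^ N * ft (famPL α ρ η n) (scl (2 ^ N) ξ) :=
    (summable_nat_add_iff 1).1 hs1
  rw [← tsum_mul_left, hs2.tsum_eq_zero_add, tsum_congr hterm, hi.tsum_eq]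
  · congr 1
    rw [show famPL α ρ η 0 = fun z => α 0 * ρ z from if_pos rfl, ft_const_mul]
    ring
  · intro k hk
    refine ⟨(k + N - 1).toNat, ?_⟩
    by_contra hne
    refine hk ?_
    have : ¬ (0 < (N : ℤ) + k) := by simp only [i] at hne; lia
    simp [t, c, extendPos, this]

theorem tendsto_scaled_ft_zero (hθ1 : 0 ≤ θ) (hθ2 : θ < 2) (hρ : ContDiff ℝ 1 ρ)
    (hρs : HasCompactSupport ρ) {ξ : Fin 4 → ℝ} (hξ : ξ ≠ 0) :
    Tendsto (fun N : ℕ => (θ : ℂ) ^ N * ft ρ (scl (2 ^ N) ξ)) atTop (𝓝 0) := by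
  have hn : 0 < ‖ξ‖ := norm_pos_iff.2 hξ
  have hlim : Tendsto (fun N : ℕ => (θ / 2) ^ N * ((∫ z, ‖fderiv ℝ ρ z‖) / ‖ξ‖)) atTop (𝓝 0) := by
    simpa using (tendsto_pow_atTop_nhds_zero_of_lt_one (by positivity)
      (by linarith : θ / 2 < 1)).mul_const ((∫ z, ‖fderiv ℝ ρ z‖) / ‖ξ‖)
  refine squeeze_zero_norm (fun N => ?_) hlim
  have h := norm_mul_ft_le hρ hρs (scl (2 ^ N) ξ)
  have h' := le_norm_scl (l := (2 : ℝ) ^ N) (one_le_pow₀ (by norm_num)) ξ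
  have h3 : ‖ft ρ (scl (2 ^ N) ξ)‖ ≤ (∫ z, ‖fderiv ℝ ρ z‖) / (2 ^ N * ‖ξ‖) := by
    rw [le_div_iff₀ (by positivity)]
    exact (mul_le_mul_of_nonneg_left h' (norm_nonneg _)).trans h
  rw [norm_mul, norm_pow, Complex.norm_real, Real.norm_of_nonneg hθ1]
  calc _ ≤ θ ^ N * ((∫ z, ‖fderiv ℝ ρ z‖) / (2 ^ N * ‖ξ‖)) := by gcongr
    _ = _ := by rw [div_pow]; field_simp

theorem tendsto_scaled_tsum_ft_famPL (hA : 0 ≤ A) (hθ1 : 1 ≤ θ) (hθ2 : θ < 2)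
    (hw : ∀ n, |θ ^ n * α n| ≤ A) (hρ : ContDiff ℝ 1 ρ) (hρs : HasCompactSupport ρ)
    (hC : 0 ≤ C) (h1 : ∀ ξ, ‖ft η ξ‖ ≤ C * ‖ξ‖)
    (h2 : ∀ ξ, ‖ft η ξ‖ * ‖ξ‖ ≤ C) {U : Filter ℕ} (hU : U ≤ atTop) {b : ℤ → ℝ}
    (hb : ∀ k : ℤ, Tendsto (fun N : ℕ => extendPos (fun m => θ ^ m * α m) (N + k)) U (𝓝 (b k)))
    {ξ : Fin 4 → ℝ} (hξ : ξ ≠ 0) :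
    Tendsto (fun N : ℕ => (θ : ℂ) ^ N * ∑' n, ft (famPL α ρ η n) (scl (2 ^ N) ξ)) U
      (𝓝 (dySum (fun k => ((b k * θ ^ (-k) : ℝ) : ℂ)) (ft η) ξ)) := by
  have hθ : 0 < θ := by linarith
  simp_rw [scaled_tsum_ft_famPL hA hθ1 hθ2 hw hC h1 h2]
  have ha := ((tendsto_scaled_ft_zero hθ.le hθ2 hρ hρs hξ).mono_left hU).const_mul (α 0 : ℂ)
  rw [mul_zero] at ha
  rw [← zero_add (dySum _ _ _)]
  refine ha.add (tendsto_tsum_of_dominated_convergence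
    (bound := fun k : ℤ => A * C * (‖ξ‖ + ‖ξ‖⁻¹) * (θ / 2) ^ k.natAbs)
    ((summable_pow_natAbs (by positivity) (by linarith : θ / 2 < 1)).mul_left _)
    (fun k => ?_) (Eventually.of_forall fun N k => ?_))
  · exact ((Complex.continuous_ofReal.tendsto _).comp ((hb k).mul_const _)).mul_const _
  · rw [norm_mul]
    exact norm_dySum_term_le hA hθ1 (norm_shiftCoeff_le hA hθ hw N) hC h1 h2 hξ k

theorem dySum_ne_zero_of_dominant {g : (Fin 4 → ℝ) → ℂ} {b : ℤ → ℝ} (hθ1 : 1 ≤ θ) (hθ2 : θ < 2)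
    (hC : 0 ≤ C) (h1 : ∀ ξ, ‖g ξ‖ ≤ C * ‖ξ‖) (h2 : ∀ ξ, ‖g ξ‖ * ‖ξ‖ ≤ C)
    (hb0 : 0 < |b 0|) (hb : ∀ k, |b k| ≤ |b 0|) {ξ : Fin 4 → ℝ}
    (hdom : ∑' k : {m : ℤ // m ≠ 0}, θ ^ (-(k : ℤ)) * ‖g (scl ((2 : ℝ) ^ (-(k : ℤ))) ξ)‖ < ‖g ξ‖) :
    dySum (fun k => ((b k * θ ^ (-k) : ℝ) : ℂ)) g ξ ≠ 0 := by
  have hθ : 0 < θ := by linarith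
  have hc : ∀ k : ℤ, ‖((b k * θ ^ (-k) : ℝ) : ℂ)‖ ≤ |b 0| * θ ^ (-k) := fun k => by
    rw [Complex.norm_real, norm_mul, Real.norm_eq_abs, Real.norm_of_nonneg (by positivity)]
    exact mul_le_mul_of_nonneg_right (hb k) (by positivity)
  have hs := summable_dySum hb0.le hθ1 hθ2 hc hC h1 h2 ξ
  have hs' : Summable fun k : ℤ => θ ^ (-k) * ‖g (scl ((2 : ℝ) ^ (-k)) ξ)‖ := by
    have hc1 : ∀ k : ℤ, ‖((θ ^ (-k) : ℝ) : ℂ)‖ ≤ 1 * θ ^ (-k) := fun k => by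
      rw [Complex.norm_real, Real.norm_of_nonneg (by positivity), one_mul]
    refine (summable_dySum zero_le_one hθ1 hθ2 hc1 hC h1 h2 ξ).norm.congr fun k => ?_
    rw [norm_mul, Complex.norm_real, Real.norm_of_nonneg (by positivity)]
  intro h0
  rw [dySum, ← hs.tsum_subtype_add_tsum_subtype_compl {0}] at h0
  rw [tsum_singleton (0 : ℤ)
    (fun k => ((b k * θ ^ (-k) : ℝ) : ℂ) * g (scl ((2 : ℝ) ^ (-k)) ξ))] at h0
  have hle : ‖∑' k : ({0}ᶜ : Set ℤ), ((b k * θ ^ (-(k : ℤ)) : ℝ) : ℂ) *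
      g (scl ((2 : ℝ) ^ (-(k : ℤ))) ξ)‖ ≤ ∑' k : ({0}ᶜ : Set ℤ),
        |b 0| * (θ ^ (-(k : ℤ)) * ‖g (scl ((2 : ℝ) ^ (-(k : ℤ))) ξ)‖) := by
    refine tsum_of_norm_bounded ((hs'.subtype _).mul_left _).hasSum fun k => ?_
    rw [norm_mul]
    exact (mul_le_mul_of_nonneg_right (hc _) (norm_nonneg _)).trans (mul_assoc _ _ _).le
  rw [tsum_mul_left] at hle
  have h3 := hle.trans_lt (mul_lt_mul_of_pos_left hdom hb0)
  have h4 := congrArg norm (eq_neg_of_add_eq_zero_left h0)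
  rw [norm_neg] at h4
  simp only [neg_zero, zpow_zero, mul_one, scl_one, norm_mul, Complex.norm_real,
    Real.norm_eq_abs] at h4
  exact h3.ne h4.symm

end

theorem snorm4_scl {l : ℝ} (hl : 0 < l) (z : Fin 4 → ℝ) : snorm4 (scl l z) = l * snorm4 z := by
  unfold snorm4
  rw [Real.mul_iSup_of_nonneg hl.le]
  congr 1; ext i
  have h0 : (sExp i : ℝ) ≠ 0 := by exact_mod_cast (Nat.one_le_iff_ne_zero.1 (one_le_sExp i))
  rw [scl, abs_mul, abs_of_pos (by positivity), Real.mul_rpow (by positivity) (abs_nonneg _),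
    ← Real.rpow_natCast, ← Real.rpow_mul hl.le, mul_inv_cancel₀ h0, Real.rpow_one]

theorem snorm4_pos {z : Fin 4 → ℝ} (hz : z ≠ 0) : 0 < snorm4 z := by
  obtain ⟨i, hi⟩ := Function.ne_iff.1 hz
  have : 0 < |z i| := abs_pos.2 hi
  exact (by positivity : 0 < |z i| ^ ((sExp i : ℝ)⁻¹)).trans_le
    (le_ciSup (f := fun i => |z i| ^ ((sExp i : ℝ)⁻¹)) (Set.finite_range _).bddAbove i)

theorem scl_mem_AnC {C : ℝ} {z : Fin 4 → ℝ} (hz : z ≠ 0)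
    (hC : snorm4 z + (snorm4 z)⁻¹ ≤ C) (N : ℕ) : scl (2 ^ N) z ∈ AnC C N := by
  have h := snorm4_pos hz
  have h' : 0 < (snorm4 z)⁻¹ := inv_pos.2 h
  refine ⟨?_, ?_⟩ <;> rw [snorm4_scl (by positivity), mul_comm (2 ^ N)]
  · gcongr
    exact inv_le_of_inv_le₀ h (by linarith)
  · gcongr
    linarith

theorem limsup_pos_of_tendsto_along {θ C : ℝ} {F : (Fin 4 → ℝ) → ℂ} {G : (Fin 4 → ℝ) → ℂ}
    {U : Filter ℕ} [U.NeBot] (hU : U ≤ atTop)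
    (hF : ∀ ξ, ξ ≠ 0 → Tendsto (fun N : ℕ => (θ : ℂ) ^ N * F (scl (2 ^ N) ξ)) U (𝓝 (G ξ)))
    (hθ : 0 ≤ θ) {ξ ζ : Fin 4 → ℝ} (hξ : ξ ≠ 0) (hζ : ζ ≠ 0) (hξζ : ξ + ζ ≠ 0)
    (hGξ : G ξ ≠ 0) (hGζ : G ζ ≠ 0) (hGξζ : G (ξ + ζ) ≠ 0)
    (hC : ∀ z ∈ ({ξ, ζ, ξ + ζ} : Set (Fin 4 → ℝ)), snorm4 z + (snorm4 z)⁻¹ ≤ C) :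
    0 < atTop.limsup fun N : ℕ => ENNReal.ofReal ((θ ^ N) ^ 3) *
      ⨆ p ∈ BnC C N, (‖F p.1 * F p.2 * F (p.1 + p.2)‖₊ : ENNReal) := by
  have ht := (((hF ξ hξ).mul (hF ζ hζ)).mul (hF _ hξζ)).norm
  have hδ : 0 < ‖G ξ * G ζ * G (ξ + ζ)‖ := norm_pos_iff.2 (mul_ne_zero (mul_ne_zero hGξ hGζ) hGξζ)
  obtain ⟨δ, hδ0, hδ1⟩ := exists_between hδ
  refine (ENNReal.ofReal_pos.2 hδ0).trans_le (le_limsup_of_frequently_le ?_)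
  refine Frequently.filter_mono (Eventually.frequently ?_) hU
  filter_upwards [ht.eventually_const_lt hδ1] with N hN
  have hmem : (scl (2 ^ N) ξ, scl (2 ^ N) ζ) ∈ BnC C N := by
    refine ⟨scl_mem_AnC hξ (hC _ (by simp)) N, scl_mem_AnC hζ (hC _ (by simp)) N, ?_⟩
    rw [← scl_add]
    exact scl_mem_AnC hξζ (hC _ (by simp)) N
  refine le_trans ?_ (mul_le_mul_right (le_iSup₂_of_le _ hmem le_rfl) _)
  rw [← enorm_eq_nnnorm, ← ofReal_norm, ← ENNReal.ofReal_mul (by positivity), ← scl_add]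
  refine ENNReal.ofReal_le_ofReal (hN.le.trans (le_of_eq ?_))
  simp only [norm_mul, norm_pow, Complex.norm_real, Real.norm_of_nonneg hθ]
  ring

theorem exists_triple_ne_zero {G : (Fin 4 → ℝ) → ℂ} {ξ : Fin 4 → ℝ} (hξ : G ξ ≠ 0)
    (hcont : ContinuousAt G ξ)
    (hnear : ∀ r, 0 < r → (∀ ζ, ‖ζ‖ < r → G ζ = 0) → ∀ ζ, G ζ = 0) :
    ∃ ζ, G ζ ≠ 0 ∧ G (ξ + ζ) ≠ 0 := by
  obtain ⟨r, hr, h⟩ := Metric.eventually_nhds_iff.1 (hcont.eventually_ne hξ)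
  by_contra! hcon
  refine hξ (hnear r hr (fun ζ hζ => ?_) ξ)
  by_contra hne
  exact h (y := ξ + ζ) (by simpa [dist_eq_norm] using hζ) (hcon ζ hne)

/-- part of Proposition 2.5 of the paper.  In the Littlewood--Paley
setting, if 0 ≤ β < 1/2 and limsup 2^(nβ)|αₙ| ∈ (0,∞), then Assumption Rough holds:
for some C ≥ 1, limsup_n 2^(3nβ) sup_((ξ,ξ') ∈ B_n^C) |R̂(ξ)R̂(ξ')R̂(ξ+ξ')| > 0. -/
theorem stmt3 (β : ℝ) (hβ : 0 ≤ β) (hβhalf : β < 1 / 2)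
    (ρ : (Fin 4 → ℝ) → ℝ) (hρsmooth : ContDiff ℝ (⊤ : ℕ∞) ρ)
    (hρeven : ∀ z, ρ (-z) = ρ z) (hρsupp : HasCompactSupport ρ)
    (hρint : (∫ z, ρ z) = 1)
    (η : (Fin 4 → ℝ) → ℝ)
    (hη : η = fun x => ρ x - ((2 : ℝ) ^ (5 : ℕ))⁻¹ * ρ (scl (2⁻¹ : ℝ) x))
    (ξ0 : Fin 4 → ℝ)
    (hξ0 : 0 < ‖ft η ξ0‖ -
      ∑' n : {m : ℤ // m ≠ 0},
        (2 : ℝ) ^ (-((n : ℤ) : ℝ) * β) * ‖ft η (scl ((2 : ℝ) ^ (-((n : ℤ) : ℝ))) ξ0)‖)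
    (α : ℕ → ℝ) (hα : ∃ M : ℝ, ∀ n, |α n| ≤ M)
    (hαpos : 0 < Filter.atTop.limsup
        (fun n : ℕ => ENNReal.ofReal ((2 : ℝ) ^ ((n : ℝ) * β) * |α n|)))
    (hαfin : Filter.atTop.limsup
        (fun n : ℕ => ENNReal.ofReal ((2 : ℝ) ^ ((n : ℝ) * β) * |α n|)) < ⊤)
    (Rhat : (Fin 4 → ℝ) → ℂ)
    (hRhat : Rhat = fun ξ => ∑' n : ℕ, ft (famPL α ρ η n) ξ) :
    ∃ C : ℝ, 1 ≤ C ∧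
      0 < Filter.atTop.limsup (fun n : ℕ =>
        ENNReal.ofReal ((2 : ℝ) ^ (3 * (n : ℝ) * β)) *
          ⨆ p ∈ BnC C n, (‖Rhat p.1 * Rhat p.2 * Rhat (p.1 + p.2)‖₊ : ENNReal)) := by
  set θ : ℝ := (2 : ℝ) ^ β with hθdef
  have hθ1 : 1 ≤ θ := Real.one_le_rpow one_le_two hβ
  have hθ2 : θ < 2 := Real.rpow_lt_self_of_one_lt one_lt_two (by linarith)
  have hθ : 0 < θ := by linarith
  have hθn : ∀ n : ℕ, (2 : ℝ) ^ ((n : ℝ) * β) = θ ^ n := fun n => by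
    rw [hθdef, ← Real.rpow_natCast, ← Real.rpow_mul zero_le_two, mul_comm]
  have hρ1 : ContDiff ℝ 1 ρ := hρsmooth.of_le (by exact_mod_cast le_top)
  have hηd : ContDiff ℝ 1 η := by
    rw [hη]
    exact hρ1.sub (contDiff_const.mul (hρ1.comp (contDiff_scl _)))
  have hηs : HasCompactSupport η := by
    rw [hη]
    exact hρsupp.sub (hasCompactSupport_comp_scl hρsupp (by norm_num)).mul_left
  have hηe : ∀ z, η (-z) = η z := fun z => by
    have : scl (2⁻¹ : ℝ) (-z) = -scl 2⁻¹ z := by simpa using scl_smul 2⁻¹ (-1) z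
    simp only [hη, this, hρeven]
  have hηft := ft_sub_scl hρ1.continuous hρsupp hη
  have hη0 : ∫ z, η z = 0 := by
    have := hηft 0
    rw [scl_zero_right, sub_self, ft_zero] at this
    exact_mod_cast this
  obtain ⟨C, hC, h1, h2⟩ : ∃ C, 0 ≤ C ∧ (∀ ξ, ‖ft η ξ‖ ≤ C * ‖ξ‖) ∧
      ∀ ξ, ‖ft η ξ‖ * ‖ξ‖ ≤ C := by
    obtain ⟨C, hC, h⟩ := norm_ft_le_mul_norm hηd.continuous hηs hη0
    exact ⟨max C (∫ z, ‖fderiv ℝ η z‖), hC.trans (le_max_left _ _),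
      fun ξ => (h ξ).trans (by gcongr; exact le_max_left _ _),
      fun ξ => (norm_mul_ft_le hηd hηs ξ).trans (le_max_right _ _)⟩
  have hu : (fun n : ℕ => ENNReal.ofReal ((2 : ℝ) ^ ((n : ℝ) * β) * |α n|)) =
      fun n => ENNReal.ofReal |θ ^ n * α n| := by
    ext n
    rw [hθn, abs_mul, abs_of_pos (pow_pos hθ n)]
  rw [hu] at hαpos hαfin
  obtain ⟨A, hA, hw⟩ := exists_bound_of_limsup_lt_top hαfin
  obtain ⟨U, b, hU, hb, hb0, hbL⟩ := exists_ultrafilter_tendsto_shift hαpos hαfin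
  let c : ℤ → ℂ := fun k => ((b k * θ ^ (-k) : ℝ) : ℂ)
  have hc : ∀ k, ‖c k‖ ≤ |b 0| * θ ^ (-k) := fun k => by
    rw [Complex.norm_real, norm_mul, Real.norm_eq_abs, Real.norm_of_nonneg (by positivity)]
    exact mul_le_mul_of_nonneg_right (hbL k) (by positivity)
  have hlim : ∀ ξ, ξ ≠ 0 → Tendsto (fun N : ℕ => (θ : ℂ) ^ N * Rhat (scl (2 ^ N) ξ)) U
      (𝓝 (dySum c (ft η) ξ)) := fun ξ hξ => by
    rw [hRhat]
    exact tendsto_scaled_tsum_ft_famPL hA hθ1 hθ2 hw hρ1 hρsupp hC h1 h2 hU hb hξ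
  have hdom : ∑' k : {m : ℤ // m ≠ 0},
      θ ^ (-(k : ℤ)) * ‖ft η (scl ((2 : ℝ) ^ (-(k : ℤ))) ξ0)‖ < ‖ft η ξ0‖ := by
    refine lt_of_eq_of_lt (tsum_congr fun k => ?_) (sub_pos.1 hξ0)
    have e1 : (2 : ℝ) ^ (-((k : ℤ) : ℝ)) = 2 ^ (-(k : ℤ)) := by
      rw [← Real.rpow_intCast, Int.cast_neg]
    have e2 : (2 : ℝ) ^ (-((k : ℤ) : ℝ) * β) = θ ^ (-(k : ℤ)) := by
      rw [hθdef, ← Real.rpow_intCast, ← Real.rpow_mul zero_le_two, Int.cast_neg, mul_comm]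
    rw [e1, e2]
  have hF0 : dySum c (ft η) ξ0 ≠ 0 := dySum_ne_zero_of_dominant hθ1 hθ2 hC h1 h2 hb0 hbL hdom
  have hne : ∀ ξ, dySum c (ft η) ξ ≠ 0 → ξ ≠ 0 := by
    rintro _ h rfl
    have h0 : ft η 0 = 0 := by rw [ft_zero, hη0, Complex.ofReal_zero]
    exact h (by simp [dySum, scl_zero_right, h0])
  obtain ⟨ζ, hζ, hζ'⟩ := exists_triple_ne_zero hF0
    (continuousAt_dySum hb0.le hθ1 hθ2 hc hC (continuous_ft hηd.continuous hηs) h1 h2 (hne _ hF0))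
    fun r hr hz => dySum_eq_zero_of_eq_zero_near hρ1 hρsupp hρint hηd hηs hηe hηft hb0.le hθ1 hθ2
      hc hr hz
  have hs : ∀ z : Fin 4 → ℝ, z ≠ 0 → 0 ≤ snorm4 z + (snorm4 z)⁻¹ := fun z hz => by
    have := snorm4_pos hz
    positivity
  have hs1 := hs _ (hne _ hF0)
  have hs2 := hs _ (hne _ hζ)
  have hs3 := hs _ (hne _ hζ')
  refine ⟨1 + (snorm4 ξ0 + (snorm4 ξ0)⁻¹) + (snorm4 ζ + (snorm4 ζ)⁻¹) +
    (snorm4 (ξ0 + ζ) + (snorm4 (ξ0 + ζ))⁻¹), by linarith, ?_⟩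
  have h3 : ∀ N : ℕ, (2 : ℝ) ^ (3 * (N : ℝ) * β) = (θ ^ N) ^ 3 := fun N => by
    rw [← pow_mul, ← hθn]
    congr 1
    push_cast; ring
  simp_rw [h3]
  refine limsup_pos_of_tendsto_along hU hlim hθ.le (hne _ hF0) (hne _ hζ) (hne _ hζ') hF0 hζ hζ' ?_
  rintro z (rfl | rfl | rfl) <;> linarith
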